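/- Let n ≥ 2, let U ⊆ ℝⁿ be open and connected, let a_{ij} : U → ℝ (1 ≤ i,j ≤ n) be smooth with a_{ij} = a_{ji} and ∑_{i,j} a_{ij}(x) ξᵢ ξⱼ > 0 for all x ∈ U and ξ ∈ ℝⁿ \ {0}, and let F : U × ℝ × ℝⁿ → ℝ be smooth with F(x, 0, 0) = 0 for all x ∈ U. Let u : U → ℝ be a smooth solution of −∑_{i,j} a_{ij}(x) (∂²u/∂xᵢ∂xⱼ)(x) + F(x, u(x), ∇u(x)) = 0 with u not identically zero. Then the critical nodal set N_crit(u) = {x ∈ U : u(x) = 0 and ∇u(x) = 0} is countably (n−2)-C∞-rectifiable and has locally finite (n−2)-dimensional Hausdorff measure: every p ∈ U admits r > 0 with μH^{n−2}(N_crit(u) ∩ B(p,r)) < ∞. In particular dimH(N_crit(u)) ≤ n − 2. -/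

import Mathlib

open MeasureTheory Metric Set Filter Topology ENNReal NNReal

noncomputable section

/-- `m`-dimensional Euclidean space. -/
abbrev Euc (m : ℕ) := EuclideanSpace ℝ (Fin m)

/-- The semilinear first-order differential operator `φ ↦ ∑ⱼ Aⱼ(x) ∂φ/∂xⱼ + V(x, φ(x))`
applied to `φ` at the point `x`. -/
def semilinApply {n N : ℕ} (A : Fin n → Euc n → Matrix (Fin N) (Fin N) ℝ)
    (V : Euc n → (Fin N → ℝ) → (Fin N → ℝ)) (φ : Euc n → (Fin N → ℝ)) (x : Euc n) :
    Fin N → ℝ :=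
  (∑ j, (A j x).mulVec (fderiv ℝ φ x (EuclideanSpace.single j 1))) + V x (φ x)

/-- Ellipticity of the principal symbol `ξ ↦ ∑ⱼ ξⱼ Aⱼ(x)` at every point of `U`. -/
def IsElliptic {n N : ℕ} (A : Fin n → Euc n → Matrix (Fin N) (Fin N) ℝ)
    (U : Set (Euc n)) : Prop :=
  ∀ x ∈ U, ∀ ξ : Euc n, ξ ≠ 0 → IsUnit (∑ j, ξ j • A j x)

/-- A set `S ⊆ ℝⁿ` is countably `m`-`C^∞`-rectifiable if it is contained in a countable
union of ranges of smooth maps `ℝᵐ → ℝⁿ`. -/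
def CountablyCinfRectifiable {n : ℕ} (m : ℕ) (S : Set (Euc n)) : Prop :=
  ∃ g : ℕ → (Euc m → Euc n), (∀ i, ContDiff ℝ (⊤ : ℕ∞) (g i)) ∧ S ⊆ ⋃ i, range (g i)

/-- The scalar semilinear second-order operator
`u ↦ −∑_{i,j} a_{ij}(x) ∂²u/∂xᵢ∂xⱼ + F(x, u(x), ∇u(x))` applied to `u` at `x`. -/
def scalarOp {n : ℕ} (a : Fin n → Fin n → Euc n → ℝ)
    (F : Euc n → ℝ → Euc n → ℝ) (u : Euc n → ℝ) (x : Euc n) : ℝ :=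
  -(∑ i, ∑ j, a i j x *
      iteratedFDeriv ℝ 2 u x ![EuclideanSpace.single i 1, EuclideanSpace.single j 1])
    + F x (u x) (gradient u x)

/-- The `i`-th partial derivative of a function on `ℝⁿ`. -/
def pd {n : ℕ} (i : Fin n) (f : Euc n → ℝ) (x : Euc n) : ℝ :=
  fderiv ℝ f x (EuclideanSpace.single i 1)

section PartialDerivatives

variable {n : ℕ} {U : Set (Euc n)} {f g : Euc n → ℝ} {x : Euc n}

theorem ContDiffOn.differentiableAt_of_isOpen (hU : IsOpen U)
    (hf : ContDiffOn ℝ (⊤ : ℕ∞) f U) (hx : x ∈ U) : DifferentiableAt ℝ f x :=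
  (hf.contDiffAt (hU.mem_nhds hx)).differentiableAt (by simp)

theorem ContDiffOn.pd (hU : IsOpen U) (hf : ContDiffOn ℝ (⊤ : ℕ∞) f U) (i : Fin n) :
    ContDiffOn ℝ (⊤ : ℕ∞) (pd i f) U := by
  have h := hf.fderiv_of_isOpen hU (m := (⊤ : ℕ∞)) (by simp)
  exact h.clm_apply contDiffOn_const

theorem ContDiff.pd (hf : ContDiff ℝ (⊤ : ℕ∞) f) (i : Fin n) :
    ContDiff ℝ (⊤ : ℕ∞) (pd i f) := by
  rw [← contDiffOn_univ] at *
  exact hf.pd isOpen_univ i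

theorem pd_eq_of_eventuallyEq (h : f =ᶠ[𝓝 x] g) (i : Fin n) : pd i f x = pd i g x := by
  simp [pd, h.fderiv_eq]

theorem pd_congr (hU : IsOpen U) (h : EqOn f g U) (i : Fin n) : EqOn (pd i f) (pd i g) U :=
  fun _ hx => pd_eq_of_eventuallyEq (h.eventuallyEq_of_mem (hU.mem_nhds hx)) i

theorem pd_add (hf : DifferentiableAt ℝ f x) (hg : DifferentiableAt ℝ g x) (i : Fin n) :
    pd i (fun y => f y + g y) x = pd i f x + pd i g x := by
  simp [pd, fderiv_fun_add hf hg]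

theorem pd_sub (hf : DifferentiableAt ℝ f x) (hg : DifferentiableAt ℝ g x) (i : Fin n) :
    pd i (fun y => f y - g y) x = pd i f x - pd i g x := by
  simp [pd, fderiv_fun_sub hf hg]

theorem pd_mul (hf : DifferentiableAt ℝ f x) (hg : DifferentiableAt ℝ g x) (i : Fin n) :
    pd i (fun y => f y * g y) x = pd i f x * g x + f x * pd i g x := by
  simp [pd, fderiv_fun_mul hf hg]; ring

@[simp] theorem pd_const (c : ℝ) (i : Fin n) : pd i (fun _ : Euc n => c) = fun _ => 0 := by
  ext; simp [pd]

theorem pd_const_mul (c : ℝ) (hf : DifferentiableAt ℝ f x) (i : Fin n) :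
    pd i (fun y => c * f y) x = c * pd i f x := by
  simp [pd, fderiv_const_mul hf]

theorem pd_sum {ι : Type*} (s : Finset ι) {F : ι → Euc n → ℝ}
    (hF : ∀ j ∈ s, DifferentiableAt ℝ (F j) x) (i : Fin n) :
    pd i (fun y => ∑ j ∈ s, F j y) x = ∑ j ∈ s, pd i (F j) x := by
  simp [pd, fderiv_fun_sum hF]

theorem two_le_coe_top : (2 : WithTop ℕ∞) ≤ ((⊤ : ℕ∞) : WithTop ℕ∞) :=
  WithTop.coe_le_coe.2 (le_top : (2 : ℕ∞) ≤ ⊤)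

theorem pd_comm (hU : IsOpen U) (hf : ContDiffOn ℝ (⊤ : ℕ∞) f U) (i j : Fin n) :
    EqOn (pd i (pd j f)) (pd j (pd i f)) U := by
  intro x hx
  have hc := hf.contDiffAt (hU.mem_nhds hx)
  have hs := hc.isSymmSndFDerivAt (by simpa using two_le_coe_top)
  have hd : DifferentiableAt ℝ (fderiv ℝ f) x :=
    (hc.fderiv_right (m := 1)
      (by simpa [one_add_one_eq_two] using two_le_coe_top)).differentiableAt (by simp)
  have key : ∀ k l : Fin n, pd k (pd l f) x
      = fderiv ℝ (fderiv ℝ f) x (EuclideanSpace.single k 1) (EuclideanSpace.single l 1) := by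
    intro k l
    have : pd l f = fun y => fderiv ℝ f y (EuclideanSpace.single l 1) := rfl
    rw [pd, this, fderiv_clm_apply hd (differentiableAt_const _)]
    simp
  rw [key, key]
  exact hs _ _

theorem iteratedFDeriv_two_eq_pd (hU : IsOpen U) (hf : ContDiffOn ℝ (⊤ : ℕ∞) f U) (hx : x ∈ U)
    (i j : Fin n) :
    iteratedFDeriv ℝ 2 f x ![EuclideanSpace.single i 1, EuclideanSpace.single j 1]
      = pd i (pd j f) x := by
  have hc := hf.contDiffAt (hU.mem_nhds hx)
  have hd : DifferentiableAt ℝ (fderiv ℝ f) x :=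
    (hc.fderiv_right (m := 1)
      (by simpa [one_add_one_eq_two] using two_le_coe_top)).differentiableAt (by simp)
  have : pd j f = fun y => fderiv ℝ f y (EuclideanSpace.single j 1) := rfl
  rw [iteratedFDeriv_two_apply, pd, this, fderiv_clm_apply hd (differentiableAt_const _)]
  simp

theorem fderiv_apply_eq_sum_pd (f : Euc n → ℝ) (x v : Euc n) :
    fderiv ℝ f x v = ∑ i, v i * pd i f x := by
  conv_lhs => rw [← (EuclideanSpace.basisFun (Fin n) ℝ).sum_repr v]
  simp [pd, map_sum]

theorem gradient_apply_eq_pd (f : Euc n → ℝ) (x : Euc n) (i : Fin n) :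
    gradient f x i = pd i f x := by
  have h := InnerProductSpace.toDual_symm_apply (𝕜 := ℝ) (x := EuclideanSpace.single i (1:ℝ))
    (y := fderiv ℝ f x)
  have h2 : inner ℝ (gradient f x) (EuclideanSpace.single i (1:ℝ)) = gradient f x i := by
    rw [EuclideanSpace.inner_single_right]; simp
  rw [← h2, gradient, h, pd]

end PartialDerivatives

/-- All derivatives of `f` of order less than `k` vanish at `p`. -/
def SFlat {n : ℕ} : ℕ → (Euc n → ℝ) → Euc n → Prop
  | 0, _, _ => True
  | k + 1, f, p => f p = 0 ∧ ∀ i, SFlat k (pd i f) p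

namespace SFlat

variable {n : ℕ} {U : Set (Euc n)} {f g : Euc n → ℝ} {p : Euc n} {k l : ℕ}

theorem congr (hU : IsOpen U) (hp : p ∈ U) (h : EqOn f g U) (hf : SFlat k f p) :
    SFlat k g p := by
  induction k generalizing f g with
  | zero => trivial
  | succ k ih => exact ⟨(h hp) ▸ hf.1, fun i => ih (pd_congr hU h i) (hf.2 i)⟩

theorem of_succ (hf : SFlat (k + 1) f p) : SFlat k f p := by
  induction k generalizing f with
  | zero => trivial
  | succ k ih => exact ⟨hf.1, fun i => ih (hf.2 i)⟩

theorem mono (h : l ≤ k) (hf : SFlat k f p) : SFlat l f p := by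
  induction h with
  | refl => exact hf
  | step _ ih => exact ih hf.of_succ

theorem zero : SFlat k (fun _ : Euc n => (0 : ℝ)) p := by
  induction k with
  | zero => trivial
  | succ k ih => exact ⟨rfl, fun i => by simpa using ih⟩

theorem add (hU : IsOpen U) (hp : p ∈ U) (sf : ContDiffOn ℝ (⊤ : ℕ∞) f U)
    (sg : ContDiffOn ℝ (⊤ : ℕ∞) g U) (hf : SFlat k f p) (hg : SFlat k g p) :
    SFlat k (fun x => f x + g x) p := by
  induction k generalizing f g with
  | zero => trivial
  | succ k ih =>
    refine ⟨by simp [hf.1, hg.1], fun i => ?_⟩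
    refine (ih (sf.pd hU i) (sg.pd hU i) (hf.2 i) (hg.2 i)).congr hU hp fun x hx => ?_
    exact (pd_add (sf.differentiableAt_of_isOpen hU hx)
      (sg.differentiableAt_of_isOpen hU hx) i).symm

theorem sum (hU : IsOpen U) (hp : p ∈ U) {ι : Type*} (s : Finset ι) {F : ι → Euc n → ℝ}
    (sF : ∀ j, ContDiffOn ℝ (⊤ : ℕ∞) (F j) U) (hF : ∀ j, SFlat k (F j) p) :
    SFlat k (fun x => ∑ j ∈ s, F j x) p := by
  classical
  induction s using Finset.induction_on with
  | empty => simpa using SFlat.zero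
  | insert a s ha ih =>
    simp only [Finset.sum_insert ha]
    exact add hU hp (sF a) (ContDiffOn.sum fun j _ => sF j) (hF a) ih

theorem mul (hU : IsOpen U) (hp : p ∈ U) (sf : ContDiffOn ℝ (⊤ : ℕ∞) f U)
    (sg : ContDiffOn ℝ (⊤ : ℕ∞) g U) (hf : SFlat k f p) (hg : SFlat l g p) :
    SFlat (k + l) (fun x => f x * g x) p := by
  induction h : k + l generalizing f g k l with
  | zero => trivial
  | succ m ih =>
    have hz : f p * g p = 0 := by
      rcases k with _ | k
      · rcases l with _ | l
        · omega
        · simp [hg.1]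
      · simp [hf.1]
    refine ⟨hz, fun i => ?_⟩
    have e : EqOn (fun x => pd i f x * g x + f x * pd i g x) (pd i fun x => f x * g x) U :=
      fun x hx => (pd_mul (sf.differentiableAt_of_isOpen hU hx)
        (sg.differentiableAt_of_isOpen hU hx) i).symm
    refine SFlat.congr hU hp e (add hU hp ((sf.pd hU i).mul sg) (sf.mul (sg.pd hU i)) ?_ ?_)
    · rcases k with _ | k
      · rcases l with _ | l
        · omega
        · exact ih (k := 0) (l := m) (sf.pd hU i) sg trivial (hg.mono (by omega)) (by omega)
      · exact ih (sf.pd hU i) sg (hf.2 i) hg (by omega)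
    · rcases l with _ | l
      · exact ih (k := m) (l := 0) sf (sg.pd hU i) (hf.mono (by omega)) trivial (by omega)
      · exact ih sf (sg.pd hU i) hf (hg.2 i) (by omega)

theorem mul_left (hU : IsOpen U) (hp : p ∈ U) (sf : ContDiffOn ℝ (⊤ : ℕ∞) f U)
    (sg : ContDiffOn ℝ (⊤ : ℕ∞) g U) (hg : SFlat k g p) :
    SFlat k (fun x => f x * g x) p := by
  simpa using mul (k := 0) hU hp sf sg trivial hg

theorem sub (hU : IsOpen U) (hp : p ∈ U) (sf : ContDiffOn ℝ (⊤ : ℕ∞) f U)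
    (sg : ContDiffOn ℝ (⊤ : ℕ∞) g U) (hf : SFlat k f p) (hg : SFlat k g p) :
    SFlat k (fun x => f x - g x) p := by
  have := add hU hp sf (contDiffOn_const.mul sg) hf
    (mul_left hU hp (f := fun _ => -1) contDiffOn_const sg hg)
  simpa [sub_eq_add_neg] using this

theorem exists_bound (hU : IsOpen U) (hp : p ∈ U) (sf : ContDiffOn ℝ (⊤ : ℕ∞) f U)
    (hf : SFlat k f p) :
    ∃ C > 0, ∃ r > 0, ball p r ⊆ U ∧ ∀ x ∈ ball p r, |f x| ≤ C * ‖x - p‖ ^ k := by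
  induction k generalizing f with
  | zero =>
    obtain ⟨r, hr, h1⟩ := Metric.isOpen_iff.1 hU p hp
    have hc := (sf.continuousOn.continuousAt (hU.mem_nhds hp)).abs.eventually
      (gt_mem_nhds (lt_add_one |f p|))
    obtain ⟨s, hs, h2⟩ := Metric.eventually_nhds_iff_ball.1 hc
    refine ⟨|f p| + 1, by positivity, min r s, lt_min hr hs,
      (ball_subset_ball (min_le_left _ _)).trans h1, fun x hx => ?_⟩
    simpa using (h2 x (ball_subset_ball (min_le_right _ _) hx)).le
  | succ k ih =>
    choose C hC r hr hsub hb using fun i => ih (sf.pd hU i) (hf.2 i)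
    obtain ⟨r0, hr0, h0⟩ := Metric.isOpen_iff.1 hU p hp
    obtain ⟨s, hs, hsle⟩ : ∃ s > 0, ∀ i, s ≤ r i := by
      rcases isEmpty_or_nonempty (Fin n) with h | h
      · exact ⟨1, one_pos, fun i => h.elim i⟩
      · obtain ⟨i, hi⟩ := Finite.exists_min r
        exact ⟨r i, hr i, hi⟩
    have hCs : 0 ≤ ∑ i, C i := Finset.sum_nonneg fun i _ => (hC i).le
    refine ⟨∑ i, C i + 1, by positivity, min r0 s, lt_min hr0 hs,
      (ball_subset_ball (min_le_left _ _)).trans h0, fun x hx => ?_⟩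
    have hsegsub : segment ℝ p x ⊆ ball p (min r0 s) :=
      (convex_ball _ _).segment_subset (mem_ball_self (lt_min hr0 hs)) hx
    have hseg : ∀ y ∈ segment ℝ p x, ‖fderiv ℝ f y‖ ≤ (∑ i, C i) * ‖x - p‖ ^ k := by
      intro y hy
      have hyx : ‖y - p‖ ≤ ‖x - p‖ := by
        have := norm_sub_le_of_mem_segment hy
        simpa [norm_sub_rev] using this
      refine ContinuousLinearMap.opNorm_le_bound _ (by positivity) fun v => ?_
      rw [fderiv_apply_eq_sum_pd, Real.norm_eq_abs]
      calc |∑ i, v i * pd i f y| ≤ ∑ i, |v i * pd i f y| := Finset.abs_sum_le_sum_abs _ _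
        _ ≤ ∑ i, ‖v‖ * (C i * ‖x - p‖ ^ k) := by
            refine Finset.sum_le_sum fun i _ => ?_
            rw [abs_mul]
            refine mul_le_mul (by simpa using PiLp.norm_apply_le v i) ?_ (abs_nonneg _)
              (norm_nonneg _)
            refine (hb i y (ball_subset_ball ((min_le_right _ _).trans (hsle i))
              (hsegsub hy))).trans ?_
            have := (hC i).le
            gcongr
        _ = (∑ i, C i) * ‖x - p‖ ^ k * ‖v‖ := by
            rw [← Finset.mul_sum, ← Finset.sum_mul]; ring
    have hmv := Convex.norm_image_sub_le_of_norm_fderiv_le (𝕜 := ℝ) (f := f)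
      (fun y hy => sf.differentiableAt_of_isOpen hU
        (h0 (ball_subset_ball (min_le_left _ _) (hsegsub hy)))) hseg (convex_segment p x)
      (left_mem_segment ℝ p x) (right_mem_segment ℝ p x)
    rw [hf.1, sub_zero, Real.norm_eq_abs] at hmv
    calc |f x| ≤ _ := hmv
      _ = (∑ i, C i) * ‖x - p‖ ^ (k + 1) := by ring
      _ ≤ _ := by gcongr; linarith

end SFlat

section CarlemanAlgebra

variable {n : ℕ}

theorem abs_sum_le_card_mul {f : Fin n → ℝ} {K : ℝ} (h : ∀ i, |f i| ≤ K) :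
    |∑ i, f i| ≤ n * K :=
  (Finset.abs_sum_le_sum_abs _ _).trans
    ((Finset.sum_le_sum fun i _ => h i).trans (by simp))

/-- The pointwise Rellich identity for the vector field `B`, the symmetric matrix `a`, the gradient
`p` and the Hessian `H`, where `b k i = ∂ᵢ Bₖ`, `a' j k i = ∂ᵢ aⱼₖ`. -/
theorem rellich_identity (a : Fin n → Fin n → ℝ) (hsym : ∀ i j, a i j = a j i)
    (a' : Fin n → Fin n → Fin n → ℝ) (p B : Fin n → ℝ) (H b : Fin n → Fin n → ℝ)
    (G : Fin n → ℝ) (hG : ∀ i, G i = ∑ j, a i j * p j)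
    (G' : Fin n → Fin n → ℝ) (hG' : ∀ j i, G' j i = ∑ k, (a' j k i * p k + a j k * H k i))
    (hH : ∀ i j, H i j = H j i) :
    ∑ i, (2 * ((∑ k, (b k i * p k + B k * H k i)) * G i + (∑ k, B k * p k) * G' i i)
        - (b i i * (∑ j, p j * G j) + B i * ∑ j, (H j i * G j + p j * G' j i)))
      = 2 * (∑ k, B k * p k) * (∑ i, G' i i) + 2 * (∑ i, ∑ k, b k i * p k * G i)
        - (∑ i, b i i) * (∑ j, p j * G j) - ∑ i, ∑ j, ∑ k, B i * p j * p k * a' j k i := by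
  have h1 : ∀ i, ∑ j, p j * G' j i = ∑ j, ∑ k, p j * p k * a' j k i + ∑ k, G k * H k i := by
    intro i
    have : ∑ k, G k * H k i = ∑ j, ∑ k, p j * a j k * H k i := by
      rw [Finset.sum_comm]
      refine Finset.sum_congr rfl fun k _ => ?_
      rw [hG, Finset.sum_mul]
      refine Finset.sum_congr rfl fun j _ => ?_
      rw [hsym k j]; ring
    rw [this, ← Finset.sum_add_distrib]
    refine Finset.sum_congr rfl fun j _ => ?_
    rw [hG', Finset.mul_sum, ← Finset.sum_add_distrib]
    refine Finset.sum_congr rfl fun k _ => ?_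
    ring
  have h2 : ∑ i, (∑ k, B k * H k i) * G i = ∑ i, B i * ∑ j, H j i * G j := by
    simp only [Finset.sum_mul, Finset.mul_sum]
    rw [Finset.sum_comm]
    refine Finset.sum_congr rfl fun k _ => Finset.sum_congr rfl fun i _ => ?_
    rw [hH i k]; ring
  have h3 : ∀ i, ∑ k, G k * H k i = ∑ j, H j i * G j := fun i =>
    Finset.sum_congr rfl fun k _ => by ring
  have h4 : ∑ i, B i * ∑ j, ∑ k, p j * p k * a' j k i =
      ∑ i, ∑ j, ∑ k, B i * p j * p k * a' j k i := by
    simp only [Finset.mul_sum]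
    refine Finset.sum_congr rfl fun i _ => Finset.sum_congr rfl fun j _ =>
      Finset.sum_congr rfl fun k _ => ?_
    ring
  have h5 : ∑ i, (∑ k, b k i * p k) * G i = ∑ i, ∑ k, b k i * p k * G i := by
    simp only [Finset.sum_mul]
  have key : ∀ i, (2 * ((∑ k, (b k i * p k + B k * H k i)) * G i + (∑ k, B k * p k) * G' i i)
        - (b i i * (∑ j, p j * G j) + B i * ∑ j, (H j i * G j + p j * G' j i)))
      = 2 * ((∑ k, b k i * p k) * G i) + 2 * ((∑ k, B k * H k i) * G i)
        + 2 * (∑ k, B k * p k) * G' i i - b i i * (∑ j, p j * G j)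
        - 2 * (B i * ∑ j, H j i * G j) - B i * ∑ j, ∑ k, p j * p k * a' j k i := by
    intro i
    rw [Finset.sum_add_distrib, Finset.sum_add_distrib, h1 i, h3 i]; ring
  rw [Finset.sum_congr rfl fun i _ => key i]
  simp only [Finset.sum_add_distrib, Finset.sum_sub_distrib, ← Finset.mul_sum, ← Finset.sum_mul]
  rw [h2, h4, h5]; ring

/-- Lower bound for the quadratic form in the gradient. -/
theorem gradient_form_lower_bound {C : ℝ} (hC : 1 ≤ C) {r γ : ℝ} (hr : 0 < r) (hγ : 0 ≤ γ)
    (hCr : 2 * n * C * r ≤ 1) (hCr' : C * r ≤ 1) {P : ℝ} (hP : 0 ≤ P)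
    (a' : Fin n → Fin n → Fin n → ℝ) (p B x : Fin n → ℝ) (b : Fin n → Fin n → ℝ)
    (G : Fin n → ℝ) (hPp : ∑ i, p i ^ 2 = P ^ 2)
    (hx : ∀ i, |x i| ≤ r) (hB : ∀ i, |B i - x i| ≤ C * r ^ 2)
    (hb : ∀ k i, |b k i - if k = i then 1 else 0| ≤ C * r)
    (hG : ∀ i, |G i - p i| ≤ C * r * P) (ha' : ∀ i j k, |a' i j k| ≤ C) :
    (γ / 2 - 10 * n ^ 3 * C) * r * P ^ 2 ≤
      (∑ i, b i i) * (∑ j, p j * G j) - 2 * (∑ i, ∑ k, b k i * p k * G i)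
        + (∑ i, ∑ j, ∑ k, B i * p j * p k * a' j k i) - (n - 2 - γ * r) * (∑ j, p j * G j) := by
  rcases Nat.eq_zero_or_pos n with rfl | hn
  · have : P = 0 := by simpa using hPp.symm
    simp [this]
  have hn1 : (1 : ℝ) ≤ n := by exact_mod_cast hn
  have hp : ∀ i, |p i| ≤ P := fun i => by
    rw [← abs_of_nonneg hP, ← sq_le_sq, ← hPp]
    exact Finset.single_le_sum (f := fun i => p i ^ 2) (fun _ _ => sq_nonneg _) (Finset.mem_univ i)
  have hGP : ∀ i, |G i| ≤ 2 * P := fun i => by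
    have := abs_add_le (G i - p i) (p i)
    rw [sub_add_cancel] at this
    have h1 : C * r * P ≤ 1 * P := by gcongr
    linarith [hG i, hp i]
  have hB2 : ∀ i, |B i| ≤ 2 * r := fun i => by
    have := abs_add_le (B i - x i) (x i)
    rw [sub_add_cancel] at this
    have h1 : C * r ^ 2 ≤ 1 * r := by rw [pow_two, ← mul_assoc]; gcongr
    linarith [hB i, hx i]
  set q := ∑ j, p j * G j with hq
  have hq1 : |q - P ^ 2| ≤ n * (C * r * P ^ 2) := by
    rw [hq, ← hPp, ← Finset.sum_sub_distrib]
    refine abs_sum_le_card_mul fun i => ?_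
    rw [show p i * G i - p i ^ 2 = p i * (G i - p i) by ring, abs_mul, hPp]
    calc |p i| * |G i - p i| ≤ P * (C * r * P) := by
          gcongr
          exacts [hp i, hG i]
      _ = _ := by ring
  have hsmall : n * (C * r * P ^ 2) ≤ P ^ 2 / 2 := by nlinarith [sq_nonneg P]
  have hq2 := abs_le.1 hq1
  have he1 : |∑ i, b i i - n| ≤ n * (C * r) := by
    have : (n : ℝ) = ∑ i : Fin n, 1 := by simp
    rw [this, ← Finset.sum_sub_distrib, ← this]
    exact abs_sum_le_card_mul fun i => by simpa using hb i i
  have he2 : |∑ i, ∑ k, b k i * p k * G i - q| ≤ n * (n * (2 * C * r * P ^ 2)) := by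
    have : q = ∑ i, ∑ k, (if k = i then 1 else 0) * p k * G i := by
      rw [hq]; refine Finset.sum_congr rfl fun i _ => ?_
      simp
    rw [this, ← Finset.sum_sub_distrib]
    refine abs_sum_le_card_mul fun i => ?_
    rw [← Finset.sum_sub_distrib]
    refine abs_sum_le_card_mul fun k => ?_
    rw [← sub_mul, ← sub_mul, abs_mul, abs_mul]
    calc _ ≤ (C * r) * P * (2 * P) := by
          gcongr
          exacts [hb k i, hp k, hGP i]
      _ = _ := by ring
  have he3 : |∑ i, ∑ j, ∑ k, B i * p j * p k * a' j k i| ≤ n * (n * (n * (2 * C * r * P ^ 2))) := by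
    refine abs_sum_le_card_mul fun i => abs_sum_le_card_mul fun j => abs_sum_le_card_mul fun k => ?_
    rw [abs_mul, abs_mul, abs_mul]
    calc _ ≤ (2 * r) * P * P * C := by
          gcongr
          exacts [hB2 i, hp j, hp k, ha' j k i]
      _ = _ := by ring
  have e1q : |(∑ i, b i i - n) * q| ≤ n * (C * r) * (2 * P ^ 2) := by
    rw [abs_mul]
    have hqa : |q| ≤ 2 * P ^ 2 := abs_le.2 ⟨by nlinarith, by nlinarith⟩
    gcongr
  have hγq : γ * r * (P ^ 2 / 2) ≤ γ * r * q := by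
    gcongr; linarith
  set W := C * r * P ^ 2 with hW
  have hW0 : 0 ≤ W := by positivity
  have hn3 : n * W ≤ n ^ 3 * W := by
    gcongr
    calc (n : ℝ) = n ^ 1 := by ring
      _ ≤ n ^ 3 := pow_le_pow_right₀ hn1 (by norm_num)
  have hn4 : n ^ 2 * W ≤ n ^ 3 * W := by
    gcongr
    norm_num
  have l1 := (abs_le.1 he2).2
  have l2 := (abs_le.1 he3).1
  have l3 := (abs_le.1 e1q).1
  have m2 : (n:ℝ) * (n * (2 * C * r * P ^ 2)) = 2 * (n ^ 2 * W) := by rw [hW]; ring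
  have m3 : (n:ℝ) * (n * (n * (2 * C * r * P ^ 2))) = 2 * (n ^ 3 * W) := by rw [hW]; ring
  have m1 : n * (C * r) * (2 * P ^ 2) = 2 * (n * W) := by rw [hW]; ring
  rw [m2] at l1
  rw [m3] at l2
  rw [m1] at l3
  have goal1 : (γ / 2 - 10 * n ^ 3 * C) * r * P ^ 2 = γ * r * (P ^ 2 / 2) - 10 * (n ^ 3 * W) := by
    rw [hW]; ring
  rw [goal1]
  nlinarith

/-- Scalar form of the lower bound for the zeroth order coefficient. -/
theorem zeroth_order_scalar_lower {N C r γ c m δ e e1 : ℝ} (hN : 1 ≤ N) (hC : 1 ≤ C) (hr : 0 < r)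
    (hγ : 0 ≤ γ) (hc : γ + 30 * N ^ 2 * C + 4 ≤ c) (hsmall : 60 * (N * C * r) ≤ 1)
    (hcrm : c * r = 1 - m) (hm1 : m ≤ 1) (hm2 : 1 / 2 ≤ m)
    (hδ : |δ| ≤ N * C * r) (he : |e| ≤ 4 * N ^ 2 * C * r) (he1 : |e1| ≤ N * (C * r)) :
    r⁻¹ ≤ (m * (1 + δ) * (2 * (c * r) + 2 * δ * (1 + m) - m * (e1 + γ * r)) - m ^ 2 * e) /
      r ^ 2 := by
  have hδ2 := abs_le.1 hδ
  have he2 := abs_le.1 he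
  have he12 := abs_le.1 he1
  have hNC : N * C ≤ N ^ 2 * C := by
    have : N ≤ N ^ 2 := by nlinarith
    gcongr
  rw [le_div_iff₀ (by positivity), show r⁻¹ * r ^ 2 = r by field_simp]
  have i1 : (2 * c - 5 * (N * C) - γ) * r ≤ 2 * (c * r) + 2 * δ * (1 + m) - m * (e1 + γ * r) := by
    have j1 : - (2 * (N * C * r)) ≤ δ * (1 + m) := by nlinarith
    have j2 : m * (e1 + γ * r) ≤ 1 * (N * (C * r) + γ * r) := by
      have : 0 ≤ N * (C * r) + γ * r := by positivity
      calc _ ≤ m * (N * (C * r) + γ * r) := by gcongr; linarith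
        _ ≤ _ := by gcongr
    linarith
  have i2 : (1:ℝ) / 4 ≤ m * (1 + δ) := by nlinarith
  have i3 : 0 ≤ (2 * c - 5 * (N * C) - γ) * r := by
    apply mul_nonneg _ hr.le; nlinarith
  have i4 : 1 / 4 * ((2 * c - 5 * (N * C) - γ) * r) ≤
    m * (1 + δ) * (2 * (c * r) + 2 * δ * (1 + m) - m * (e1 + γ * r)) := by gcongr
  have i5 : m ^ 2 * e ≤ 1 * (4 * N ^ 2 * C * r) := by
    have : 0 ≤ 4 * N ^ 2 * C * r := by positivity
    calc _ ≤ m ^ 2 * (4 * N ^ 2 * C * r) := by gcongr; linarith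
      _ ≤ _ := by gcongr; nlinarith
  have i6 : (γ + 30 * N ^ 2 * C + 4) * r ≤ c * r := by gcongr
  have i7 : N * C * r ≤ N ^ 2 * C * r := by gcongr
  have i8 : 0 ≤ γ * r := by positivity
  have i9 : 0 ≤ N * C * r := by positivity
  linarith

/-- Scalar form of the bound for the first order error coefficient. -/
theorem zeroth_order_scalar_error {N C r γ c m δ e1 : ℝ} (hN : 1 ≤ N) (hC : 1 ≤ C) (hr : 0 < r)
    (hγ : 0 ≤ γ) (hc : γ + 30 * N ^ 2 * C + 4 ≤ c)
    (hcrm : c * r = 1 - m) (hm1 : m ≤ 1) (hm2 : 1 / 2 ≤ m)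
    (hδ : |δ| ≤ N * C * r) (he1 : |e1| ≤ N * (C * r)) :
    |(m * (e1 + γ * r) - (1 - m) - δ * (1 + m)) / r ^ 2| ≤ 8 * c * r⁻¹ := by
  rw [abs_div, abs_of_pos (by positivity : 0 < r ^ 2), div_le_iff₀ (by positivity),
    show 8 * c * r⁻¹ * r ^ 2 = 8 * (c * r) by field_simp]
  have j4 : 0 ≤ γ * r := by positivity
  have i1 : |m * (e1 + γ * r)| ≤ 1 * (N * (C * r) + γ * r) := by
    rw [abs_mul, abs_of_nonneg (by linarith : 0 ≤ m)]
    refine mul_le_mul hm1 ?_ (abs_nonneg _) zero_le_one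
    exact (abs_add_le _ _).trans (add_le_add he1 (abs_of_nonneg j4).le)
  have i2 : |δ * (1 + m)| ≤ N * C * r * 2 := by
    rw [abs_mul, abs_of_nonneg (by linarith : 0 ≤ 1 + m)]
    gcongr; linarith
  rw [← hcrm]
  have i1' := abs_le.1 i1
  have i2' := abs_le.1 i2
  have i6 : (γ + 30 * N ^ 2 * C + 4) * r ≤ c * r := by gcongr
  have j2 : N * C * r ≤ N ^ 2 * C * r := by
    have : N ≤ N ^ 2 := by nlinarith
    gcongr
  have j3 : 0 ≤ N * C * r := by positivity
  refine abs_le.2 ⟨?_, ?_⟩ <;> linarith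

/-- Bounds for the zeroth order coefficients. -/
theorem zeroth_order_bounds (hn : 1 ≤ n) {C : ℝ} (hC : 1 ≤ C) {r γ c : ℝ} (hr : 0 < r)
    (hγ : 0 ≤ γ) (hc : γ + 30 * n ^ 2 * C + 4 ≤ c) (hcr : c * r ≤ 1 / 2)
    (B x : Fin n → ℝ) (b : Fin n → Fin n → ℝ) (hxr : ∑ i, x i ^ 2 = r ^ 2)
    (hx : ∀ i, |x i| ≤ r) (hB : ∀ i, |B i - x i| ≤ C * r ^ 2)
    (hb : ∀ k i, |b k i - if k = i then 1 else 0| ≤ C * r) {s μ ν : ℝ}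
    (hs : s = ∑ i, x i * B i) (hμ : μ = (1 - c * r) / r ^ 2) (hν : ν = (c * r - 2) / r ^ 4) :
    r⁻¹ ≤ (n - 2 - γ * r - ∑ i, b i i) * (μ ^ 2 * s)
        - (2 * μ * ν * s ^ 2 + μ ^ 2 * ∑ i, B i * (B i + ∑ k, x k * b k i)) ∧
      |ν * s + μ * (∑ i, b i i - (n - 2 - γ * r))| ≤ (8 * c) * r⁻¹ := by
  have hn1 : (1 : ℝ) ≤ n := by exact_mod_cast hn
  have hnC : n * C ≤ n ^ 2 * C := by
    gcongr; nlinarith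
  have hnC0 : 1 ≤ n * C := by nlinarith
  have hcr' : 60 * (n ^ 2 * C * r) ≤ 1 := by nlinarith
  have hnCr : 60 * (n * C * r) ≤ 1 := by nlinarith
  have hCr : C * r ≤ 1 := by nlinarith [mul_pos (by linarith : 0 < C) hr]
  have hB2 : ∀ i, |B i| ≤ 2 * r := fun i => by
    have := abs_add_le (B i - x i) (x i)
    rw [sub_add_cancel] at this
    have h1 : C * r ^ 2 ≤ 1 * r := by rw [pow_two, ← mul_assoc]; gcongr
    linarith [hB i, hx i]
  have he1 : |∑ i, b i i - n| ≤ n * (C * r) := by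
    have : (n : ℝ) = ∑ i : Fin n, 1 := by simp
    rw [this, ← Finset.sum_sub_distrib, ← this]
    exact abs_sum_le_card_mul fun i => by simpa using hb i i
  have hs1 : |s - r ^ 2| ≤ n * (C * r ^ 3) := by
    rw [hs, ← hxr, ← Finset.sum_sub_distrib]
    refine abs_sum_le_card_mul fun i => ?_
    rw [show x i * B i - x i ^ 2 = x i * (B i - x i) by ring, abs_mul]
    calc |x i| * |B i - x i| ≤ r * (C * r ^ 2) := by
          gcongr
          exacts [hx i, hB i]
      _ = _ := by ring
  have he4 : |∑ i, B i * (B i + ∑ k, x k * b k i) - 2 * s| ≤ 4 * n ^ 2 * C * r ^ 3 := by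
    have e : ∑ i, B i * (B i + ∑ k, x k * b k i) - 2 * s
        = ∑ i, (B i * (B i - x i) + B i * ∑ k, x k * (b k i - if k = i then 1 else 0)) := by
      rw [hs, Finset.mul_sum, ← Finset.sum_sub_distrib]
      refine Finset.sum_congr rfl fun i _ => ?_
      simp only [mul_sub, Finset.sum_sub_distrib]
      simp; ring
    rw [e]
    have : n * (2 * r * (C * r ^ 2) + 2 * r * (n * (r * (C * r)))) ≤ 4 * n ^ 2 * C * r ^ 3 := by
      have h3 : 0 < r ^ 3 := by positivity
      have : n * C * r ^ 3 ≤ n ^ 2 * C * r ^ 3 := by gcongr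
      nlinarith
    refine (abs_sum_le_card_mul fun i => ?_).trans this
    refine (abs_add_le _ _).trans (add_le_add ?_ ?_)
    · rw [abs_mul]
      gcongr
      exacts [hB2 i, hB i]
    · rw [abs_mul]
      gcongr
      · exact hB2 i
      refine abs_sum_le_card_mul fun k => ?_
      rw [abs_mul]
      gcongr
      exacts [hx k, hb k i]
  obtain ⟨δ, hδ⟩ : ∃ δ, δ = s / r ^ 2 - 1 := ⟨_, rfl⟩
  obtain ⟨e, he⟩ : ∃ e, e = (∑ i, B i * (B i + ∑ k, x k * b k i) - 2 * s) / r ^ 2 := ⟨_, rfl⟩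
  obtain ⟨e1, he1'⟩ : ∃ e1, e1 = ∑ i, b i i - n := ⟨_, rfl⟩
  obtain ⟨m, hm⟩ : ∃ m, m = 1 - c * r := ⟨_, rfl⟩
  have hs' : s = r ^ 2 * (1 + δ) := by rw [hδ]; field_simp; ring
  have hBS : ∑ i, B i * (B i + ∑ k, x k * b k i) = 2 * s + r ^ 2 * e := by
    rw [he]; field_simp; ring
  have hdb : ∑ i, b i i = n + e1 := by rw [he1']; ring
  have hδb : |δ| ≤ n * C * r := by
    rw [hδ, show s / r ^ 2 - 1 = (s - r ^ 2) / r ^ 2 by field_simp, abs_div,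
      abs_of_pos (by positivity : 0 < r ^ 2),
      div_le_iff₀ (by positivity)]
    linarith
  have heb : |e| ≤ 4 * n ^ 2 * C * r := by
    rw [he, abs_div, abs_of_pos (by positivity : 0 < r ^ 2), div_le_iff₀ (by positivity)]
    linarith
  rw [← he1'] at he1
  have hδ2 := abs_le.1 hδb
  have he2 := abs_le.1 heb
  have he12 := abs_le.1 he1
  have hc0 : 0 < c := by nlinarith
  have hm1 : m ≤ 1 := by rw [hm]; nlinarith
  have hm2 : 1 / 2 ≤ m := by rw [hm]; linarith
  have hcrm : c * r = 1 - m := by rw [hm]; ring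
  rw [hBS, hdb, hμ, hν, ← hm, hs', show c * r - 2 = -(1 + m) by rw [hcrm]; ring]
  constructor
  · have key : (n - 2 - γ * r - (n + e1)) * ((m / r ^ 2) ^ 2 * (r ^ 2 * (1 + δ)))
        - (2 * (m / r ^ 2) * (-(1 + m) / r ^ 4) * (r ^ 2 * (1 + δ)) ^ 2
          + (m / r ^ 2) ^ 2 * (2 * (r ^ 2 * (1 + δ)) + r ^ 2 * e))
        = (m * (1 + δ) * (2 * (c * r) + 2 * δ * (1 + m) - m * (e1 + γ * r)) - m ^ 2 * e) /
          r ^ 2 := by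
      rw [hcrm]; field_simp; ring
    rw [key]
    exact zeroth_order_scalar_lower hn1 hC hr hγ hc hnCr hcrm hm1 hm2 hδb heb he1
  · have key : -(1 + m) / r ^ 4 * (r ^ 2 * (1 + δ)) + m / r ^ 2 * (n + e1 - (n - 2 - γ * r))
        = (m * (e1 + γ * r) - (1 - m) - δ * (1 + m)) / r ^ 2 := by
      field_simp; ring
    rw [key]
    exact zeroth_order_scalar_error hn1 hC hr hγ hc hcrm hm1 hm2 hδb he1

end CarlemanAlgebra

/-- `f` is differentiable at `x` with `i`-th partial derivative `d`. -/
def HasPd {n : ℕ} (i : Fin n) (f : Euc n → ℝ) (d : ℝ) (x : Euc n) : Prop :=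
  DifferentiableAt ℝ f x ∧ pd i f x = d

namespace HasPd

variable {n : ℕ} {i : Fin n} {f g : Euc n → ℝ} {f' g' : ℝ} {x : Euc n}

theorem of_contDiffAt (h : ContDiffAt ℝ (⊤ : ℕ∞) f x) : HasPd i f (pd i f x) x :=
  ⟨h.differentiableAt (by simp), rfl⟩

theorem add (hf : HasPd i f f' x) (hg : HasPd i g g' x) :
    HasPd i (fun y => f y + g y) (f' + g') x :=
  ⟨hf.1.fun_add hg.1, by rw [pd_add hf.1 hg.1, hf.2, hg.2]⟩

theorem sub (hf : HasPd i f f' x) (hg : HasPd i g g' x) :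
    HasPd i (fun y => f y - g y) (f' - g') x :=
  ⟨hf.1.fun_sub hg.1, by rw [pd_sub hf.1 hg.1, hf.2, hg.2]⟩

theorem mul (hf : HasPd i f f' x) (hg : HasPd i g g' x) :
    HasPd i (fun y => f y * g y) (f' * g x + f x * g') x :=
  ⟨hf.1.fun_mul hg.1, by rw [pd_mul hf.1 hg.1, hf.2, hg.2]⟩

theorem const (c : ℝ) : HasPd i (fun _ => c) 0 x :=
  ⟨differentiableAt_const _, by simp⟩

theorem sum {ι : Type*} {s : Finset ι} {F : ι → Euc n → ℝ} {F' : ι → ℝ}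
    (hF : ∀ j ∈ s, HasPd i (F j) (F' j) x) : HasPd i (fun y => ∑ j ∈ s, F j y) (∑ j ∈ s, F' j) x :=
  ⟨DifferentiableAt.fun_sum fun j hj => (hF j hj).1, by
    rw [pd_sum s fun j hj => (hF j hj).1]
    exact Finset.sum_congr rfl fun j hj => (hF j hj).2⟩

theorem comp {h : ℝ → ℝ} {h' : ℝ} (hh : HasDerivAt h h' (f x)) (hf : HasPd i f f' x) :
    HasPd i (fun y => h (f y)) (h' * f') x := by
  have := hh.comp_hasFDerivAt x hf.1.hasFDerivAt
  refine ⟨this.differentiableAt, ?_⟩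
  have e : fderiv ℝ (fun y => h (f y)) x = h' • fderiv ℝ f x := this.fderiv
  rw [pd, e, ← hf.2]; rfl

theorem congr_deriv (hf : HasPd i f f' x) (h : f' = g') : HasPd i f g' x := h ▸ hf

theorem coord (j : Fin n) : HasPd i (fun y : Euc n => y j) (if j = i then 1 else 0) x := by
  have h : HasFDerivAt (fun y : Euc n => y j) (EuclideanSpace.proj j : Euc n →L[ℝ] ℝ) x :=
    (EuclideanSpace.proj j : Euc n →L[ℝ] ℝ).hasFDerivAt
  refine ⟨h.differentiableAt, ?_⟩
  rw [pd, h.fderiv]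
  simp

theorem norm (hx : x ≠ 0) : HasPd i (fun y : Euc n => ‖y‖) (x i / ‖x‖) x := by
  have h1 : HasPd i (fun y : Euc n => ∑ j, y j * y j) (2 * x i) x := by
    refine (HasPd.sum fun j _ => (coord j).mul (coord j)).congr_deriv ?_
    simp [Finset.sum_add_distrib]; ring
  have e : (fun y : Euc n => ‖y‖) = fun y => √(∑ j, y j * y j) := by
    ext y; rw [EuclideanSpace.norm_eq]; simp [pow_two]
  have hs : √(∑ j, x j * x j) = ‖x‖ := (congrFun e x).symm
  have hpos : 0 < ‖x‖ := norm_pos_iff.2 hx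
  have hne : ∑ j, x j * x j ≠ 0 := by
    intro h0; rw [h0, Real.sqrt_zero] at hs; exact hpos.ne hs
  rw [e]
  refine (comp (f := fun y : Euc n => ∑ j, y j * y j) (Real.hasDerivAt_sqrt hne) h1).congr_deriv ?_
  rw [hs]; field_simp

end HasPd

theorem EuclideanSpace.sum_sq_eq_norm_sq {n : ℕ} (x : Euc n) : ∑ i, x i ^ 2 = ‖x‖ ^ 2 := by
  rw [EuclideanSpace.norm_sq_eq]; simp

namespace Carleman

variable {n : ℕ} (a : Fin n → Fin n → Euc n → ℝ) (v w : Euc n → ℝ)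

/-- The vector field `A x`. -/
def radialField (k : Fin n) (x : Euc n) : ℝ := ∑ j, a k j x * x j

/-- The vector field `A ∇v`. -/
def flux (i : Fin n) (x : Euc n) : ℝ := ∑ j, a i j x * pd j v x

/-- The operator `div (A ∇v)`. -/
def divForm (x : Euc n) : ℝ := ∑ i, pd i (flux a v i) x

/-- The quadratic form `⟨x, A x⟩`. -/
def radialForm (x : Euc n) : ℝ := ∑ i, x i * radialField a i x

/-- The radial derivative factor of the Carleman weight. -/
def slope (c : ℝ) (x : Euc n) : ℝ := (1 - c * ‖x‖) / ‖x‖ ^ 2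

/-- The derivative `⟨B, ∇v⟩` along the radial field. -/
def radialDeriv (x : Euc n) : ℝ := ∑ k, radialField a k x * pd k v x

/-- The energy density `⟨∇v, A ∇v⟩`. -/
def energy (x : Euc n) : ℝ := ∑ j, pd j v x * flux a v j x

/-- The zeroth order multiplier. -/
def multiplier (γ : ℝ) (x : Euc n) : ℝ := n - 2 - γ * ‖x‖

/-- The vector field whose divergence appears in the Carleman identity. -/
def current (c γ τ : ℝ) (i : Fin n) (x : Euc n) : ℝ :=
  2 * radialDeriv a v x * flux a v i x - radialField a i x * energy a v x
    + multiplier γ x * v x * flux a v i x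
    + τ ^ 2 * (slope c x * slope c x * radialForm a x) * radialField a i x * (v x * v x)

variable {a v w} {x : Euc n}

theorem hasPd_radialField (ha : ∀ i j, ContDiff ℝ (⊤ : ℕ∞) (a i j)) (k i : Fin n) :
    HasPd i (radialField a k) (a k i x + ∑ j, x j * pd i (a k j) x) x := by
  refine (HasPd.sum fun j _ => (HasPd.of_contDiffAt (ha k j).contDiffAt).mul
    (HasPd.coord j)).congr_deriv ?_
  simp [Finset.sum_add_distrib, mul_comm, add_comm]

theorem hasPd_flux (ha : ∀ i j, ContDiff ℝ (⊤ : ℕ∞) (a i j)) {V : Set (Euc n)} (hV : IsOpen V)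
    (hv : ContDiffOn ℝ (⊤ : ℕ∞) v V) (hx : x ∈ V) (j i : Fin n) :
    HasPd i (flux a v j) (∑ k, (pd i (a j k) x * pd k v x + a j k x * pd i (pd k v) x)) x :=
  HasPd.sum fun k _ => (HasPd.of_contDiffAt (ha j k).contDiffAt).mul
    (HasPd.of_contDiffAt ((hv.pd hV k).contDiffAt (hV.mem_nhds hx)))

theorem hasPd_slope (c : ℝ) (hx : x ≠ 0) (i : Fin n) :
    HasPd i (slope c) ((c * ‖x‖ - 2) / ‖x‖ ^ 4 * x i) x := by
  have hpos : 0 < ‖x‖ := norm_pos_iff.2 hx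
  have h : HasDerivAt (fun t : ℝ => (1 - c * t) / t ^ 2)
      (((-(c * 1)) * ‖x‖ ^ 2 - (1 - c * ‖x‖) * (2 * ‖x‖ ^ 1 * 1)) / (‖x‖ ^ 2) ^ 2) ‖x‖ := by
    have h1 := ((hasDerivAt_id ‖x‖).const_mul c).const_sub 1
    have h2 := (hasDerivAt_id ‖x‖).fun_pow 2
    simpa using h1.fun_div h2 (by simpa using hpos.ne')
  refine (HasPd.comp (f := fun y : Euc n => ‖y‖) h (HasPd.norm hx)).congr_deriv ?_
  field_simp; ring

theorem hasPd_radialForm (ha : ∀ i j, ContDiff ℝ (⊤ : ℕ∞) (a i j)) (i : Fin n) :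
    HasPd i (radialForm a) (radialField a i x
      + ∑ k, x k * (a k i x + ∑ j, x j * pd i (a k j) x)) x := by
  refine (HasPd.sum fun k _ => (HasPd.coord k).mul (hasPd_radialField ha k i)).congr_deriv ?_
  simp [Finset.sum_add_distrib]

theorem sum_mul_flux (hsym : ∀ i j x, a i j x = a j i x) :
    ∑ i, x i * flux a v i x = radialDeriv a v x := by
  simp only [flux, radialDeriv, radialField, Finset.mul_sum, Finset.sum_mul]
  rw [Finset.sum_comm]
  refine Finset.sum_congr rfl fun i _ => Finset.sum_congr rfl fun j _ => ?_
  rw [hsym j i]; ring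

theorem sum_pd_current (ha : ∀ i j, ContDiff ℝ (⊤ : ℕ∞) (a i j))
    (hsym : ∀ i j x, a i j x = a j i x) {V : Set (Euc n)} (hV : IsOpen V)
    (hv : ContDiffOn ℝ (⊤ : ℕ∞) v V) (hx : x ∈ V) (hx0 : x ≠ 0) (c γ τ : ℝ)
    (b : Fin n → Fin n → ℝ) (hb : ∀ k i, b k i = a k i x + ∑ j, x j * pd i (a k j) x) :
    ∑ i, pd i (current a v c γ τ i) x =
      (divForm a v x + τ ^ 2 * (slope c x ^ 2 * radialForm a x) * v x)
          * (2 * radialDeriv a v x + multiplier γ x * v x)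
        - ((∑ i, b i i) * energy a v x - 2 * (∑ i, ∑ k, b k i * pd k v x * flux a v i x)
          + (∑ i, ∑ j, ∑ k, radialField a i x * pd j v x * pd k v x * pd i (a j k) x)
          - multiplier γ x * energy a v x)
        - γ * ‖x‖⁻¹ * v x * radialDeriv a v x
        - τ ^ 2 * v x ^ 2 * ((multiplier γ x - ∑ i, b i i) * (slope c x ^ 2 * radialForm a x)
          - (2 * slope c x * ((c * ‖x‖ - 2) / ‖x‖ ^ 4) * radialForm a x ^ 2
            + slope c x ^ 2 *
              ∑ i, radialField a i x * (radialField a i x + ∑ k, x k * b k i))) := by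
  have hdv : ∀ k i, HasPd i (pd k v) (pd i (pd k v) x) x := fun k i =>
    HasPd.of_contDiffAt ((hv.pd hV k).contDiffAt (hV.mem_nhds hx))
  have hvi : ∀ i, HasPd i v (pd i v x) x := fun i =>
    HasPd.of_contDiffAt (hv.contDiffAt (hV.mem_nhds hx))
  set p : Fin n → ℝ := fun k => pd k v x with hp
  set H : Fin n → Fin n → ℝ := fun k i => pd i (pd k v) x with hH
  have hHsym : ∀ i j, H i j = H j i := fun i j => pd_comm hV hv j i hx
  set G : Fin n → ℝ := fun i => flux a v i x with hG
  set G' : Fin n → Fin n → ℝ := fun j i =>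
    ∑ k, (pd i (a j k) x * p k + a j k x * H k i) with hG'
  set B : Fin n → ℝ := fun k => radialField a k x with hB
  have hGd : ∀ j i, HasPd i (flux a v j) (G' j i) x := fun j i => hasPd_flux ha hV hv hx j i
  have hBd : ∀ k i, HasPd i (radialField a k) (b k i) x := fun k i =>
    (hasPd_radialField ha k i).congr_deriv (hb k i).symm
  have hβ : ∀ i, HasPd i (radialDeriv a v) (∑ k, (b k i * p k + B k * H k i)) x := fun i =>
    HasPd.sum fun k _ => (hBd k i).mul (hdv k i)
  have hq : ∀ i, HasPd i (energy a v) (∑ j, (H j i * G j + p j * G' j i)) x := fun i =>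
    HasPd.sum fun j _ => (hdv j i).mul (hGd j i)
  have hs : ∀ i, HasPd i (radialForm a) (B i + ∑ k, x k * b k i) x := fun i =>
    (hasPd_radialForm ha i).congr_deriv (by simp only [hb, hB])
  have hκ : ∀ i, HasPd i (multiplier γ) (-(γ * (x i / ‖x‖))) x := fun i =>
    ((HasPd.const ((n:ℝ) - 2)).sub ((HasPd.const γ).mul (HasPd.norm hx0))).congr_deriv (by ring)
  set μ := slope c x with hμ
  set ν := (c * ‖x‖ - 2) / ‖x‖ ^ 4 with hν
  have hμd : ∀ i, HasPd i (slope c) (ν * x i) x := fun i => hasPd_slope c hx0 i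
  set s := radialForm a x with hsx
  set κ := multiplier γ x with hκx
  set β := radialDeriv a v x with hβx
  set q := energy a v x with hqx
  have hX : ∀ i, pd i (current a v c γ τ i) x =
      (2 * ((∑ k, (b k i * p k + B k * H k i)) * G i + β * G' i i)
        - (b i i * q + B i * ∑ j, (H j i * G j + p j * G' j i)))
      + (-(γ * ‖x‖⁻¹ * v x) * (x i * G i) + κ * (p i * G i) + κ * v x * G' i i)
      + τ ^ 2 * (v x ^ 2 * (2 * μ * ν * s * (x i * B i) + μ ^ 2 * (B i * (B i + ∑ k, x k * b k i))
          + μ ^ 2 * s * b i i) + 2 * (μ ^ 2 * s) * v x * (B i * p i)) := by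
    intro i
    have h := (((((HasPd.const (i := i) (x := x) 2).mul (hβ i)).mul (hGd i i)).sub
      ((hBd i i).mul (hq i))).add
      (((hκ i).mul (hvi i)).mul (hGd i i))).add
      ((((HasPd.const (τ ^ 2)).mul (((hμd i).mul (hμd i)).mul (hs i))).mul (hBd i i)).mul
        ((hvi i).mul (hvi i)))
    refine h.2.trans ?_
    simp only [← hμ, ← hβx, ← hκx, ← hsx, ← hqx]
    simp only [hG, hB, hp]
    rw [div_eq_mul_inv]
    ring
  have r1 := rellich_identity (fun i j => a i j x) (fun i j => hsym i j x)
    (fun j k i => pd i (a j k) x) p B H b G (fun i => rfl) G' (fun j i => rfl) hHsym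
  have e1 : ∑ i, x i * G i = β := sum_mul_flux hsym
  have e2 : ∑ i, p i * G i = q := rfl
  have e3 : ∑ i, G' i i = divForm a v x := Finset.sum_congr rfl fun i _ => (hGd i i).2.symm
  have e4 : ∑ i, x i * B i = s := rfl
  have e5 : ∑ i, B i * p i = β := rfl
  rw [Finset.sum_congr rfl fun i _ => hX i]
  rw [Finset.sum_add_distrib, Finset.sum_add_distrib]
  rw [show ∑ i, (2 * ((∑ k, (b k i * p k + B k * H k i)) * G i + β * G' i i)
        - (b i i * q + B i * ∑ j, (H j i * G j + p j * G' j i))) = _ from r1]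
  simp only [Finset.sum_add_distrib, ← Finset.mul_sum]
  rw [e1, e2, e3, e4, e5]
  simp only [hp, hG]
  ring

end Carleman

namespace Carleman

variable {n : ℕ} {a : Fin n → Fin n → Euc n → ℝ} {v w : Euc n → ℝ} {x : Euc n}

/-- The Carleman weight `exp (τ φ)` with `φ = c r - log r`. -/
def weight (n : ℕ) (c τ : ℝ) (x : Euc n) : ℝ := Real.exp (τ * (c * ‖x‖ - Real.log ‖x‖))

theorem hasPd_weight (c τ : ℝ) (hx : x ≠ 0) (i : Fin n) :
    HasPd i (weight n c τ) (-(τ * slope c x * x i * weight n c τ x)) x := by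
  have hpos : 0 < ‖x‖ := norm_pos_iff.2 hx
  have h : HasDerivAt (fun t : ℝ => Real.exp (τ * (c * t - Real.log t)))
      (Real.exp (τ * (c * ‖x‖ - Real.log ‖x‖)) * (τ * (c * 1 - ‖x‖⁻¹))) ‖x‖ :=
    ((((hasDerivAt_id ‖x‖).const_mul c).sub (Real.hasDerivAt_log hpos.ne')).const_mul τ).exp
  refine (HasPd.comp (f := fun y : Euc n => ‖y‖) h (HasPd.norm hx)).congr_deriv ?_
  rw [weight, slope]
  field_simp; ring

theorem contDiffOn_weight (c τ : ℝ) : ContDiffOn ℝ (⊤ : ℕ∞) (weight n c τ) {0}ᶜ := by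
  intro x hx
  have hx : x ≠ 0 := hx
  have hn := contDiffAt_norm (n := (⊤ : ℕ∞)) ℝ hx
  exact ((contDiffAt_const.mul ((contDiffAt_const.mul hn).sub
    (hn.log (norm_ne_zero_iff.2 hx)))).exp).contDiffWithinAt

theorem weight_pos (c τ : ℝ) (x : Euc n) : 0 < weight n c τ x := Real.exp_pos _

theorem pd_weight_mul (c τ : ℝ) (hw : ContDiff ℝ (⊤ : ℕ∞) w) (hx : x ≠ 0) (j : Fin n) :
    pd j (fun y => weight n c τ y * w y) x
      = weight n c τ x * pd j w x - τ * slope c x * x j * (weight n c τ x * w x) := by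
  rw [((hasPd_weight c τ hx j).mul (HasPd.of_contDiffAt hw.contDiffAt)).2]
  ring

theorem flux_weight_mul (c τ : ℝ) (hw : ContDiff ℝ (⊤ : ℕ∞) w) (hx : x ≠ 0) (i : Fin n) :
    flux a (fun y => weight n c τ y * w y) i x
      = weight n c τ x * flux a w i x
        - τ * slope c x * radialField a i x * (weight n c τ x * w x) := by
  simp only [flux, radialField, pd_weight_mul c τ hw hx, mul_sub, Finset.sum_sub_distrib,
    Finset.mul_sum, Finset.sum_mul]
  congr 1 <;> exact Finset.sum_congr rfl fun j _ => by ring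

theorem divForm_weight_mul (ha : ∀ i j, ContDiff ℝ (⊤ : ℕ∞) (a i j))
    (hsym : ∀ i j x, a i j x = a j i x) (c τ : ℝ) (hw : ContDiff ℝ (⊤ : ℕ∞) w) (hx : x ≠ 0)
    (b : Fin n → Fin n → ℝ) (hb : ∀ k i, b k i = a k i x + ∑ j, x j * pd i (a k j) x) :
    divForm a (fun y => weight n c τ y * w y) x
      = weight n c τ x * divForm a w x
        - 2 * τ * slope c x * radialDeriv a (fun y => weight n c τ y * w y) x
        - τ ^ 2 * (slope c x ^ 2 * radialForm a x) * (weight n c τ x * w x)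
        - τ * ((c * ‖x‖ - 2) / ‖x‖ ^ 4 * radialForm a x + slope c x * ∑ i, b i i)
          * (weight n c τ x * w x) := by
  have hO : IsOpen ({0}ᶜ : Set (Euc n)) := isOpen_compl_singleton
  have key : ∀ i, pd i (flux a (fun y => weight n c τ y * w y) i) x
      = weight n c τ x * pd i (flux a w i) x - τ * slope c x * weight n c τ x * (x i * flux a w i x)
        - τ * ((c * ‖x‖ - 2) / ‖x‖ ^ 4 * (x i * radialField a i x) + slope c x * b i i)
            * (weight n c τ x * w x)
        - τ * slope c x * (radialField a i x * pd i (fun y => weight n c τ y * w y) x) := by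
    intro i
    rw [pd_congr hO (fun y (hy : y ≠ 0) => flux_weight_mul (a := a) c τ hw hy i) i hx]
    have hwd : HasPd i w (pd i w x) x := HasPd.of_contDiffAt hw.contDiffAt
    have hvd := (hasPd_weight c τ hx i).mul hwd
    have hf : HasPd i (flux a w i) (pd i (flux a w i) x) x :=
      (hasPd_flux ha isOpen_univ hw.contDiffOn (mem_univ x) i i).congr_deriv
        (hasPd_flux ha isOpen_univ hw.contDiffOn (mem_univ x) i i).2.symm
    have hB : HasPd i (radialField a i) (b i i) x :=
      (hasPd_radialField ha i i).congr_deriv (hb i i).symm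
    rw [(((hasPd_weight c τ hx i).mul hf).sub
      ((((HasPd.const τ).mul (hasPd_slope c hx i)).mul hB).mul hvd)).2, hvd.2]
    ring
  have e1 : ∑ i, x i * flux a w i x = radialDeriv a w x := sum_mul_flux hsym
  have e2 : radialDeriv a (fun y => weight n c τ y * w y) x
      = weight n c τ x * radialDeriv a w x -
        τ * slope c x * radialForm a x * (weight n c τ x * w x) := by
    simp only [radialDeriv, radialForm, pd_weight_mul c τ hw hx, mul_sub, Finset.sum_sub_distrib,
      Finset.mul_sum, Finset.sum_mul]
    congr 1 <;> exact Finset.sum_congr rfl fun j _ => by ring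
  have e3 : ∑ i, radialField a i x * pd i (fun y => weight n c τ y * w y) x
      = radialDeriv a (fun y => weight n c τ y * w y) x := rfl
  rw [divForm, Finset.sum_congr rfl fun i _ => key i]
  simp only [Finset.sum_sub_distrib, ← Finset.mul_sum, Finset.sum_add_distrib, ← Finset.sum_mul]
  rw [e1, e3, show ∑ i, x i * radialField a i x = radialForm a x from rfl, ← divForm, e2]
  ring

/-- Closeness of the coefficients to the identity near the origin. -/
structure CoeffBounds (a : Fin n → Fin n → Euc n → ℝ) (C : ℝ) (x : Euc n) : Prop where
  field : ∀ i, |radialField a i x - x i| ≤ C * ‖x‖ ^ 2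
  deriv : ∀ k i, |a k i x + ∑ j, x j * pd i (a k j) x - if k = i then 1 else 0| ≤ C * ‖x‖
  coeff : ∀ (p : Fin n → ℝ) (P : ℝ), 0 ≤ P → ∑ i, p i ^ 2 = P ^ 2 →
    ∀ i, |∑ j, a i j x * p j - p i| ≤ C * ‖x‖ * P
  grad : ∀ i j k, |pd i (a j k) x| ≤ C

set_option maxHeartbeats 400000 in
/-- The scalar inequality behind the pointwise Carleman inequality. -/
theorem carleman_scalar {r n' c γ τ S M E Q D β v P : ℝ} (hr : 0 < r) (hr1 : r ≤ 1)
    (hγ : 0 ≤ γ) (hcr : c * r ≤ 1 / 2)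
    (hτ1 : 2 * n' ^ 2 * γ ^ 2 ≤ τ ^ 2) (hτ2 : 256 * c ^ 2 ≤ τ) (hτ : 0 < τ)
    (hE : |E| ≤ 8 * c * r⁻¹) (hβ : |β| ≤ 2 * n' * r * P)
    (hSM : D + 2 * r * P ^ 2 + γ * r⁻¹ * v * β + τ ^ 2 * v ^ 2 * r⁻¹ ≤ S * M)
    (hQ : Q = S + τ * ((1 - c * r) / r ^ 2) * M + τ * E * v) :
    τ * D + τ * r * P ^ 2 + τ ^ 3 / 4 * (r⁻¹ * v ^ 2) ≤ r ^ 2 * Q ^ 2 := by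
  obtain ⟨μ, hμ⟩ : ∃ μ, μ = (1 - c * r) / r ^ 2 := ⟨_, rfl⟩
  have hμr : 1 / 2 ≤ μ * r ^ 2 := by rw [hμ]; field_simp; linarith
  have h1 : 2 * (τ * (μ * r ^ 2)) * (S * M) ≤ r ^ 2 * (Q ^ 2 + τ ^ 2 * E ^ 2 * v ^ 2) := by
    rw [← hμ] at hQ
    have : 4 * (τ * μ) * (S * M) ≤ 2 * (Q ^ 2 + τ ^ 2 * E ^ 2 * v ^ 2) := by
      have e : Q - τ * E * v = S + τ * μ * M := by rw [hQ]; ring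
      have e2 : (Q - τ * E * v) ^ 2 = (S + τ * μ * M) ^ 2 := by rw [e]
      linarith [sq_nonneg (S - τ * μ * M), sq_nonneg (Q + τ * E * v)]
    have := mul_le_mul_of_nonneg_left this (sq_nonneg r)
    linarith
  have hv1 : |γ * r⁻¹ * v * β| ≤ r * P ^ 2 + n' ^ 2 * γ ^ 2 * (r⁻¹ * v ^ 2) := by
    rw [abs_mul, abs_mul, abs_of_nonneg (by positivity : 0 ≤ γ * r⁻¹)]
    have : γ * r⁻¹ * |v| * |β| ≤ γ * r⁻¹ * |v| * (2 * n' * r * P) := by gcongr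
    refine this.trans ?_
    have e : γ * r⁻¹ * |v| * (2 * n' * r * P) = 2 * (n' * γ * |v|) * P := by field_simp
    rw [e, ← sq_abs v]
    have : r * P ^ 2 + n' ^ 2 * γ ^ 2 * (r⁻¹ * |v| ^ 2) - 2 * (n' * γ * |v|) * P
      = r⁻¹ * (r * P - n' * γ * |v|) ^ 2 := by field_simp; ring
    have h2 : 0 ≤ r⁻¹ * (r * P - n' * γ * |v|) ^ 2 := by positivity
    linarith
  have hv2 := (abs_le.1 hv1).1
  obtain ⟨y, hy⟩ : ∃ y, y = r⁻¹ * v ^ 2 := ⟨_, rfl⟩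
  have hy0 : 0 ≤ y := by rw [hy]; positivity
  have hvy : v ^ 2 ≤ y := by
    rw [hy]
    have : 1 ≤ r⁻¹ := (one_le_inv₀ hr).2 hr1
    nlinarith [sq_nonneg v]
  have hE2 : r ^ 2 * (τ ^ 2 * E ^ 2 * v ^ 2) ≤ 64 * c ^ 2 * τ ^ 2 * y := by
    have : (r * |E|) ^ 2 ≤ (8 * c) ^ 2 := by
      have h0 : r * |E| ≤ 8 * c := by
        calc r * |E| ≤ r * (8 * c * r⁻¹) := by gcongr
          _ = 8 * c := by field_simp
      gcongr
    rw [mul_pow, sq_abs] at this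
    calc r ^ 2 * (τ ^ 2 * E ^ 2 * v ^ 2) = (r ^ 2 * E ^ 2) * (τ ^ 2 * v ^ 2) := by ring
      _ ≤ (8 * c) ^ 2 * (τ ^ 2 * y) := by gcongr
      _ = _ := by ring
  rw [← hy] at hv2 ⊢
  have hSM2 : D + r * P ^ 2 + τ ^ 2 / 2 * y ≤ S * M := by
    have : τ ^ 2 * v ^ 2 * r⁻¹ = τ ^ 2 * y := by rw [hy]; ring
    have h3 : n' ^ 2 * γ ^ 2 * y ≤ τ ^ 2 / 2 * y := by gcongr; linarith
    linarith
  have hc4 : 64 * c ^ 2 * τ ^ 2 * y ≤ τ ^ 3 / 4 * y := by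
    have : 64 * c ^ 2 * τ ^ 2 ≤ τ ^ 3 / 4 := by
      have := mul_le_mul_of_nonneg_right hτ2 (sq_nonneg τ)
      linarith
    gcongr
  by_cases hneg : S * M ≤ 0
  · have : τ * (D + r * P ^ 2 + τ ^ 2 / 2 * y) ≤ 0 :=
      mul_nonpos_of_nonneg_of_nonpos hτ.le (hSM2.trans hneg)
    have h5 : 0 ≤ τ ^ 3 / 4 * y := by positivity
    have h6 : 0 ≤ r ^ 2 * Q ^ 2 := by positivity
    linarith
  · push Not at hneg
    have h7 : τ * (S * M) ≤ 2 * (τ * (μ * r ^ 2)) * (S * M) := by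
      have : τ ≤ 2 * (τ * (μ * r ^ 2)) := by
        have := mul_le_mul_of_nonneg_left hμr hτ.le
        linarith
      gcongr
    have h8 : τ * (D + r * P ^ 2 + τ ^ 2 / 2 * y) ≤ τ * (S * M) := by gcongr
    linarith

set_option maxHeartbeats 1000000 in
/-- The pointwise Carleman inequality. -/
theorem carleman_pointwise (hn : 1 ≤ n) (ha : ∀ i j, ContDiff ℝ (⊤ : ℕ∞) (a i j))
    (hsym : ∀ i j x, a i j x = a j i x) {C : ℝ} (hC : 1 ≤ C) (hbd : CoeffBounds a C x)
    (hx : x ≠ 0) {γ c τ : ℝ} (hγ : 20 * n ^ 3 * C + 4 ≤ γ)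
    (hc : γ + 30 * n ^ 2 * C + 4 ≤ c) (hcr : c * ‖x‖ ≤ 1 / 2)
    (hτ1 : 2 * n ^ 2 * γ ^ 2 ≤ τ ^ 2) (hτ2 : 256 * c ^ 2 ≤ τ) (hτ : 0 < τ)
    (hw : ContDiff ℝ (⊤ : ℕ∞) w) :
    τ * ∑ i, pd i (current a (fun y => weight n c τ y * w y) c γ τ i) x
      + τ / 16 * (‖x‖ * weight n c τ x ^ 2 * ∑ i, pd i w x ^ 2)
      + τ ^ 3 / 8 * (‖x‖⁻¹ * weight n c τ x ^ 2 * w x ^ 2)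
      ≤ ‖x‖ ^ 2 * weight n c τ x ^ 2 * divForm a w x ^ 2 := by
  obtain ⟨v, hvdef⟩ : ∃ v : Euc n → ℝ, v = fun y => weight n c τ y * w y := ⟨_, rfl⟩
  rw [← hvdef]
  have hvx : v x = weight n c τ x * w x := by rw [hvdef]
  have hV : IsOpen ({0}ᶜ : Set (Euc n)) := isOpen_compl_singleton
  have hv : ContDiffOn ℝ (⊤ : ℕ∞) v {0}ᶜ := by
    rw [hvdef]; exact (contDiffOn_weight c τ).mul hw.contDiffOn
  obtain ⟨r, hr⟩ : ∃ r, r = ‖x‖ := ⟨_, rfl⟩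
  have hr0 : 0 < r := hr ▸ norm_pos_iff.2 hx
  have hn1 : (1 : ℝ) ≤ n := by exact_mod_cast hn
  have hγ0 : 0 ≤ γ := le_trans (by positivity) hγ
  have hc4 : 4 ≤ c := le_trans (by
    nlinarith [sq_nonneg (n:ℝ), mul_nonneg (sq_nonneg (n:ℝ)) (by linarith : 0 ≤ C)]) hc
  have hr1 : r ≤ 1 := by rw [← hr] at hcr; nlinarith
  have hnn : (n:ℝ) ≤ n ^ 2 := by nlinarith
  have h60 : 60 * (n ^ 2 * C * r) ≤ 1 := by rw [← hr] at hcr; nlinarith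
  have hnCr : n * (C * r) ≤ n ^ 2 * C * r := by
    rw [← mul_assoc]; gcongr
  have hCr : C * r ≤ n * (C * r) := le_mul_of_one_le_left (by positivity) hn1
  obtain ⟨P, hP⟩ : ∃ P, P = √(∑ i, pd i v x ^ 2) := ⟨_, rfl⟩
  have hP0 : 0 ≤ P := hP ▸ Real.sqrt_nonneg _
  have hPp : ∑ i, pd i v x ^ 2 = P ^ 2 := by
    rw [hP, Real.sq_sqrt (Finset.sum_nonneg fun _ _ => sq_nonneg _)]
  have hxi : ∀ i, |x i| ≤ r := fun i => by simpa [hr] using PiLp.norm_apply_le x i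
  obtain ⟨b, hb⟩ : ∃ b : Fin n → Fin n → ℝ,
    ∀ k i, b k i = a k i x + ∑ j, x j * pd i (a k j) x := ⟨_, fun _ _ => rfl⟩
  have hb' : ∀ k i, |b k i - if k = i then 1 else 0| ≤ C * r := fun k i => by
    rw [hb, hr]; exact hbd.deriv k i
  have hB' : ∀ i, |radialField a i x - x i| ≤ C * r ^ 2 := hr ▸ hbd.field
  have hgrad := gradient_form_lower_bound hC hr0 hγ0 (by nlinarith) (by nlinarith) hP0
    (fun j k i => pd i (a j k) x) (fun i => pd i v x) (fun i => radialField a i x) (fun i => x i) b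
    (fun i => flux a v i x) hPp hxi hB' hb' (fun i => hr ▸ hbd.coeff _ P hP0 hPp i)
    (fun i j k => hbd.grad k i j)
  have hzero := zeroth_order_bounds hn hC hr0 hγ0 hc (hr ▸ hcr) (fun i => radialField a i x)
    (fun i => x i) b (by rw [EuclideanSpace.sum_sq_eq_norm_sq, hr]) hxi hB' hb'
    (s := radialForm a x)
    (μ := slope c x) rfl (by rw [slope, hr]) rfl
  have hid := sum_pd_current ha hsym hV hv hx hx c γ τ b hb
  have hconj := divForm_weight_mul ha hsym c τ hw hx b hb
  rw [← hvdef, ← hvx] at hconj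
  have hβ : |radialDeriv a v x| ≤ 2 * n * r * P := by
    rw [show 2 * (n:ℝ) * r * P = n * (2 * r * P) by ring]
    refine abs_sum_le_card_mul fun k => ?_
    rw [abs_mul]
    have h1 : |radialField a k x| ≤ 2 * r := by
      have := abs_add_le (radialField a k x - x k) (x k)
      rw [sub_add_cancel] at this
      have h1 : C * r ^ 2 ≤ 1 * r := by
        rw [pow_two, ← mul_assoc]; gcongr; nlinarith
      linarith [hB' k, hxi k]
    have h2 : |pd k v x| ≤ P := by
      rw [← abs_of_nonneg hP0, ← sq_le_sq, ← hPp]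
      exact Finset.single_le_sum (f := fun i => pd i v x ^ 2) (fun _ _ => sq_nonneg _)
        (Finset.mem_univ k)
    gcongr
  have hγP : 2 * r * P ^ 2 ≤ (γ / 2 - 10 * n ^ 3 * C) * r * P ^ 2 := by
    gcongr; linarith
  rw [← hr] at hid hconj ⊢
  have hV0 := mul_le_mul_of_nonneg_left hzero.1 (by positivity : 0 ≤ τ ^ 2 * v x ^ 2)
  have main := carleman_scalar (Q := weight n c τ x * divForm a w x)
    (S := divForm a v x + τ ^ 2 * (slope c x ^ 2 * radialForm a x) * v x)
    (M := 2 * radialDeriv a v x + multiplier γ x * v x)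
    (D := ∑ i, pd i (current a v c γ τ i) x) (β := radialDeriv a v x) (v := v x)
    hr0 hr1 hγ0 (hr ▸ hcr) hτ1 hτ2 hτ hzero.2 hβ (by
      rw [hid, multiplier, ← hr]
      have e : energy a v x = ∑ j, pd j v x * flux a v j x := rfl
      rw [e]
      linarith) (by
      rw [hconj, multiplier, ← hr, show slope c x = (1 - c * r) / r ^ 2 by rw [slope, hr]]
      ring)
  have hgw : weight n c τ x ^ 2 * ∑ i, pd i w x ^ 2
      ≤ 2 * P ^ 2 + 2 * τ ^ 2 * (r⁻¹ ^ 2 * v x ^ 2) := by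
    have e : ∀ i, (weight n c τ x * pd i w x) ^ 2
        ≤ 2 * pd i v x ^ 2 + 2 * (τ * slope c x * v x) ^ 2 * x i ^ 2 := by
      intro i
      have := pd_weight_mul c τ hw hx i
      rw [← hvdef, ← hvx] at this
      rw [show weight n c τ x * pd i w x = pd i v x + τ * slope c x * v x * x i by rw [this]; ring]
      nlinarith [sq_nonneg (pd i v x - τ * slope c x * v x * x i)]
    have := Finset.sum_le_sum fun i (_ : i ∈ Finset.univ) => e i
    rw [Finset.sum_add_distrib, ← Finset.mul_sum, ← Finset.mul_sum, hPp,
      EuclideanSpace.sum_sq_eq_norm_sq, ← hr] at this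
    simp only [mul_pow (weight n c τ x)] at this
    rw [← Finset.mul_sum] at this
    refine this.trans ?_
    have hs : (slope c x * r) ^ 2 ≤ r⁻¹ ^ 2 := by
      have e : slope c x * r = (1 - c * r) * r⁻¹ := by rw [slope, ← hr]; field_simp
      rw [e]
      have h1 : 0 ≤ 1 - c * r := by rw [← hr] at hcr; linarith
      have h2 : (1 - c * r) * r⁻¹ ≤ 1 * r⁻¹ := by gcongr; nlinarith
      rw [one_mul] at h2
      gcongr
    have : 2 * (τ * slope c x * v x) ^ 2 * r ^ 2 = 2 * τ ^ 2 * ((slope c x * r) ^ 2 * v x ^ 2) := by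
      ring
    rw [this]
    gcongr
  have hgw2 : τ / 16 * (r * weight n c τ x ^ 2 * ∑ i, pd i w x ^ 2)
      ≤ τ * r * P ^ 2 + τ ^ 3 / 8 * (r⁻¹ * v x ^ 2) := by
    calc _ = τ / 16 * r * (weight n c τ x ^ 2 * ∑ i, pd i w x ^ 2) := by ring
      _ ≤ τ / 16 * r * (2 * P ^ 2 + 2 * τ ^ 2 * (r⁻¹ ^ 2 * v x ^ 2)) := by gcongr
      _ = τ * r * P ^ 2 / 8 + τ ^ 3 / 8 * (r⁻¹ * v x ^ 2) := by field_simp; ring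
      _ ≤ _ := by
        have : 0 ≤ τ * r * P ^ 2 := by positivity
        linarith
  have e1 : r⁻¹ * weight n c τ x ^ 2 * w x ^ 2 = r⁻¹ * v x ^ 2 := by rw [hvx]; ring
  rw [e1]
  linarith

end Carleman

theorem SFlat.exists_uniform_bound {n k : ℕ} {ι : Type*} [Finite ι] {U : Set (Euc n)} {p : Euc n}
    (hU : IsOpen U) (hp : p ∈ U) {f : ι → Euc n → ℝ} (sf : ∀ i, ContDiffOn ℝ (⊤ : ℕ∞) (f i) U)
    (hf : ∀ i, SFlat k (f i) p) :
    ∃ C : ℝ, 1 ≤ C ∧ ∀ᶠ x in 𝓝 p, ∀ i, |f i x| ≤ C * ‖x - p‖ ^ k := by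
  have := Fintype.ofFinite ι
  choose C hC r hr hsub hb using fun i => SFlat.exists_bound hU hp (sf i) (hf i)
  refine ⟨1 + ∑ i, C i, by linarith [Finset.sum_nonneg fun i (_ : i ∈ Finset.univ) => (hC i).le],
    eventually_all.2 fun i => ?_⟩
  filter_upwards [ball_mem_nhds p (hr i)] with x hx
  refine (hb i x hx).trans ?_
  gcongr
  have := Finset.single_le_sum (f := C) (fun i _ => (hC i).le) (Finset.mem_univ i)
  linarith

namespace Carleman

variable {n : ℕ} {a : Fin n → Fin n → Euc n → ℝ} {v w : Euc n → ℝ} {x : Euc n}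

theorem exists_coeffBounds (ha : ∀ i j, ContDiff ℝ (⊤ : ℕ∞) (a i j))
    (h0 : ∀ i j, a i j 0 = if i = j then 1 else 0) :
    ∃ C, 1 ≤ C ∧ ∀ᶠ x in 𝓝 (0 : Euc n), CoeffBounds a C x := by
  obtain ⟨K, hK, h1⟩ := SFlat.exists_uniform_bound (k := 1) isOpen_univ (mem_univ (0 : Euc n))
    (f := fun (ij : Fin n × Fin n) x => a ij.1 ij.2 x - if ij.1 = ij.2 then 1 else 0)
    (fun ij => ((ha ij.1 ij.2).sub contDiff_const).contDiffOn)
    (fun ij => ⟨by simp [h0], fun _ => trivial⟩)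
  obtain ⟨K', hK', h2⟩ := SFlat.exists_uniform_bound (k := 0) isOpen_univ (mem_univ (0 : Euc n))
    (f := fun (ij : Fin n × Fin n × Fin n) x => pd ij.1 (a ij.2.1 ij.2.2) x)
    (fun ij => ((ha _ _).pd _).contDiffOn) (fun ij => trivial)
  refine ⟨K + K' + n * K + n * K', by nlinarith, ?_⟩
  filter_upwards [h1, h2] with x h1 h2
  have h1 : ∀ i j, |a i j x - if i = j then 1 else 0| ≤ K * ‖x‖ := fun i j => by
    simpa using h1 (i, j)
  have h2 : ∀ i j k, |pd i (a j k) x| ≤ K' := fun i j k => by simpa using h2 (i, j, k)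
  have hxi : ∀ i, |x i| ≤ ‖x‖ := fun i => by simpa using PiLp.norm_apply_le x i
  have hnK : 0 ≤ n * K := by positivity
  have hnK' : 0 ≤ n * K' := by positivity
  have key : ∀ (p : Fin n → ℝ) (P : ℝ), 0 ≤ P → (∀ i, |p i| ≤ P) →
      ∀ i, |∑ j, a i j x * p j - p i| ≤ n * K * ‖x‖ * P := by
    intro p P hP hp i
    have e : ∑ j, a i j x * p j - p i = ∑ j, (a i j x - if i = j then 1 else 0) * p j := by
      simp [sub_mul, Finset.sum_sub_distrib]
    rw [e, show n * K * ‖x‖ * P = n * (K * ‖x‖ * P) by ring]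
    refine abs_sum_le_card_mul fun j => ?_
    rw [abs_mul]
    gcongr
    exacts [h1 i j, hp j]
  refine ⟨fun i => ?_, fun k i => ?_, fun p P hP hp i => ?_, fun i j k => (h2 i j k).trans ?_⟩
  · refine (key (fun i => x i) ‖x‖ (norm_nonneg _) hxi i).trans ?_
    rw [mul_assoc, ← pow_two]
    gcongr; linarith
  · rw [add_sub_right_comm]
    refine (abs_add_le _ _).trans ?_
    have : |∑ j, x j * pd i (a k j) x| ≤ n * (‖x‖ * K') := by
      refine abs_sum_le_card_mul fun j => ?_
      rw [abs_mul]
      gcongr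
      exacts [hxi j, h2 _ _ _]
    have h3 := h1 k i
    have : 0 ≤ (K' + n * K) * ‖x‖ := by positivity
    nlinarith
  · refine (key p P hP (fun i => ?_) i).trans ?_
    · rw [← abs_of_nonneg hP, ← sq_le_sq, ← hp]
      exact Finset.single_le_sum (f := fun i => p i ^ 2) (fun _ _ => sq_nonneg _)
        (Finset.mem_univ i)
    · gcongr; linarith
  · linarith

theorem contDiffOn_current (ha : ∀ i j, ContDiff ℝ (⊤ : ℕ∞) (a i j))
    (hv : ContDiffOn ℝ (⊤ : ℕ∞) v {0}ᶜ) (c γ τ : ℝ) (i : Fin n) :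
    ContDiffOn ℝ (⊤ : ℕ∞) (current a v c γ τ i) {0}ᶜ := by
  have hV : IsOpen ({0}ᶜ : Set (Euc n)) := isOpen_compl_singleton
  have hx : ∀ j : Fin n, ContDiffOn ℝ (⊤ : ℕ∞) (fun x : Euc n => x j) {0}ᶜ := fun j =>
    (EuclideanSpace.proj j : Euc n →L[ℝ] ℝ).contDiff.contDiffOn
  have hr : ContDiffOn ℝ (⊤ : ℕ∞) (fun x : Euc n => ‖x‖) {0}ᶜ := fun x hx =>
    (contDiffAt_norm ℝ hx).contDiffWithinAt
  have hG : ∀ i, ContDiffOn ℝ (⊤ : ℕ∞) (flux a v i) {0}ᶜ := fun i =>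
    ContDiffOn.sum fun j _ => (ha i j).contDiffOn.mul (hv.pd hV j)
  have hB : ∀ i, ContDiffOn ℝ (⊤ : ℕ∞) (radialField a i) {0}ᶜ := fun i =>
    ContDiffOn.sum fun j _ => (ha i j).contDiffOn.mul (hx j)
  have hq : ContDiffOn ℝ (⊤ : ℕ∞) (energy a v) {0}ᶜ :=
    ContDiffOn.sum fun j _ => (hv.pd hV j).mul (hG j)
  have hβ : ContDiffOn ℝ (⊤ : ℕ∞) (radialDeriv a v) {0}ᶜ :=
    ContDiffOn.sum fun j _ => (hB j).mul (hv.pd hV j)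
  have hs : ContDiffOn ℝ (⊤ : ℕ∞) (radialForm a) {0}ᶜ :=
    ContDiffOn.sum fun j _ => (hx j).mul (hB j)
  have hμ : ContDiffOn ℝ (⊤ : ℕ∞) (slope (n := n) c) {0}ᶜ :=
    (contDiffOn_const.sub (contDiffOn_const.mul hr)).div (hr.pow 2)
      fun x hx => pow_ne_zero _ (norm_ne_zero_iff.2 hx)
  have hκ : ContDiffOn ℝ (⊤ : ℕ∞) (multiplier (n := n) γ) {0}ᶜ :=
    contDiffOn_const.sub (contDiffOn_const.mul hr)
  exact ((((contDiffOn_const.mul hβ).mul (hG i)).sub ((hB i).mul hq)).add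
    ((hκ.mul hv).mul (hG i))).add
    (((contDiffOn_const.mul ((hμ.mul hμ).mul hs)).mul (hB i)).mul (hv.mul hv))

theorem current_eq_zero {c γ τ : ℝ} {i : Fin n} (h : v =ᶠ[𝓝 x] fun _ => 0) :
    current a v c γ τ i x = 0 := by
  have h1 : ∀ j, pd j v x = 0 := fun j => by rw [pd_eq_of_eventuallyEq h]; simp
  have h2 : v x = 0 := h.eq_of_nhds
  simp [current, flux, energy, radialDeriv, h1, h2]

end Carleman

namespace Carleman

variable {n : ℕ} {f g : Euc n → ℝ}

/-- `f` decays faster than every power at the origin. -/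
def RapidDecay (f : Euc n → ℝ) : Prop :=
  ∀ N : ℕ, f =O[𝓝[≠] 0] fun x => ‖x‖ ^ N

/-- `f` grows at most like a power at the origin. -/
def ModerateGrowth (f : Euc n → ℝ) : Prop :=
  ∃ N : ℕ, f =O[𝓝[≠] 0] fun x => ‖x‖⁻¹ ^ N

theorem eventually_norm_le_one : ∀ᶠ x : Euc n in 𝓝[≠] 0, 0 < ‖x‖ ∧ ‖x‖ ≤ 1 := by
  filter_upwards [self_mem_nhdsWithin,
    nhdsWithin_le_nhds (ball_mem_nhds (0 : Euc n) one_pos)] with x hx h1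
  exact ⟨norm_pos_iff.2 hx, by simpa using (mem_ball_zero_iff.1 h1).le⟩

theorem RapidDecay.add (hf : RapidDecay f) (hg : RapidDecay g) :
    RapidDecay fun x => f x + g x := fun N => (hf N).add (hg N)

theorem RapidDecay.mul (hf : RapidDecay f) (hg : ModerateGrowth g) :
    RapidDecay fun x => f x * g x := by
  obtain ⟨M, hM⟩ := hg
  intro N
  refine ((hf (N + M)).mul hM).congr' EventuallyEq.rfl ?_
  filter_upwards [eventually_norm_le_one] with x hx
  have := hx.1.ne'
  rw [pow_add, inv_pow]; field_simp

theorem inv_pow_isBigO {M N : ℕ} (h : M ≤ N) :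
    (fun x : Euc n => ‖x‖⁻¹ ^ M) =O[𝓝[≠] 0] fun x => ‖x‖⁻¹ ^ N := by
  refine Asymptotics.IsBigO.of_bound 1 ?_
  filter_upwards [eventually_norm_le_one] with x hx
  have : 1 ≤ ‖x‖⁻¹ := (one_le_inv₀ hx.1).2 hx.2
  rw [one_mul, Real.norm_of_nonneg (by positivity), Real.norm_of_nonneg (by positivity)]
  gcongr

theorem ModerateGrowth.add (hf : ModerateGrowth f) (hg : ModerateGrowth g) :
    ModerateGrowth fun x => f x + g x := by
  obtain ⟨M, hM⟩ := hf
  obtain ⟨N, hN⟩ := hg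
  exact ⟨max M N, (hM.trans (inv_pow_isBigO (le_max_left _ _))).add
    (hN.trans (inv_pow_isBigO (le_max_right _ _)))⟩

theorem ModerateGrowth.mul (hf : ModerateGrowth f) (hg : ModerateGrowth g) :
    ModerateGrowth fun x => f x * g x := by
  obtain ⟨M, hM⟩ := hf
  obtain ⟨N, hN⟩ := hg
  exact ⟨M + N, by simpa [pow_add] using hM.mul hN⟩

theorem ModerateGrowth.of_continuousAt (hf : ContinuousAt f 0) : ModerateGrowth f :=
  ⟨0, by simpa using (hf.isBigO_one ℝ).mono nhdsWithin_le_nhds⟩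

theorem ModerateGrowth.inv_norm_pow (k : ℕ) : ModerateGrowth fun x : Euc n => ‖x‖⁻¹ ^ k :=
  ⟨k, Asymptotics.isBigO_refl _ _⟩

/-- `f` and its gradient decay rapidly at the origin. -/
structure RapidDecayOne (f : Euc n → ℝ) : Prop where
  diff : ∀ x ≠ 0, DifferentiableAt ℝ f x
  val : RapidDecay f
  grad : ∀ i, RapidDecay (pd i f)

/-- `f` and its gradient have moderate growth at the origin. -/
structure ModerateGrowthOne (f : Euc n → ℝ) : Prop where
  diff : ∀ x ≠ 0, DifferentiableAt ℝ f x
  val : ModerateGrowth f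
  grad : ∀ i, ModerateGrowth (pd i f)

theorem eventuallyEq_of_ne (h : ∀ x ≠ 0, f x = g x) : f =ᶠ[𝓝[≠] 0] g := by
  filter_upwards [self_mem_nhdsWithin] with x hx using h x hx

theorem RapidDecay.congr (hf : RapidDecay f) (h : ∀ x ≠ 0, f x = g x) : RapidDecay g :=
  fun N => (hf N).congr' (eventuallyEq_of_ne h) EventuallyEq.rfl

theorem ModerateGrowth.congr (hf : ModerateGrowth f) (h : ∀ x ≠ 0, f x = g x) :
    ModerateGrowth g := by
  obtain ⟨N, hN⟩ := hf
  exact ⟨N, hN.congr' (eventuallyEq_of_ne h) EventuallyEq.rfl⟩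

theorem RapidDecayOne.congr (hf : RapidDecayOne f) (h : ∀ x ≠ 0, f x = g x) :
    RapidDecayOne g :=
  ⟨fun x hx => (hf.diff x hx).congr_of_eventuallyEq
      (((show EqOn f g {0}ᶜ from h).eventuallyEq_of_mem (isOpen_compl_singleton.mem_nhds hx)).symm),
    hf.val.congr h, fun i => (hf.grad i).congr (pd_congr isOpen_compl_singleton h i)⟩

theorem RapidDecayOne.add (hf : RapidDecayOne f) (hg : RapidDecayOne g) :
    RapidDecayOne fun x => f x + g x :=
  ⟨fun x hx => (hf.diff x hx).fun_add (hg.diff x hx), hf.val.add hg.val, fun i =>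
    ((hf.grad i).add (hg.grad i)).congr fun x hx =>
      (pd_add (hf.diff x hx) (hg.diff x hx) i).symm⟩

theorem RapidDecayOne.mul (hf : RapidDecayOne f) (hg : ModerateGrowthOne g) :
    RapidDecayOne fun x => f x * g x :=
  ⟨fun x hx => (hf.diff x hx).fun_mul (hg.diff x hx), hf.val.mul hg.val, fun i =>
    (((hf.grad i).mul hg.val).add (hf.val.mul (hg.grad i))).congr fun x hx =>
      (pd_mul (hf.diff x hx) (hg.diff x hx) i).symm⟩

theorem RapidDecayOne.mul_left (hf : RapidDecayOne f) (hg : ModerateGrowthOne g) :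
    RapidDecayOne fun x => g x * f x := by
  simpa only [mul_comm] using hf.mul hg

theorem ModerateGrowthOne.add (hf : ModerateGrowthOne f) (hg : ModerateGrowthOne g) :
    ModerateGrowthOne fun x => f x + g x :=
  ⟨fun x hx => (hf.diff x hx).fun_add (hg.diff x hx), hf.val.add hg.val, fun i =>
    ((hf.grad i).add (hg.grad i)).congr fun x hx =>
      (pd_add (hf.diff x hx) (hg.diff x hx) i).symm⟩

theorem ModerateGrowthOne.mul (hf : ModerateGrowthOne f) (hg : ModerateGrowthOne g) :
    ModerateGrowthOne fun x => f x * g x :=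
  ⟨fun x hx => (hf.diff x hx).fun_mul (hg.diff x hx), hf.val.mul hg.val, fun i =>
    (((hf.grad i).mul hg.val).add (hf.val.mul (hg.grad i))).congr fun x hx =>
      (pd_mul (hf.diff x hx) (hg.diff x hx) i).symm⟩

theorem ModerateGrowthOne.of_contDiff (hf : ContDiff ℝ (⊤ : ℕ∞) f) : ModerateGrowthOne f :=
  ⟨fun x _ => hf.differentiable (by simp) x, .of_continuousAt hf.continuous.continuousAt, fun i =>
    .of_continuousAt (hf.pd i).continuous.continuousAt⟩

theorem ModerateGrowthOne.const (c : ℝ) : ModerateGrowthOne fun _ : Euc n => c :=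
  .of_contDiff contDiff_const

theorem ModerateGrowthOne.sum {ι : Type*} (s : Finset ι) {F : ι → Euc n → ℝ}
    (hF : ∀ i, ModerateGrowthOne (F i)) : ModerateGrowthOne fun x => ∑ i ∈ s, F i x := by
  classical
  induction s using Finset.induction_on with
  | empty => simpa using ModerateGrowthOne.const 0
  | insert a s ha ih =>
    simp only [Finset.sum_insert ha]
    exact (hF a).add ih

theorem RapidDecayOne.sum {ι : Type*} (s : Finset ι) {F : ι → Euc n → ℝ}
    (hF : ∀ i, RapidDecayOne (F i)) : RapidDecayOne fun x => ∑ i ∈ s, F i x := by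
  classical
  induction s using Finset.induction_on with
  | empty =>
    have h : RapidDecay fun _ : Euc n => (0 : ℝ) := fun N => Asymptotics.isBigO_zero _ _
    simpa using (⟨fun _ _ => differentiableAt_const _, h, fun i => by simpa using h⟩ :
      RapidDecayOne fun _ : Euc n => (0 : ℝ))
  | insert a s ha ih =>
    simp only [Finset.sum_insert ha]
    exact (hF a).add ih

theorem RapidDecay.of_sflat (hf : ContDiff ℝ (⊤ : ℕ∞) f) (h : ∀ k, SFlat k f 0) : RapidDecay f := by
  intro N
  obtain ⟨C, hC, r, hr, -, hb⟩ := SFlat.exists_bound isOpen_univ (mem_univ 0) hf.contDiffOn (h N)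
  refine Asymptotics.IsBigO.of_bound C (nhdsWithin_le_nhds ?_)
  filter_upwards [ball_mem_nhds 0 hr] with x hx
  simpa using hb x hx

theorem RapidDecayOne.of_sflat (hf : ContDiff ℝ (⊤ : ℕ∞) f) (h : ∀ k, SFlat k f 0) :
    RapidDecayOne f :=
  ⟨fun x _ => hf.differentiable (by simp) x, .of_sflat hf h, fun i =>
    .of_sflat (hf.pd i) fun k => (h (k + 1)).2 i⟩

theorem moderateGrowth_slope (c : ℝ) : ModerateGrowth (slope (n := n) c) := by
  refine ((ModerateGrowth.of_continuousAt (f := fun x : Euc n => 1 - c * ‖x‖)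
    (by fun_prop)).mul (.inv_norm_pow 2)).congr fun x _ => ?_
  rw [slope, div_eq_mul_inv, inv_pow]

theorem moderateGrowthOne_coord (i : Fin n) : ModerateGrowthOne fun x : Euc n => x i :=
  .of_contDiff (EuclideanSpace.proj i : Euc n →L[ℝ] ℝ).contDiff

theorem moderateGrowthOne_slope (c : ℝ) : ModerateGrowthOne (slope (n := n) c) := by
  refine ⟨fun x hx => ?_, moderateGrowth_slope c, fun i => ?_⟩
  · rcases isEmpty_or_nonempty (Fin n) with h | ⟨⟨i⟩⟩
    · exact absurd (Subsingleton.elim x 0) hx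
    · exact (hasPd_slope c hx i).1
  · refine (((ModerateGrowth.of_continuousAt (f := fun x : Euc n => c * ‖x‖ - 2)
      (by fun_prop)).mul (.inv_norm_pow 4)).mul (moderateGrowthOne_coord i).val).congr
      fun x hx => ?_
    rw [(hasPd_slope c hx i).2, div_eq_mul_inv, inv_pow]

theorem moderateGrowthOne_norm : ModerateGrowthOne fun x : Euc n => ‖x‖ := by
  refine ⟨fun x hx => (contDiffAt_norm (n := 1) ℝ hx).differentiableAt (by simp),
    .of_continuousAt (by fun_prop), fun i => ?_⟩
  refine ((moderateGrowthOne_coord i).val.mul (.inv_norm_pow 1)).congr fun x hx => ?_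
  rw [(HasPd.norm hx).2, div_eq_mul_inv, pow_one]

theorem moderateGrowth_weight (c τ : ℝ) : ModerateGrowth (weight n c τ) := by
  obtain ⟨N, hN⟩ := exists_nat_ge τ
  have h : ModerateGrowth fun x : Euc n => ‖x‖⁻¹ ^ (τ : ℝ) := by
    refine ⟨N, Asymptotics.IsBigO.of_bound 1 ?_⟩
    filter_upwards [eventually_norm_le_one] with x hx
    have : 1 ≤ ‖x‖⁻¹ := (one_le_inv₀ hx.1).2 hx.2
    rw [one_mul, Real.norm_of_nonneg (by positivity), Real.norm_of_nonneg (by positivity),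
      ← Real.rpow_natCast]
    exact Real.rpow_le_rpow_of_exponent_le this hN
  refine ((ModerateGrowth.of_continuousAt (f := fun x : Euc n => Real.exp (τ * (c * ‖x‖)))
    (by fun_prop)).mul h).congr fun x hx => ?_
  have hp := norm_pos_iff.2 hx
  rw [weight, Real.rpow_def_of_pos (inv_pos.2 hp), ← Real.exp_add, Real.log_inv]
  ring_nf

theorem moderateGrowthOne_weight (c τ : ℝ) : ModerateGrowthOne (weight n c τ) := by
  refine ⟨fun x hx => ((contDiffOn_weight c τ).contDiffAt
    (isOpen_compl_singleton.mem_nhds hx)).differentiableAt (by simp), moderateGrowth_weight c τ,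
    fun i => ?_⟩
  refine ((((ModerateGrowthOne.const (-τ)).val.mul (moderateGrowth_slope c)).mul
    (moderateGrowthOne_coord i).val).mul (moderateGrowth_weight c τ)).congr fun x hx => ?_
  rw [(hasPd_weight c τ hx i).2]; ring

theorem RapidDecayOne.moderate (hf : RapidDecayOne f) : ModerateGrowthOne f :=
  ⟨hf.diff, ⟨0, by simpa using hf.val 0⟩, fun i => ⟨0, by simpa using hf.grad i 0⟩⟩

variable {a : Fin n → Fin n → Euc n → ℝ} {w : Euc n → ℝ}

theorem rapidDecayOne_current (ha : ∀ i j, ContDiff ℝ (⊤ : ℕ∞) (a i j))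
    (hw : ContDiff ℝ (⊤ : ℕ∞) w) (hflat : ∀ k, SFlat k w 0) (c γ τ : ℝ) (i : Fin n) :
    RapidDecayOne (current a (fun y => weight n c τ y * w y) c γ τ i) := by
  have hw1 : RapidDecayOne w := .of_sflat hw hflat
  have hp1 : ∀ j, RapidDecayOne (pd j w) := fun j =>
    .of_sflat (hw.pd j) fun k => (hflat (k + 1)).2 j
  have hv : RapidDecayOne fun y => weight n c τ y * w y :=
    hw1.mul_left (moderateGrowthOne_weight c τ)
  have hp : ∀ j, RapidDecayOne (pd j fun y => weight n c τ y * w y) := by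
    intro j
    refine (((hp1 j).mul_left (moderateGrowthOne_weight c τ)).add (hv.mul_left
      (((ModerateGrowthOne.const (-τ)).mul (moderateGrowthOne_slope c)).mul
        (moderateGrowthOne_coord j)))).congr fun x hx => ?_
    rw [pd_weight_mul c τ hw hx]; ring
  have hG : ∀ i, RapidDecayOne (flux a (fun y => weight n c τ y * w y) i) := fun i =>
    RapidDecayOne.sum _ fun j => (hp j).mul_left (.of_contDiff (ha i j))
  have hB : ∀ i, ModerateGrowthOne (radialField a i) := fun i =>
    ModerateGrowthOne.sum _ fun j => (ModerateGrowthOne.of_contDiff (ha i j)).mul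
      (moderateGrowthOne_coord j)
  have hs : ModerateGrowthOne (radialForm a) :=
    ModerateGrowthOne.sum _ fun j => (moderateGrowthOne_coord j).mul (hB j)
  have hβ : RapidDecayOne (radialDeriv a fun y => weight n c τ y * w y) :=
    RapidDecayOne.sum _ fun j => (hp j).mul_left (hB j)
  have hq : RapidDecayOne (energy a fun y => weight n c τ y * w y) :=
    RapidDecayOne.sum _ fun j => (hp j).mul (hG j).moderate
  have hμ := moderateGrowthOne_slope (n := n) c
  have hκ : ModerateGrowthOne (multiplier (n := n) γ) := by
    have := (ModerateGrowthOne.const ((n : ℝ) - 2)).add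
      ((ModerateGrowthOne.const (-γ)).mul (moderateGrowthOne_norm (n := n)))
    convert this using 2 with x
    rw [multiplier]; ring
  have h := (((((hβ.mul_left (.const 2)).mul (hG i).moderate).add
    ((hq.mul_left (hB i)).mul_left (.const (-1)))).add
    ((hG i).mul_left (hκ.mul hv.moderate))).add
    ((hv.mul hv.moderate).mul_left ((((ModerateGrowthOne.const (τ ^ 2)).mul
      ((hμ.mul hμ).mul hs)).mul (hB i)))))
  refine h.congr fun x _ => ?_
  simp only [current]; ring

theorem integrable_of_continuousOn_compl {K : Set (Euc n)} (hK : IsCompact K)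
    (hf : ContinuousOn f {0}ᶜ) (h0 : ∀ x ∉ K, f x = 0)
    (hb : f =O[𝓝[≠] 0] fun _ => (1 : ℝ)) : Integrable f := by
  obtain ⟨C, hC⟩ := hb.bound
  obtain ⟨δ, hδ, hball⟩ := Metric.mem_nhdsWithin_iff.1 hC
  have h1 : IntegrableOn f (K \ ball 0 δ) :=
    (hf.mono fun x hx h => hx.2 (by rw [h]; exact mem_ball_self hδ)).integrableOn_compact
      (hK.diff isOpen_ball)
  have hO : IsOpen (ball (0 : Euc n) δ ∩ {0}ᶜ) := isOpen_ball.inter isOpen_compl_singleton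
  have h2 : IntegrableOn f (ball 0 δ ∩ {0}ᶜ) := by
    refine IntegrableOn.of_bound ((measure_mono inter_subset_left).trans_lt measure_ball_lt_top)
      ((hf.mono inter_subset_right).aestronglyMeasurable hO.measurableSet) C ?_
    filter_upwards [ae_restrict_mem hO.measurableSet] with x hx
    simpa using hball hx
  have h3 : IntegrableOn f {0} := by
    rw [integrableOn_singleton_iff enorm_ne_top]
    exact Or.inr isCompact_singleton.measure_lt_top
  refine ((h1.union h2).union h3).integrable_of_forall_notMem_eq_zero
    fun x hx => h0 x fun hxK => hx ?_
  by_cases hx0 : x = 0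
  · exact Or.inr hx0
  · by_cases hxb : x ∈ ball 0 δ
    · exact Or.inl (Or.inr ⟨hxb, hx0⟩)
    · exact Or.inl (Or.inl ⟨hxK, hxb⟩)

theorem RapidDecay.hasFDerivAt_zero (hf : RapidDecay f) (h0 : f 0 = 0) :
    HasFDerivAt f (0 : Euc n →L[ℝ] ℝ) 0 := by
  rw [hasFDerivAt_iff_isLittleO]
  obtain ⟨C, hC⟩ := (hf 2).bound
  have hO : (fun x => f x) =O[𝓝 0] fun x : Euc n => ‖x‖ ^ 2 := by
    refine Asymptotics.IsBigO.of_bound C ?_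
    rw [eventually_nhdsWithin_iff] at hC
    filter_upwards [hC] with x hx
    by_cases hx0 : x = 0
    · simp [hx0, h0]
    · exact hx hx0
  have : (fun x : Euc n => ‖x‖ ^ 2) =o[𝓝 0] fun x : Euc n => x := by
    simpa using Asymptotics.isLittleO_norm_pow_id (E' := Euc n) (n := 2) (by norm_num)
  simpa [h0] using hO.trans_isLittleO this

theorem integrable_pd_and_integral_eq_zero {K : Set (Euc n)} (hK : IsCompact K)
    (hf : ContDiffOn ℝ (⊤ : ℕ∞) f {0}ᶜ) (hz : ∀ x ∉ K, f x = 0) (hd : RapidDecayOne f)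
    (h0 : f 0 = 0) (i : Fin n) : Integrable (pd i f) ∧ ∫ x, pd i f x = 0 := by
  have hO : IsOpen ({0}ᶜ : Set (Euc n)) := isOpen_compl_singleton
  have h1 : Integrable (pd i f) :=
    integrable_of_continuousOn_compl hK (hf.pd hO i).continuousOn (fun x hx => by
      have : f =ᶠ[𝓝 x] fun _ => 0 := by
        filter_upwards [hK.isClosed.isOpen_compl.mem_nhds hx] with y hy using hz y hy
      rw [pd_eq_of_eventuallyEq this]; simp) (by simpa using hd.grad i 0)
  have h2 : Integrable f :=
    integrable_of_continuousOn_compl hK hf.continuousOn hz (by simpa using hd.val 0)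
  refine ⟨h1, ?_⟩
  have := integral_mul_fderiv_eq_neg_fderiv_mul_of_integrable (μ := (volume : Measure (Euc n)))
    (f := fun _ => (1 : ℝ)) (g := f) (v := EuclideanSpace.single i 1) (by simp)
    (by simp only [one_mul]; exact h1) (by simpa using h2) (by simp) (fun x _ => by
      by_cases hx : x = 0
      · rw [hx]; exact (hd.val.hasFDerivAt_zero h0).differentiableAt
      · exact hd.diff x hx)
  simpa [pd] using this

end Carleman

namespace Carleman

variable {n : ℕ} {a : Fin n → Fin n → Euc n → ℝ}

/-- The Carleman inequality for smooth functions supported near the origin and vanishing there to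
infinite order. -/
theorem carleman (hn : 1 ≤ n) (ha : ∀ i j, ContDiff ℝ (⊤ : ℕ∞) (a i j))
    (hsym : ∀ i j x, a i j x = a j i x) (h0 : ∀ i j, a i j 0 = if i = j then 1 else 0) :
    ∃ R > 0, ∃ c τ₀ : ℝ, R ≤ 1 ∧ 0 ≤ c ∧ c * R ≤ 1 / 2 ∧ 0 < τ₀ ∧
      ∀ τ ≥ τ₀, ∀ w : Euc n → ℝ, ContDiff ℝ (⊤ : ℕ∞) w → HasCompactSupport w →
        tsupport w ⊆ ball 0 R → (∀ k, SFlat k w 0) →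
        (Integrable fun x => τ / 16 * (‖x‖ * weight n c τ x ^ 2 * ∑ i, pd i w x ^ 2)
          + τ ^ 3 / 8 * (‖x‖⁻¹ * weight n c τ x ^ 2 * w x ^ 2)) ∧
        (Integrable fun x => ‖x‖ ^ 2 * weight n c τ x ^ 2 * divForm a w x ^ 2) ∧
        ∫ x, (τ / 16 * (‖x‖ * weight n c τ x ^ 2 * ∑ i, pd i w x ^ 2)
          + τ ^ 3 / 8 * (‖x‖⁻¹ * weight n c τ x ^ 2 * w x ^ 2))
        ≤ ∫ x, ‖x‖ ^ 2 * weight n c τ x ^ 2 * divForm a w x ^ 2 := by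
  obtain ⟨C, hC, hev⟩ := exists_coeffBounds ha h0
  obtain ⟨R₀, hR₀, hR⟩ := Metric.eventually_nhds_iff_ball.1 hev
  obtain ⟨γ, hγ⟩ : ∃ γ : ℝ, γ = 20 * n ^ 3 * C + 4 := ⟨_, rfl⟩
  obtain ⟨c, hc⟩ : ∃ c : ℝ, c = γ + 30 * n ^ 2 * C + 4 := ⟨_, rfl⟩
  have hγ0 : 0 ≤ γ := by rw [hγ]; positivity
  have hc0 : 1 ≤ c := by
    have : 0 ≤ γ + 30 * n ^ 2 * C := by positivity
    rw [hc]; linarith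
  refine ⟨min R₀ (1 / (2 * c)), lt_min hR₀ (by positivity), c,
    256 * c ^ 2 + 2 * n ^ 2 * γ ^ 2 + 1, ?_, by linarith, ?_, by positivity, ?_⟩
  · refine (min_le_right _ _).trans ((div_le_one (by positivity)).2 (by linarith))
  · calc c * min R₀ (1 / (2 * c)) ≤ c * (1 / (2 * c)) := by
          gcongr; exact min_le_right _ _
      _ = 1 / 2 := by field_simp
  intro τ hτ w hw hwc hsupp hflat
  have hs1 : 0 ≤ 2 * n ^ 2 * γ ^ 2 := by positivity
  have hs2 : 0 ≤ 256 * c ^ 2 := by positivity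
  have hτ1 : 1 ≤ τ := by linarith
  set v : Euc n → ℝ := fun y => weight n c τ y * w y with hvdef
  have hV : IsOpen ({0}ᶜ : Set (Euc n)) := isOpen_compl_singleton
  have hv : ContDiffOn ℝ (⊤ : ℕ∞) v {0}ᶜ := (contDiffOn_weight c τ).mul hw.contDiffOn
  have hw0 : ∀ x ∉ tsupport w, w =ᶠ[𝓝 x] fun _ => 0 := fun x hx =>
    notMem_tsupport_iff_eventuallyEq.1 hx
  have hv0 : ∀ x ∉ tsupport w, v =ᶠ[𝓝 x] fun _ => 0 := fun x hx => by
    filter_upwards [hw0 x hx] with y hy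
    simp [hvdef, hy]
  have hX0 : ∀ i, ∀ x ∉ tsupport w, current a v c γ τ i x = 0 := fun i x hx =>
    current_eq_zero (hv0 x hx)
  have hX00 : ∀ i, current a v c γ τ i 0 = 0 := fun i => by
    simp [current, radialDeriv, radialField, multiplier, hvdef, (hflat 1).1]
  have hXd : ∀ i, RapidDecayOne (current a v c γ τ i) := fun i =>
    rapidDecayOne_current ha hw hflat c γ τ i
  have hXi := fun i => integrable_pd_and_integral_eq_zero hwc
    (contDiffOn_current ha hv c γ τ i) (hX0 i) (hXd i) (hX00 i) i
  have hpw0 : ∀ x ∉ tsupport w, ∀ i, pd i w x = 0 := fun x hx i => by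
    rw [pd_eq_of_eventuallyEq (hw0 x hx)]; simp
  have hd0 : ∀ x ∉ tsupport w, divForm a w x = 0 := fun x hx => by
    refine Finset.sum_eq_zero fun i _ => ?_
    have : flux a w i =ᶠ[𝓝 x] fun _ => 0 := by
      filter_upwards [(isClosed_tsupport w).isOpen_compl.mem_nhds hx] with y hy
      simp [flux, hpw0 y hy]
    rw [pd_eq_of_eventuallyEq this]; simp
  have hdX0 : ∀ x ∉ tsupport w, ∀ i, pd i (current a v c γ τ i) x = 0 := fun x hx i => by
    have : current a v c γ τ i =ᶠ[𝓝 x] fun _ => 0 := by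
      filter_upwards [(isClosed_tsupport w).isOpen_compl.mem_nhds hx] with y hy using hX0 i y hy
    rw [pd_eq_of_eventuallyEq this]; simp
  have hpw : ∀ i, Continuous (pd i w) := fun i => (hw.pd i).continuous
  have hdc : Continuous (divForm a w) := by
    refine continuous_finsetSum _ fun i _ => ContDiff.continuous (𝕜 := ℝ) (n := (⊤ : ℕ∞)) ?_
    exact (ContDiff.sum fun j _ => (ha i j).mul (hw.pd j)).pd i
  have hwr : RapidDecayOne w := .of_sflat hw hflat
  have hwp : ∀ i, RapidDecayOne (pd i w) := fun i =>
    .of_sflat (hw.pd i) fun k => (hflat (k + 1)).2 i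
  have hdr : RapidDecayOne (divForm a w) := by
    have hfl : ∀ i, ContDiff ℝ (⊤ : ℕ∞) (flux a w i) := fun i =>
      ContDiff.sum fun j _ => (ha i j).mul (hw.pd j)
    refine RapidDecayOne.sum _ fun i => .of_sflat ((hfl i).pd i) fun k => ?_
    refine (SFlat.sum (k := k + 1) (F := fun j x => a i j x * pd j w x) isOpen_univ (mem_univ 0)
      Finset.univ
      (fun j => ((ha i j).mul (hw.pd j)).contDiffOn) fun j =>
        SFlat.mul_left isOpen_univ (mem_univ 0) (ha i j).contDiffOn (hw.pd j).contDiffOn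
          ((hflat (k + 2)).2 j)).2 i
  have hwm := moderateGrowth_weight (n := n) c τ
  have hwt := (contDiffOn_weight (n := n) c τ).continuousOn
  have hr : ContinuousOn (fun x : Euc n => ‖x‖) {0}ᶜ := continuous_norm.continuousOn
  have hri : ContinuousOn (fun x : Euc n => ‖x‖⁻¹) {0}ᶜ := hr.inv₀ fun x hx => norm_ne_zero_iff.2 hx
  have hI1 : Integrable fun x => (τ / 16 * (‖x‖ * weight n c τ x ^ 2 * ∑ i, pd i w x ^ 2)
          + τ ^ 3 / 8 * (‖x‖⁻¹ * weight n c τ x ^ 2 * w x ^ 2)) := by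
    refine integrable_of_continuousOn_compl hwc ?_ (fun x hx => ?_) ?_
    · exact (continuousOn_const.mul ((hr.mul (hwt.pow 2)).mul
        (continuous_finsetSum _ fun i _ => (hpw i).pow 2).continuousOn)).add
        (continuousOn_const.mul ((hri.mul (hwt.pow 2)).mul (hw.continuous.pow 2).continuousOn))
    · simp [hpw0 x hx, image_eq_zero_of_notMem_tsupport hx]
    · have h1 := (((ModerateGrowth.of_continuousAt (f := fun x : Euc n => τ / 16 * ‖x‖)
        (by fun_prop)).mul hwm).mul hwm)
      have h2 := ((((ModerateGrowth.inv_norm_pow (n := n) 1).mul hwm).mul hwm).mul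
        (ModerateGrowthOne.const (τ ^ 3 / 8)).val)
      have h3 := RapidDecay.add
        ((RapidDecayOne.sum Finset.univ fun i => (hwp i).mul (hwp i).moderate).val.mul h1)
        ((hwr.val.mul hwr.moderate.val).mul h2)
      refine ((h3.congr fun x _ => ?_) 0).trans (by simp [Asymptotics.isBigO_refl])
      rw [show ∑ i, pd i w x * pd i w x = ∑ i, pd i w x ^ 2 from
        Finset.sum_congr rfl fun i _ => (sq _).symm]
      ring
  have hI2 : Integrable fun x => ‖x‖ ^ 2 * weight n c τ x ^ 2 * divForm a w x ^ 2 := by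
    refine integrable_of_continuousOn_compl hwc ?_ (fun x hx => by simp [hd0 x hx]) ?_
    swap
    · have h := (hdr.mul hdr.moderate).val.mul (((ModerateGrowth.of_continuousAt
        (f := fun x : Euc n => ‖x‖ ^ 2) (by fun_prop)).mul hwm).mul hwm)
      refine ((h.congr fun x _ => ?_) 0).trans (by simp [Asymptotics.isBigO_refl])
      ring
    exact ((hr.pow 2).mul (hwt.pow 2)).mul (hdc.pow 2).continuousOn
  have hI4 : Integrable fun x => τ * ∑ i, pd i (current a v c γ τ i) x :=
    (integrable_finsetSum _ fun i _ => (hXi i).1).const_mul τ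
  have hX : ∫ x, τ * ∑ i, pd i (current a v c γ τ i) x = 0 := by
    rw [integral_const_mul, integral_finsetSum _ fun i _ => (hXi i).1]
    simp [fun i => (hXi i).2]
  have hle : ∀ x, (τ / 16 * (‖x‖ * weight n c τ x ^ 2 * ∑ i, pd i w x ^ 2)
          + τ ^ 3 / 8 * (‖x‖⁻¹ * weight n c τ x ^ 2 * w x ^ 2))
      ≤ ‖x‖ ^ 2 * weight n c τ x ^ 2 * divForm a w x ^ 2
        - τ * ∑ i, pd i (current a v c γ τ i) x := by
    intro x
    by_cases hx0 : x = 0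
    · have : ∀ i, pd i (current a v c γ τ i) 0 = 0 := fun i => by
        rw [pd, ((hXd i).val.hasFDerivAt_zero (hX00 i)).fderiv]; simp
      subst hx0
      simp [this]
    by_cases hx : x ∈ tsupport w
    · have hxR := hsupp hx
      have hxn : ‖x‖ < min R₀ (1 / (2 * c)) := by simpa using hxR
      have := carleman_pointwise hn ha hsym hC
        (hR x (by simpa using hxn.trans_le (min_le_left _ _))) hx0 hγ.ge hc.ge ?_
        (τ := τ) ?_ ?_ (by linarith) hw
      · linarith
      · calc c * ‖x‖ ≤ c * (1 / (2 * c)) := by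
              gcongr; exact (hxn.trans_le (min_le_right _ _)).le
          _ = 1 / 2 := by field_simp
      · nlinarith
      · linarith
    · simp [hpw0 x hx, image_eq_zero_of_notMem_tsupport hx, hd0 x hx, hdX0 x hx]
  refine ⟨hI1, hI2, ?_⟩
  calc _ ≤ ∫ x, (‖x‖ ^ 2 * weight n c τ x ^ 2 * divForm a w x ^ 2
        - τ * ∑ i, pd i (current a v c γ τ i) x) := integral_mono hI1 (hI2.sub hI4) hle
    _ = _ := by rw [integral_sub hI2 hI4, hX, sub_zero]

end Carleman

namespace Carleman

variable {n : ℕ} {a : Fin n → Fin n → Euc n → ℝ}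

theorem weight_anti {c τ : ℝ} (hτ : 0 ≤ τ) {x y : Euc n} (hx : 0 < ‖x‖)
    (hxy : ‖x‖ ≤ ‖y‖) (hy : c * ‖y‖ ≤ 1) : weight n c τ y ≤ weight n c τ x := by
  rw [weight, weight]
  refine Real.exp_le_exp.2 (mul_le_mul_of_nonneg_left ?_ hτ)
  have h1 : Real.log (‖x‖ / ‖y‖) ≤ ‖x‖ / ‖y‖ - 1 :=
    Real.log_le_sub_one_of_pos (div_pos hx (hx.trans_le hxy))
  have hyp := hx.trans_le hxy
  rw [Real.log_div hx.ne' hyp.ne'] at h1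
  have h2 : c * (‖y‖ - ‖x‖) ≤ 1 - ‖x‖ / ‖y‖ := by
    have : 1 - ‖x‖ / ‖y‖ = (1 / ‖y‖) * (‖y‖ - ‖x‖) := by field_simp
    rw [this]
    refine mul_le_mul_of_nonneg_right ?_ (by linarith)
    rwa [le_div_iff₀ hyp]
  linarith

theorem add_sum_abs_sq_le (b : ℝ) (d : Fin n → ℝ) :
    (|b| + ∑ i, |d i|) ^ 2 ≤ (n + 1) * (b ^ 2 + ∑ i, d i ^ 2) := by
  have h := sq_sum_le_card_mul_sum_sq (s := (Finset.univ : Finset (Option (Fin n))))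
    (f := fun o => o.elim |b| fun i => |d i|)
  simpa [Fintype.sum_option] using h

set_option maxHeartbeats 800000 in
/-- Strong unique continuation at the origin, for a principal part normalised there. -/
theorem eq_zero_near_zero_of_flat (hn : 1 ≤ n) (ha : ∀ i j, ContDiff ℝ (⊤ : ℕ∞) (a i j))
    (hsym : ∀ i j x, a i j x = a j i x) (h0 : ∀ i j, a i j 0 = if i = j then 1 else 0)
    {u : Euc n → ℝ} (hu : ContDiff ℝ (⊤ : ℕ∞) u) {K r₀ : ℝ} (hr₀ : 0 < r₀)
    (hdiv : ∀ x ∈ ball (0 : Euc n) r₀, |divForm a u x| ≤ K * (|u x| + ∑ i, |pd i u x|))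
    (hflat : ∀ k, SFlat k u 0) : ∃ r > 0, ∀ x ∈ ball (0 : Euc n) r, u x = 0 := by
  obtain ⟨R, hR, c, τ₀, hR1, hc, hcR, hτ₀, hcarl⟩ := carleman hn ha hsym h0
  obtain ⟨s, hs, hsR, hsr⟩ : ∃ s > 0, 2 * s < R ∧ 2 * s < r₀ := by
    refine ⟨min R r₀ / 4, by positivity, ?_, ?_⟩
    · have := min_le_left R r₀
      linarith
    · have := min_le_right R r₀
      linarith
  let χ : ContDiffBump (0 : Euc n) := ⟨s, 2 * s, hs, by linarith⟩
  have hχ : ContDiff ℝ (⊤ : ℕ∞) (χ : Euc n → ℝ) := χ.contDiff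
  set w : Euc n → ℝ := fun x => χ x * u x with hwdef
  have hw : ContDiff ℝ (⊤ : ℕ∞) w := hχ.mul hu
  have hts : tsupport w ⊆ closedBall 0 (2 * s) := by
    have := tsupport_mul_subset_left (f := (χ : Euc n → ℝ)) (g := u)
    rwa [χ.tsupport_eq] at this
  have hwc : HasCompactSupport w := HasCompactSupport.mul_right χ.hasCompactSupport
  have hwu : EqOn w u (ball 0 s) := fun x hx => by
    simp [hwdef, χ.one_of_mem_closedBall (ball_subset_closedBall hx)]
  have hpw : ∀ i, EqOn (pd i w) (pd i u) (ball 0 s) := pd_congr isOpen_ball hwu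
  have hdw : EqOn (divForm a w) (divForm a u) (ball 0 s) := fun x hx => by
    refine Finset.sum_congr rfl fun i _ => pd_congr isOpen_ball (fun y hy => ?_) i hx
    exact Finset.sum_congr rfl fun j _ => by rw [hpw j hy]
  have hwflat : ∀ k, SFlat k w 0 := fun k =>
    (hflat k).congr isOpen_ball (mem_ball_self hs) hwu.symm
  have hdc : Continuous (divForm a w) := by
    refine continuous_finsetSum _ fun i _ => ContDiff.continuous (𝕜 := ℝ) (n := (⊤ : ℕ∞)) ?_
    exact (ContDiff.sum fun j _ => (ha i j).mul (hw.pd j)).pd i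
  have hd0 : ∀ x ∉ tsupport w, divForm a w x = 0 := fun x hx => by
    refine Finset.sum_eq_zero fun i _ => ?_
    have : flux a w i =ᶠ[𝓝 x] fun _ => 0 := by
      filter_upwards [(isClosed_tsupport w).isOpen_compl.mem_nhds hx] with y hy
      have hy0 : ∀ j, pd j w y = 0 := fun j => by
        rw [pd_eq_of_eventuallyEq (notMem_tsupport_iff_eventuallyEq.1 hy)]; simp [Pi.zero_def]
      simp [flux, hy0]
    rw [pd_eq_of_eventuallyEq this]; simp
  have hDi : Integrable fun x => divForm a w x ^ 2 :=
    (hdc.pow 2).integrable_of_hasCompactSupport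
      (HasCompactSupport.intro hwc fun x hx => by simp [hd0 x hx])
  obtain ⟨D, hD⟩ : ∃ D, D = ∫ x, divForm a w x ^ 2 := ⟨_, rfl⟩
  have hD0 : 0 ≤ D := hD ▸ integral_nonneg fun x => sq_nonneg _
  have : Nontrivial (Euc n) := by
    have : Nonempty (Fin n) := ⟨⟨0, hn⟩⟩
    infer_instance
  obtain ⟨e, he⟩ : ∃ e : Euc n, ‖e‖ = s := exists_norm_eq _ hs.le
  have hui : IntegrableOn (fun x => u x ^ 2) (ball 0 s) :=
    (((hu.continuous.pow 2).continuousOn.integrableOn_compact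
      (isCompact_closedBall 0 s))).mono_set ball_subset_closedBall
  have key : ∀ τ ≥ max τ₀ (max 1 (32 * K ^ 2 * (n + 1))),
      τ * ∫ x in ball 0 s, u x ^ 2 ≤ 16 * D := by
    intro τ hτ
    have hτ1 : τ₀ ≤ τ := (le_max_left _ _).trans hτ
    have hτ2 : 1 ≤ τ := (le_max_left _ _).trans ((le_max_right _ _).trans hτ)
    have hτ3 : 32 * K ^ 2 * (n + 1) ≤ τ := (le_max_right _ _).trans ((le_max_right _ _).trans hτ)
    have hτ4 : τ ≤ τ ^ 3 := le_self_pow₀ hτ2 (by norm_num)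
    obtain ⟨hL, hRi, hle⟩ := hcarl τ hτ1 w hw hwc
      (hts.trans fun x hx => mem_ball.2 ((mem_closedBall.1 hx).trans_lt hsR)) hwflat
    set L : Euc n → ℝ := fun x => τ / 16 * (‖x‖ * weight n c τ x ^ 2 * ∑ i, pd i w x ^ 2)
          + τ ^ 3 / 8 * (‖x‖⁻¹ * weight n c τ x ^ 2 * w x ^ 2) with hLdef
    have hL0 : ∀ x, 0 ≤ L x := fun x => by
      have : 0 ≤ ∑ i, pd i w x ^ 2 := Finset.sum_nonneg fun i _ => sq_nonneg _
      have h2 := le_trans zero_le_one hτ2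
      positivity
    set ω := weight n c τ e with hω
    have hω0 : 0 < ω := weight_pos _ _ _
    have hpt : ∀ x, ‖x‖ ^ 2 * weight n c τ x ^ 2 * divForm a w x ^ 2
        ≤ 1 / 2 * L x + ω ^ 2 * divForm a w x ^ 2 := by
      intro x
      have hnn : 0 ≤ ω ^ 2 * divForm a w x ^ 2 := by positivity
      by_cases hx0 : x = 0
      · have := hL0 x
        subst hx0
        simp only [norm_zero]; linarith
      have hxp := norm_pos_iff.2 hx0
      by_cases hxs : ‖x‖ < s
      · have hxb : x ∈ ball (0 : Euc n) s := by simpa using hxs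
        have h1 := hdiv x (by simpa using hxs.trans (by linarith))
        have h2 : divForm a u x ^ 2 ≤ K ^ 2 * ((n + 1) * (u x ^ 2 + ∑ i, pd i u x ^ 2)) := by
          rw [← sq_abs]
          calc |divForm a u x| ^ 2 ≤ (K * (|u x| + ∑ i, |pd i u x|)) ^ 2 :=
                pow_le_pow_left₀ (abs_nonneg _) h1 2
            _ ≤ _ := by
                rw [mul_pow]
                exact mul_le_mul_of_nonneg_left (add_sum_abs_sq_le _ _) (sq_nonneg _)
        have hx1 : ‖x‖ ≤ 1 := by linarith
        have hsum : 0 ≤ ∑ i, pd i u x ^ 2 := Finset.sum_nonneg fun i _ => sq_nonneg _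
        have hk1 : ‖x‖ ^ 2 * (K ^ 2 * (n + 1)) ≤ τ / 32 * ‖x‖ := by
          have : ‖x‖ ^ 2 ≤ ‖x‖ := by nlinarith
          have h3 : 0 ≤ K ^ 2 * ((n : ℝ) + 1) := by positivity
          nlinarith
        have hk2 : ‖x‖ ^ 2 * (K ^ 2 * (n + 1)) ≤ τ ^ 3 / 16 * ‖x‖⁻¹ := by
          have hi : 1 ≤ ‖x‖⁻¹ := (one_le_inv₀ hxp).2 hx1
          have h3 : τ / 32 * ‖x‖ ≤ τ ^ 3 / 16 * 1 := by nlinarith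
          refine hk1.trans (h3.trans ?_)
          gcongr
        rw [hLdef]
        simp only
        rw [hdw hxb, hwu hxb, Finset.sum_congr rfl fun i _ => by rw [hpw i hxb]]
        rw [hdw hxb] at hnn
        have hwp := weight_pos (n := n) c τ x
        calc ‖x‖ ^ 2 * weight n c τ x ^ 2 * divForm a u x ^ 2
            ≤ ‖x‖ ^ 2 * weight n c τ x ^ 2 *
              (K ^ 2 * ((n + 1) * (u x ^ 2 + ∑ i, pd i u x ^ 2))) := by gcongr
          _ = (‖x‖ ^ 2 * (K ^ 2 * (n + 1))) * (weight n c τ x ^ 2 * ∑ i, pd i u x ^ 2)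
              + (‖x‖ ^ 2 * (K ^ 2 * (n + 1))) * (weight n c τ x ^ 2 * u x ^ 2) := by ring
          _ ≤ (τ / 32 * ‖x‖) * (weight n c τ x ^ 2 * ∑ i, pd i u x ^ 2)
              + (τ ^ 3 / 16 * ‖x‖⁻¹) * (weight n c τ x ^ 2 * u x ^ 2) := by gcongr
          _ = 1 / 2 * (τ / 16 * (‖x‖ * weight n c τ x ^ 2 * ∑ i, pd i u x ^ 2)
              + τ ^ 3 / 8 * (‖x‖⁻¹ * weight n c τ x ^ 2 * u x ^ 2)) := by ring
          _ ≤ _ := by linarith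
      · by_cases hxt : x ∈ tsupport w
        · have hx2 : ‖x‖ ≤ 2 * s := by simpa using hts hxt
          have hcx : c * ‖x‖ ≤ 1 :=
            (mul_le_mul_of_nonneg_left (hx2.trans hsR.le) hc).trans (by linarith)
          have h1 : weight n c τ x ≤ ω :=
            weight_anti (by linarith) (he ▸ hs) (by rw [he]; exact not_lt.1 hxs) hcx
          have h2 : ‖x‖ ^ 2 ≤ 1 := pow_le_one₀ hxp.le (by linarith)
          have hwp := weight_pos (n := n) c τ x
          calc ‖x‖ ^ 2 * weight n c τ x ^ 2 * divForm a w x ^ 2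
              ≤ 1 * ω ^ 2 * divForm a w x ^ 2 := by gcongr
            _ ≤ _ := by
                have := hL0 x
                linarith
        · rw [hd0 x hxt]
          have := hL0 x
          simp; linarith
    have h1 : ∫ x, L x ≤ 1 / 2 * (∫ x, L x) + ω ^ 2 * D := by
      refine hle.trans ((integral_mono hRi ((hL.const_mul _).add (hDi.const_mul _)) hpt).trans ?_)
      simp only [Pi.add_apply]
      rw [integral_add (hL.const_mul _) (hDi.const_mul _), integral_const_mul, integral_const_mul,
      hD]
    have h2 : ∫ x in ball 0 s, τ ^ 3 / 8 * ω ^ 2 * u x ^ 2 ≤ ∫ x, L x := by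
      refine (setIntegral_mono_on (hui.const_mul _) hL.integrableOn measurableSet_ball
        fun x hx => ?_).trans (setIntegral_le_integral hL (ae_of_all _ hL0))
      by_cases hx0 : x = 0
      · have := hL0 x
        subst hx0
        simpa [(hflat 1).1] using this
      have hxp := norm_pos_iff.2 hx0
      have hxs : ‖x‖ < s := by simpa using hx
      have hce : c * ‖e‖ ≤ 1 := by
        rw [he]
        exact (mul_le_mul_of_nonneg_left (by linarith) hc).trans (hcR.trans (by norm_num))
      have h3 : ω ≤ weight n c τ x := weight_anti (by linarith) hxp (he ▸ hxs.le) hce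
      have hi : 1 ≤ ‖x‖⁻¹ := (one_le_inv₀ hxp).2 (by linarith)
      have hsum : 0 ≤ ∑ i, pd i w x ^ 2 := Finset.sum_nonneg fun i _ => sq_nonneg _
      rw [hLdef]
      simp only
      rw [hwu hx]
      calc τ ^ 3 / 8 * ω ^ 2 * u x ^ 2 = τ ^ 3 / 8 * (1 * ω ^ 2 * u x ^ 2) := by ring
        _ ≤ τ ^ 3 / 8 * (‖x‖⁻¹ * weight n c τ x ^ 2 * u x ^ 2) := by gcongr
        _ ≤ _ := le_add_of_nonneg_left (by positivity)
    rw [integral_const_mul] at h2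
    have h4 : ω ^ 2 * (τ ^ 3 / 8 * ∫ x in ball 0 s, u x ^ 2) ≤ ω ^ 2 * (2 * D) := by linarith
    have h5 := le_of_mul_le_mul_left h4 (by positivity)
    have h6 : 0 ≤ ∫ x in ball 0 s, u x ^ 2 := integral_nonneg fun x => sq_nonneg _
    have h7 := mul_le_mul_of_nonneg_right hτ4 h6
    linarith
  have hI0 : ∫ x in ball 0 s, u x ^ 2 = 0 := by
    refine le_antisymm ?_ (integral_nonneg fun x => sq_nonneg _)
    by_contra! hpos
    set I := ∫ x in ball 0 s, u x ^ 2
    have h1 := key (max (max τ₀ (max 1 (32 * K ^ 2 * (n + 1)))) ((16 * D + 1) / I))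
      (le_max_left _ _)
    have h2 : (16 * D + 1) / I * I ≤ 16 * D :=
      (mul_le_mul_of_nonneg_right (le_max_right _ _) hpos.le).trans h1
    rw [div_mul_cancel₀ _ hpos.ne'] at h2
    linarith
  refine ⟨s, hs, fun x hx => ?_⟩
  have hae :=
    (setIntegral_eq_zero_iff_of_nonneg_ae (ae_of_all _ fun x => sq_nonneg (u x)) hui).1 hI0
  have := Measure.eqOn_open_of_ae_eq hae isOpen_ball (hu.continuous.pow 2).continuousOn
    continuousOn_const hx
  simpa using this

end Carleman

open scoped MatrixOrder in
/-- A symmetric positive definite matrix can be normalised to the identity. -/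
theorem exists_matrix_normalization {n : ℕ} {A : Fin n → Fin n → ℝ} (hsym : ∀ i j, A i j = A j i)
    (hpos : ∀ ξ : Euc n, ξ ≠ 0 → 0 < ∑ i, ∑ j, A i j * ξ i * ξ j) :
    ∃ T S : Matrix (Fin n) (Fin n) ℝ, S * T = 1 ∧ T * S = 1 ∧
      ∀ i j, ∑ k, ∑ l, S i k * A k l * S j l = if i = j then 1 else 0 := by
  have hp : (Matrix.of A).PosDef := by
    rw [Matrix.posDef_iff_dotProduct_mulVec]
    refine ⟨by ext i j; simp [hsym i j], fun x hx => ?_⟩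
    have := hpos (WithLp.toLp 2 x) (by simpa using hx)
    simp only [dotProduct, Matrix.mulVec, Finset.mul_sum, Pi.star_apply, star_trivial,
      Matrix.of_apply]
    exact this.trans_eq (Finset.sum_congr rfl fun i _ => Finset.sum_congr rfl fun j _ => by
      simp only; ring)
  have h0 : (0 : Matrix (Fin n) (Fin n) ℝ) ≤ Matrix.of A := hp.posSemidef.nonneg
  set T := CFC.sqrt (Matrix.of A) with hT
  have hTT : T * T = Matrix.of A := CFC.sqrt_mul_sqrt_self _ h0
  have hTs : T.transpose = T := by
    have : IsSelfAdjoint T := (CFC.sqrt_nonneg _).isSelfAdjoint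
    simpa [Matrix.star_eq_conjTranspose] using this.star_eq
  have hu : IsUnit T.det := by
    have h1 : IsUnit (Matrix.of A).det := (Matrix.isUnit_iff_isUnit_det _).1 hp.isUnit
    rw [← hTT, Matrix.det_mul] at h1
    exact isUnit_of_mul_isUnit_left h1
  refine ⟨T, T⁻¹, Matrix.nonsing_inv_mul _ hu, Matrix.mul_nonsing_inv _ hu, fun i j => ?_⟩
  have h2 : T⁻¹ * Matrix.of A * T⁻¹.transpose = 1 := by
    rw [Matrix.transpose_nonsing_inv, hTs, ← hTT, ← mul_assoc, Matrix.nonsing_inv_mul _ hu, one_mul,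
      Matrix.mul_nonsing_inv _ hu]
  have h3 := congrFun (congrFun h2 i) j
  rw [Matrix.one_apply] at h3
  rw [← h3]
  simp only [Matrix.mul_apply, Matrix.transpose_apply, Matrix.of_apply, Finset.sum_mul]
  rw [Finset.sum_comm]

section SmoothCoefficients

variable {n : ℕ}

theorem pd_comp_affine {f : Euc n → ℝ} (hf : Differentiable ℝ f) (T : Euc n →L[ℝ] Euc n)
    (p y : Euc n) (i : Fin n) :
    pd i (fun z => f (p + T z)) y
      = ∑ k, T (EuclideanSpace.single i 1) k * pd k f (p + T y) := by
  have h : HasFDerivAt (fun z => f (p + T z)) ((fderiv ℝ f (p + T y)).comp T) y :=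
    (hf _).hasFDerivAt.comp y (T.hasFDerivAt.const_add p)
  rw [pd, h.fderiv, ContinuousLinearMap.comp_apply, fderiv_apply_eq_sum_pd]

theorem ContDiff.comp_affine {f : Euc n → ℝ} (hf : ContDiff ℝ (⊤ : ℕ∞) f)
    (T : Euc n →L[ℝ] Euc n) (p : Euc n) : ContDiff ℝ (⊤ : ℕ∞) fun z => f (p + T z) :=
  hf.comp (contDiff_const.add T.contDiff)

theorem SFlat.comp_affine {k : ℕ} {f : Euc n → ℝ} (hf : ContDiff ℝ (⊤ : ℕ∞) f)
    (T : Euc n →L[ℝ] Euc n) {p : Euc n} (h : SFlat k f p) :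
    SFlat k (fun z => f (p + T z)) 0 := by
  induction k generalizing f with
  | zero => trivial
  | succ k ih =>
    refine ⟨by simpa using h.1, fun i => ?_⟩
    rw [show pd i (fun z => f (p + T z)) = fun y => ∑ l, T (EuclideanSpace.single i 1) l *
      pd l f (p + T y) from funext fun y => pd_comp_affine (hf.differentiable (by simp)) T p y i]
    refine SFlat.sum isOpen_univ (mem_univ 0) _
      (fun l => (contDiff_const.mul ((hf.pd l).comp_affine T p)).contDiffOn) fun l => ?_
    exact SFlat.mul_left isOpen_univ (mem_univ 0) contDiffOn_const
      ((hf.pd l).comp_affine T p).contDiffOn (ih (hf.pd l) (h.2 l))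

theorem exists_cutoff {U : Set (Euc n)} (hU : IsOpen U) {p : Euc n} (hp : p ∈ U) :
    ∃ r > 0, ball p r ⊆ U ∧ ∃ χ : Euc n → ℝ, (∀ x ∈ ball p r, χ x = 1) ∧ (∀ x ∉ U, χ x = 0) ∧
      ContDiff ℝ (⊤ : ℕ∞) χ ∧
      ∀ f : Euc n → ℝ, ContDiffOn ℝ (⊤ : ℕ∞) f U → ContDiff ℝ (⊤ : ℕ∞) fun x => χ x * f x := by
  obtain ⟨R, hR, hRU⟩ := Metric.isOpen_iff.1 hU p hp
  let χ : ContDiffBump p := ⟨R / 3, R / 2, by positivity, by linarith⟩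
  have hts : tsupport (χ : Euc n → ℝ) ⊆ U := by
    rw [χ.tsupport_eq]
    exact (closedBall_subset_ball (show R / 2 < R by linarith)).trans hRU
  refine ⟨R / 3, by positivity, (ball_subset_ball (by linarith)).trans hRU, χ, fun x hx =>
    χ.one_of_mem_closedBall (ball_subset_closedBall hx), fun x hx =>
    image_eq_zero_of_notMem_tsupport fun h => hx (hts h), χ.contDiff, fun f hf => ?_⟩
  rw [contDiff_iff_contDiffAt]
  intro x
  by_cases hx : x ∈ U
  · exact χ.contDiff.contDiffAt.mul (hf.contDiffAt (hU.mem_nhds hx))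
  · have : (fun y => χ y * f y) =ᶠ[𝓝 x] fun _ => 0 := by
      filter_upwards [(isClosed_tsupport (χ : Euc n → ℝ)).isOpen_compl.mem_nhds fun h => hx (hts h)]
        with y hy
      rw [image_eq_zero_of_notMem_tsupport hy, zero_mul]
    exact contDiffAt_const.congr_of_eventuallyEq this

namespace Carleman

theorem eq_zero_near_zero_of_flat_of_nondivergence {a : Fin n → Fin n → Euc n → ℝ} (hn : 1 ≤ n)
    (ha : ∀ i j, ContDiff ℝ (⊤ : ℕ∞) (a i j))
    (hsym : ∀ i j x, a i j x = a j i x) (h0 : ∀ i j, a i j 0 = if i = j then 1 else 0)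
    {u : Euc n → ℝ} (hu : ContDiff ℝ (⊤ : ℕ∞) u) {K r₀ : ℝ} (hr₀ : 0 < r₀)
    (hL : ∀ x ∈ ball (0 : Euc n) r₀,
      |∑ i, ∑ j, a i j x * pd i (pd j u) x| ≤ K * (|u x| + ∑ i, |pd i u x|))
    (hflat : ∀ k, SFlat k u 0) : ∃ r > 0, ∀ x ∈ ball (0 : Euc n) r, u x = 0 := by
  have hb : ∀ i j, ∃ C, 0 ≤ C ∧ ∀ᶠ x in 𝓝 (0 : Euc n), |pd i (a i j) x| ≤ C := fun i j =>
    ⟨|pd i (a i j) 0| + 1, by positivity,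
      (((ha i j).pd i).continuous.abs.continuousAt.eventually (gt_mem_nhds (lt_add_one _))).mono
        fun _ h => h.le⟩
  choose C hC0 hC using hb
  obtain ⟨s, hs, hsC⟩ := Metric.eventually_nhds_iff_ball.1
    (eventually_all.2 fun i => eventually_all.2 fun j => hC i j)
  refine eq_zero_near_zero_of_flat hn ha hsym h0 hu (K := K + ∑ i, ∑ j, C i j)
    (lt_min hr₀ hs) (fun x hx => ?_) hflat
  have e : divForm a u x = ∑ i, ∑ j, pd i (a i j) x * pd j u x
      + ∑ i, ∑ j, a i j x * pd i (pd j u) x := by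
    rw [← Finset.sum_add_distrib]
    refine Finset.sum_congr rfl fun i _ => ?_
    rw [← Finset.sum_add_distrib]
    have hd : ∀ f : Euc n → ℝ, ContDiff ℝ (⊤ : ℕ∞) f → DifferentiableAt ℝ f x := fun f hf =>
      hf.differentiable (by simp) x
    refine (pd_sum _ (fun j _ => hd _ ((ha i j).mul (hu.pd j))) i).trans ?_
    exact Finset.sum_congr rfl fun j _ => pd_mul (hd _ (ha i j)) (hd _ (hu.pd j)) i
  have h1 := hL x (ball_subset_ball (min_le_left _ _) hx)
  have h2 := hsC x (ball_subset_ball (min_le_right _ _) hx)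
  have h3 : |∑ i, ∑ j, pd i (a i j) x * pd j u x|
      ≤ (∑ i, ∑ j, C i j) * (|u x| + ∑ i, |pd i u x|) := by
    rw [Finset.sum_mul]
    refine (Finset.abs_sum_le_sum_abs _ _).trans (Finset.sum_le_sum fun i _ => ?_)
    rw [Finset.sum_mul]
    refine (Finset.abs_sum_le_sum_abs _ _).trans (Finset.sum_le_sum fun j _ => ?_)
    rw [abs_mul]
    have h4 : |pd j u x| ≤ ∑ i, |pd i u x| :=
      Finset.single_le_sum (f := fun i => |pd i u x|) (fun i _ => abs_nonneg _) (Finset.mem_univ j)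
    exact mul_le_mul (h2 i j) (h4.trans (le_add_of_nonneg_left (abs_nonneg _))) (abs_nonneg _)
      (hC0 i j)
  rw [e, add_mul, add_comm (K * _)]
  exact (abs_add_le _ _).trans (add_le_add h3 h1)

/-- The second-order part of the transformed operator in linear coordinates. -/
theorem sum_conj_mul_pd_pd_comp_affine {u : Euc n → ℝ} (hu : ContDiff ℝ (⊤ : ℕ∞) u)
    {T S : Matrix (Fin n) (Fin n) ℝ} (hTS : T * S = 1) (L : Euc n →L[ℝ] Euc n)
    (hL : ∀ i k, L (EuclideanSpace.single i 1) k = T k i) (b : Fin n → Fin n → ℝ) (p y : Euc n) :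
    ∑ i, ∑ j, (∑ k, ∑ l, S i k * b k l * S j l) * pd i (pd j fun z => u (p + L z)) y
      = ∑ k, ∑ l, b k l * pd k (pd l u) (p + L y) := by
  have h1 : ∀ i j, pd i (pd j fun z => u (p + L z)) y
      = ∑ k, ∑ l, T k i * T l j * pd k (pd l u) (p + L y) := by
    intro i j
    rw [show pd j (fun z => u (p + L z)) = fun y => ∑ l, T l j * pd l u (p + L y) from
      funext fun y => by rw [pd_comp_affine (hu.differentiable (by simp))]; simp [hL]]
    rw [pd_sum _ fun l _ => (contDiff_const.mul ((hu.pd l).comp_affine L p)).differentiable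
      (by simp) y, Finset.sum_comm]
    refine Finset.sum_congr rfl fun l _ => ?_
    rw [pd_const_mul _ (((hu.pd l).comp_affine L p).differentiable (by simp) y),
      pd_comp_affine ((hu.pd l).differentiable (by simp)), Finset.mul_sum]
    exact Finset.sum_congr rfl fun k _ => by rw [hL]; ring
  have h2 : ∀ k k', ∑ i, T k' i * S i k = if k' = k then 1 else 0 := fun k k' => by
    rw [← Matrix.mul_apply, hTS, Matrix.one_apply]
  calc _ = ∑ i, ∑ j, ∑ k, ∑ l, ∑ k', ∑ l', (T k' i * S i k) * (T l' j * S j l) *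
          (b k l * pd k' (pd l' u) (p + L y)) := by
        refine Finset.sum_congr rfl fun i _ => Finset.sum_congr rfl fun j _ => ?_
        rw [h1, Finset.sum_mul]
        refine Finset.sum_congr rfl fun k _ => ?_
        rw [Finset.sum_mul]
        refine Finset.sum_congr rfl fun l _ => ?_
        rw [Finset.mul_sum]
        refine Finset.sum_congr rfl fun k' _ => ?_
        rw [Finset.mul_sum]
        exact Finset.sum_congr rfl fun l' _ => by ring
    _ = ∑ k, ∑ l, ∑ k', ∑ l', (∑ i, T k' i * S i k) * (∑ j, T l' j * S j l) *
          (b k l * pd k' (pd l' u) (p + L y)) := by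
        have sw : ∀ {G : Fin n → Fin n → Fin n → Fin n → Fin n → Fin n → ℝ},
            ∑ i, ∑ j, ∑ k, ∑ l, ∑ k', ∑ l', G i j k l k' l'
              = ∑ k, ∑ l, ∑ k', ∑ l', ∑ i, ∑ j, G i j k l k' l' := by
          intro G
          have mv : ∀ H : Fin n → Fin n → Fin n → Fin n → Fin n → ℝ,
              ∑ i, ∑ k, ∑ l, ∑ k', ∑ l', H i k l k' l'
                = ∑ k, ∑ l, ∑ k', ∑ l', ∑ i, H i k l k' l' := by
            intro H
            rw [Finset.sum_comm]
            refine Finset.sum_congr rfl fun k _ => ?_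
            rw [Finset.sum_comm]
            refine Finset.sum_congr rfl fun l _ => ?_
            rw [Finset.sum_comm]
            exact Finset.sum_congr rfl fun k' _ => Finset.sum_comm
          rw [Finset.sum_congr rfl fun i _ => mv (G i), mv]
        rw [sw]
        refine Finset.sum_congr rfl fun k _ => Finset.sum_congr rfl fun l _ =>
          Finset.sum_congr rfl fun k' _ => Finset.sum_congr rfl fun l' _ => ?_
        rw [Finset.sum_mul_sum, Finset.sum_mul]
        exact Finset.sum_congr rfl fun i _ => (Finset.sum_mul _ _ _).symm
    _ = _ := by simp [h2]

/-- Strong unique continuation at a point. -/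
theorem eventually_eq_zero_of_flat {U : Set (Euc n)} (hU : IsOpen U) {p : Euc n} (hp : p ∈ U)
    {a : Fin n → Fin n → Euc n → ℝ} (hn : 1 ≤ n) (ha : ∀ i j, ContDiffOn ℝ (⊤ : ℕ∞) (a i j) U)
    (hsym : ∀ i j, ∀ x ∈ U, a i j x = a j i x)
    (hpos : ∀ ξ : Euc n, ξ ≠ 0 → 0 < ∑ i, ∑ j, a i j p * ξ i * ξ j)
    {u : Euc n → ℝ} (hu : ContDiffOn ℝ (⊤ : ℕ∞) u U) {K : ℝ} (hK : 0 ≤ K)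
    (hL : ∀ᶠ x in 𝓝 p,
      |∑ i, ∑ j, a i j x * pd i (pd j u) x| ≤ K * (|u x| + ∑ i, |pd i u x|))
    (hflat : ∀ k, SFlat k u p) : ∀ᶠ x in 𝓝 p, u x = 0 := by
  obtain ⟨r, hr, hrU, χ, hχ1, hχ0, -, hχ⟩ := exists_cutoff hU hp
  obtain ⟨T, S, hST, hTS, hSA⟩ := exists_matrix_normalization (hsym · · p hp) hpos
  set L : Euc n →L[ℝ] Euc n := (Matrix.toEuclideanCLM (n := Fin n) (𝕜 := ℝ) T) with hLd
  have hLT : ∀ i k, L (EuclideanSpace.single i 1) k = T k i := fun i k => by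
    simp [hLd, Matrix.ofLp_toEuclideanCLM]
  set u' : Euc n → ℝ := fun x => χ x * u x with hu'
  have hu's : ContDiff ℝ (⊤ : ℕ∞) u' := hχ u hu
  have huu : EqOn u u' (ball p r) := fun x hx => by simp [hu', hχ1 x hx]
  have hpu : ∀ i, EqOn (pd i u) (pd i u') (ball p r) := pd_congr isOpen_ball huu
  set a' : Fin n → Fin n → Euc n → ℝ := fun i j x => χ x * a i j x with ha'
  have ha's : ∀ i j, ContDiff ℝ (⊤ : ℕ∞) (a' i j) := fun i j => hχ _ (ha i j)
  set v : Euc n → ℝ := fun y => u' (p + L y) with hv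
  have hvs : ContDiff ℝ (⊤ : ℕ∞) v := hu's.comp_affine L p
  set b : Fin n → Fin n → Euc n → ℝ :=
    fun i j y => ∑ k, ∑ l, S i k * a' k l (p + L y) * S j l with hb
  have hbs : ∀ i j, ContDiff ℝ (⊤ : ℕ∞) (b i j) := fun i j =>
    ContDiff.sum fun k _ => ContDiff.sum fun l _ =>
      (contDiff_const.mul ((ha's k l).comp_affine L p)).mul contDiff_const
  have ha'sym : ∀ i j x, a' i j x = a' j i x := fun i j x => by
    by_cases hx : x ∈ U
    · simp [ha', hsym i j x hx]
    · simp [ha', hχ0 x hx]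
  have hbsym : ∀ i j x, b i j x = b j i x := fun i j x => by
    simp only [hb]
    rw [Finset.sum_comm]
    exact Finset.sum_congr rfl fun k _ => Finset.sum_congr rfl fun l _ => by
      rw [ha'sym l k]; ring
  have hb0 : ∀ i j, b i j 0 = if i = j then 1 else 0 := fun i j => by
    simp [hb, ha', hχ1 p (mem_ball_self hr), hSA]
  have hvflat : ∀ k, SFlat k v 0 := fun k =>
    ((hflat k).congr isOpen_ball (mem_ball_self hr) huu).comp_affine hu's L
  have hcont : Tendsto (fun y => p + L y) (𝓝 0) (𝓝 p) := by
    have : Continuous fun y => p + L y := by fun_prop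
    simpa using this.tendsto 0
  obtain ⟨s, hs, hLs⟩ := Metric.eventually_nhds_iff_ball.1
    (hcont.eventually (hL.and (ball_mem_nhds p hr)))
  have hpdu : ∀ k y, pd k u' (p + L y) = ∑ i, S i k * pd i v y := fun k y => by
    have h1 : ∀ i, pd i v y = ∑ l, T l i * pd l u' (p + L y) := fun i => by
      rw [hv, pd_comp_affine (hu's.differentiable (by simp))]; simp [hLT]
    simp only [h1, Finset.mul_sum]
    rw [Finset.sum_comm]
    have h2 : ∀ l, ∑ i, T l i * S i k = if l = k then 1 else 0 := fun l => by
      rw [← Matrix.mul_apply, hTS, Matrix.one_apply]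
    calc _ = ∑ l, (∑ i, T l i * S i k) * pd l u' (p + L y) := by simp [h2]
      _ = _ := by
        refine Finset.sum_congr rfl fun l _ => ?_
        rw [Finset.sum_mul]
        exact Finset.sum_congr rfl fun i _ => by ring
  have hLv : ∀ y ∈ ball (0 : Euc n) s, |∑ i, ∑ j, b i j y * pd i (pd j v) y|
      ≤ K * (1 + ∑ k, ∑ i, |S i k|) * (|v y| + ∑ i, |pd i v y|) := by
    intro y hy
    obtain ⟨h1, h2⟩ := hLs y hy
    have h3 : ∑ i, ∑ j, b i j y * pd i (pd j v) y
        = ∑ i, ∑ j, a i j (p + L y) * pd i (pd j u) (p + L y) := by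
      rw [hv, sum_conj_mul_pd_pd_comp_affine hu's hTS L hLT (fun k l => a' k l (p + L y))]
      refine Finset.sum_congr rfl fun i _ => Finset.sum_congr rfl fun j _ => ?_
      rw [pd_congr isOpen_ball (hpu j) i h2]
      simp [ha', hχ1 _ h2]
    rw [h3]
    refine h1.trans ?_
    rw [mul_assoc]
    refine mul_le_mul_of_nonneg_left ?_ hK
    have h4 : |u (p + L y)| = |v y| := by rw [huu h2]
    have h5 : ∑ k, |pd k u (p + L y)| ≤ (∑ k, ∑ i, |S i k|) * (|v y| + ∑ i, |pd i v y|) := by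
      rw [Finset.sum_mul]
      refine Finset.sum_le_sum fun k _ => ?_
      rw [hpu k h2, hpdu, Finset.sum_mul]
      refine (Finset.abs_sum_le_sum_abs _ _).trans (Finset.sum_le_sum fun i _ => ?_)
      rw [abs_mul]
      refine mul_le_mul_of_nonneg_left ?_ (abs_nonneg _)
      exact (Finset.single_le_sum (f := fun i => |pd i v y|) (fun i _ => abs_nonneg _)
        (Finset.mem_univ i)).trans (le_add_of_nonneg_left (abs_nonneg _))
    have h6 : 0 ≤ ∑ i, |pd i v y| := Finset.sum_nonneg fun i _ => abs_nonneg _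
    rw [h4, add_mul, one_mul]
    linarith
  obtain ⟨r₁, hr₁, hzero⟩ := eq_zero_near_zero_of_flat_of_nondivergence hn hbs hbsym hb0 hvs
    hs hLv hvflat
  have hcont' : Tendsto (fun x => Matrix.toEuclideanCLM (n := Fin n) (𝕜 := ℝ) S (x - p))
      (𝓝 p) (𝓝 0) := by
    have : Continuous fun x => Matrix.toEuclideanCLM (n := Fin n) (𝕜 := ℝ) S (x - p) := by
      fun_prop
    simpa using this.tendsto p
  filter_upwards [hcont'.eventually (ball_mem_nhds 0 hr₁), ball_mem_nhds p hr] with x hx hxr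
  have h1 := hzero _ hx
  have h2 : L (Matrix.toEuclideanCLM (n := Fin n) (𝕜 := ℝ) S (x - p)) = x - p := by
    rw [hLd, ← mul_apply_eq_comp, ← map_mul, hTS, map_one,
      one_apply_eq_self]
  rw [hv] at h1
  simp only [h2, add_sub_cancel] at h1
  rw [huu hxr, h1]

end Carleman

end SmoothCoefficients

section FiniteOrder

variable {n : ℕ}

theorem gradient_eq_toLp_pd (f : Euc n → ℝ) :
    gradient f = fun x => WithLp.toLp 2 fun i => pd i f x := by
  funext x
  ext i
  exact gradient_apply_eq_pd f x i

theorem norm_le_sum_abs (v : Euc n) : ‖v‖ ≤ ∑ i, |v i| := by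
  have h : v = ∑ i, v i • EuclideanSpace.single i (1 : ℝ) := by
    ext j
    simp [Finset.sum_apply, Pi.single_apply]
  conv_lhs => rw [h]
  refine (norm_sum_le _ _).trans (Finset.sum_le_sum fun i _ => ?_)
  simp [norm_smul]

theorem contDiffOn_gradient {U : Set (Euc n)} (hU : IsOpen U) {u : Euc n → ℝ}
    (hu : ContDiffOn ℝ (⊤ : ℕ∞) u U) : ContDiffOn ℝ (⊤ : ℕ∞) (gradient u) U := by
  rw [gradient_eq_toLp_pd, contDiffOn_euclidean]
  exact fun i => hu.pd hU i

theorem exists_abs_le_of_zero_section {U : Set (Euc n)} (hU : IsOpen U)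
    {F : Euc n → ℝ → Euc n → ℝ}
    (hF : ContDiffOn ℝ (⊤ : ℕ∞) (fun p : Euc n × ℝ × Euc n => F p.1 p.2.1 p.2.2)
      (U ×ˢ (univ : Set (ℝ × Euc n))))
    (hF0 : ∀ x ∈ U, F x 0 0 = 0) {u : Euc n → ℝ} (hu : ContDiffOn ℝ (⊤ : ℕ∞) u U) {p : Euc n}
    (hp : p ∈ U) (h0 : u p = 0) (h1 : gradient u p = 0) :
    ∃ K ≥ 0, ∀ᶠ x in 𝓝 p, |F x (u x) (gradient u x)| ≤ K * (|u x| + ∑ i, |pd i u x|) := by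
  have hG : ContDiffAt ℝ 1 (fun p : Euc n × ℝ × Euc n => F p.1 p.2.1 p.2.2) (p, 0, 0) :=
    (hF.contDiffAt ((hU.prod isOpen_univ).mem_nhds ⟨hp, mem_univ _⟩)).of_le (by simp)
  obtain ⟨K, t, ht, hlip⟩ := hG.exists_lipschitzOnWith
  have hc1 : ContinuousAt (fun x => (x, u x, gradient u x)) p :=
    continuousAt_id.prodMk (((hu.continuousOn.continuousAt (hU.mem_nhds hp))).prodMk
      ((contDiffOn_gradient hU hu).continuousOn.continuousAt (hU.mem_nhds hp)))
  have hc2 : ContinuousAt (fun x : Euc n => (x, (0 : ℝ), (0 : Euc n))) p := by fun_prop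
  refine ⟨K, K.2, ?_⟩
  have ht' : t ∈ 𝓝 (p, u p, gradient u p) := by rwa [h0, h1]
  filter_upwards [hc1 ht', hc2 ht, hU.mem_nhds hp] with x hx1 hx2 hxU
  have h := hlip.dist_le_mul _ hx1 _ hx2
  simp only [hF0 x hxU, Real.dist_eq, sub_zero] at h
  refine h.trans (mul_le_mul_of_nonneg_left ?_ K.2)
  have h3 : ‖gradient u x‖ ≤ ∑ i, |pd i u x| :=
    (norm_le_sum_abs _).trans_eq (Finset.sum_congr rfl fun i _ => by rw [gradient_apply_eq_pd])
  rw [dist_eq_norm]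
  simp only [Prod.mk_sub_mk, sub_self, sub_zero, Prod.norm_def, norm_zero, Real.norm_eq_abs]
  have h4 : 0 ≤ ∑ i, |pd i u x| := Finset.sum_nonneg fun i _ => abs_nonneg _
  refine max_le (by positivity) (max_le (by linarith) ?_)
  have := abs_nonneg (u x)
  linarith

theorem SFlat.isOpen_not {U : Set (Euc n)} (hU : IsOpen U) {u : Euc n → ℝ}
    (hu : ContDiffOn ℝ (⊤ : ℕ∞) u U) (k : ℕ) : IsOpen {x ∈ U | ¬ SFlat k u x} := by
  induction k generalizing u with
  | zero => simp [SFlat]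
  | succ k ih =>
    have : {x ∈ U | ¬ SFlat (k + 1) u x}
        = (U ∩ u ⁻¹' {0}ᶜ) ∪ ⋃ i, {x ∈ U | ¬ SFlat k (pd i u) x} := by
      ext x
      simp only [SFlat, mem_ofPred_eq, mem_union, mem_inter_iff, mem_preimage, mem_compl_iff,
        mem_singleton_iff, mem_iUnion, not_and_or, not_forall]
      tauto
    rw [this]
    exact (hu.continuousOn.isOpen_inter_preimage hU isOpen_compl_singleton).union
      (isOpen_iUnion fun i => ih (hu.pd hU i))

theorem SFlat.of_eventuallyEq_zero {u : Euc n → ℝ} {p : Euc n} (h : ∀ᶠ x in 𝓝 p, u x = 0)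
    (k : ℕ) : SFlat k u p := by
  obtain ⟨V, hV, hVo, hp⟩ := _root_.eventually_nhds_iff.1 h
  exact SFlat.zero.congr hVo hp fun x hx => (hV x hx).symm

/-- A nontrivial solution vanishes to finite order at every point. -/
theorem exists_not_sflat (hn : 1 ≤ n) {U : Set (Euc n)} (hU : IsOpen U) (hUc : IsConnected U)
    {a : Fin n → Fin n → Euc n → ℝ} (ha : ∀ i j, ContDiffOn ℝ (⊤ : ℕ∞) (a i j) U)
    (hsym : ∀ i j, ∀ x ∈ U, a i j x = a j i x)
    (hpos : ∀ x ∈ U, ∀ ξ : Euc n, ξ ≠ 0 → 0 < ∑ i, ∑ j, a i j x * ξ i * ξ j)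
    {F : Euc n → ℝ → Euc n → ℝ}
    (hF : ContDiffOn ℝ (⊤ : ℕ∞) (fun p : Euc n × ℝ × Euc n => F p.1 p.2.1 p.2.2)
      (U ×ˢ (univ : Set (ℝ × Euc n))))
    (hF0 : ∀ x ∈ U, F x 0 0 = 0) {u : Euc n → ℝ} (hu : ContDiffOn ℝ (⊤ : ℕ∞) u U)
    (hpde : ∀ x ∈ U, ∑ i, ∑ j, a i j x * pd i (pd j u) x = F x (u x) (gradient u x))
    (hne : ∃ x ∈ U, u x ≠ 0) {p : Euc n} (hp : p ∈ U) : ∃ k, ¬ SFlat k u p := by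
  by_contra! hflat
  set A : Set (Euc n) := {x ∈ U | ∀ k, SFlat k u x}
  set B : Set (Euc n) := ⋃ k, {x ∈ U | ¬ SFlat k u x}
  have hzero : ∀ q ∈ A, ∀ᶠ x in 𝓝 q, u x = 0 := fun q hq => by
    obtain ⟨hqU, hqf⟩ := hq
    have hg : gradient u q = 0 := by
      ext i
      rw [gradient_apply_eq_pd]
      exact ((hqf 2).2 i).1
    obtain ⟨K, hK, hFK⟩ := exists_abs_le_of_zero_section hU hF hF0 hu hqU (hqf 1).1 hg
    refine Carleman.eventually_eq_zero_of_flat hU hqU hn ha hsym (hpos q hqU) hu hK ?_ hqf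
    filter_upwards [hFK, hU.mem_nhds hqU] with x hx hxU
    rwa [hpde x hxU]
  have hA : IsOpen A := by
    rw [isOpen_iff_eventually]
    intro q hq
    filter_upwards [(hzero q hq).eventually_nhds, hU.mem_nhds hq.1] with x hx hxU
    exact ⟨hxU, SFlat.of_eventuallyEq_zero hx⟩
  have hB : IsOpen B := isOpen_iUnion fun k => SFlat.isOpen_not hU hu k
  have hUA : U ⊆ A := by
    refine hUc.isPreconnected.subset_left_of_subset_union hA hB ?_ (fun x hx => ?_)
      ⟨p, hp, hp, hflat⟩
    · rw [disjoint_left]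
      intro x hxA hxB
      obtain ⟨k, hk⟩ := mem_iUnion.1 hxB
      exact hk.2 (hxA.2 k)
    · by_cases h : ∀ k, SFlat k u x
      · exact Or.inl ⟨hx, h⟩
      · push Not at h
        obtain ⟨k, hk⟩ := h
        exact Or.inr (mem_iUnion.2 ⟨k, hx, hk⟩)
  obtain ⟨x, hx, hux⟩ := hne
  exact hux ((hUA hx).2 1).1

end FiniteOrder

section WordDerivatives

variable {n : ℕ}

/-- The iterated partial derivative of `f` along a word of directions. -/
def pdw {n : ℕ} : List (Fin n) → (Euc n → ℝ) → Euc n → ℝ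
  | [], f => f
  | i :: w, f => pdw w (pd i f)

section Words

variable {U : Set (Euc n)} {f g : Euc n → ℝ} {p : Euc n}

theorem ContDiffOn.pdw (hU : IsOpen U) (hf : ContDiffOn ℝ (⊤ : ℕ∞) f U) (w : List (Fin n)) :
    ContDiffOn ℝ (⊤ : ℕ∞) (pdw w f) U := by
  induction w generalizing f with
  | nil => exact hf
  | cons i w ih => exact ih (hf.pd hU i)

theorem ContDiff.pdw (hf : ContDiff ℝ (⊤ : ℕ∞) f) (w : List (Fin n)) :
    ContDiff ℝ (⊤ : ℕ∞) (pdw w f) :=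
  contDiffOn_univ.1 (hf.contDiffOn.pdw isOpen_univ w)

theorem pdw_congr (hU : IsOpen U) (h : EqOn f g U) (w : List (Fin n)) :
    EqOn (pdw w f) (pdw w g) U := by
  induction w generalizing f g with
  | nil => exact h
  | cons i w ih => exact ih (pd_congr hU h i)

theorem pd_pdw (hU : IsOpen U) (hf : ContDiffOn ℝ (⊤ : ℕ∞) f U) (i : Fin n) (w : List (Fin n)) :
    EqOn (pd i (pdw w f)) (pdw (i :: w) f) U := by
  induction w generalizing f with
  | nil => exact fun _ _ => rfl
  | cons j w ih =>
    exact (ih (hf.pd hU j)).trans (pdw_congr hU (pd_comm hU hf i j) w)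

theorem pdw_swap (hU : IsOpen U) (hf : ContDiffOn ℝ (⊤ : ℕ∞) f U) (i j : Fin n)
    (w : List (Fin n)) : EqOn (pdw (i :: j :: w) f) (pdw (j :: i :: w) f) U :=
  pdw_congr hU (fun _ hx => pd_comm hU hf j i hx) w

theorem sflat_iff_pdw {k : ℕ} : SFlat k f p ↔ ∀ w : List (Fin n), w.length < k → pdw w f p = 0 := by
  induction k generalizing f with
  | zero => simp [SFlat]
  | succ k ih =>
    simp only [SFlat, ih]
    constructor
    · rintro ⟨h0, h1⟩ w hw
      cases w with
      | nil => exact h0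
      | cons i w => exact h1 i w (by simpa using hw)
    · exact fun h => ⟨h [] (by simp), fun i w hw => h (i :: w) (by simpa using hw)⟩

theorem SFlat.pdw_eq_zero {k : ℕ} (h : SFlat k f p) {w : List (Fin n)} (hw : w.length < k) :
    pdw w f p = 0 := sflat_iff_pdw.1 h w hw

theorem exists_pdw_ne_zero {k : ℕ} (h : SFlat k f p) (h' : ¬ SFlat (k + 1) f p) :
    ∃ w : List (Fin n), w.length = k ∧ pdw w f p ≠ 0 := by
  rw [sflat_iff_pdw] at h h'
  push Not at h'
  obtain ⟨w, hw, hne⟩ := h'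
  refine ⟨w, le_antisymm (by omega) ?_, hne⟩
  by_contra! hlt
  exact hne (h w hlt)

theorem pdw_add (hU : IsOpen U) (hf : ContDiffOn ℝ (⊤ : ℕ∞) f U)
    (hg : ContDiffOn ℝ (⊤ : ℕ∞) g U) (w : List (Fin n)) :
    EqOn (pdw w fun x => f x + g x) (fun x => pdw w f x + pdw w g x) U := by
  induction w generalizing f g with
  | nil => exact fun _ _ => rfl
  | cons i w ih =>
    refine EqOn.trans (pdw_congr hU (fun x hx => ?_) w) (ih (hf.pd hU i) (hg.pd hU i))
    exact pd_add (hf.differentiableAt_of_isOpen hU hx) (hg.differentiableAt_of_isOpen hU hx) i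

theorem pdw_const_mul (hU : IsOpen U) (hf : ContDiffOn ℝ (⊤ : ℕ∞) f U) (c : ℝ)
    (w : List (Fin n)) : EqOn (pdw w fun x => c * f x) (fun x => c * pdw w f x) U := by
  induction w generalizing f with
  | nil => exact fun _ _ => rfl
  | cons i w ih =>
    refine EqOn.trans (pdw_congr hU (fun x hx => ?_) w) (ih (hf.pd hU i))
    exact pd_const_mul c (hf.differentiableAt_of_isOpen hU hx) i

theorem pdw_zero (w : List (Fin n)) : pdw w (fun _ : Euc n => (0 : ℝ)) = fun _ => 0 := by
  induction w with
  | nil => rfl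
  | cons i w ih => simpa [pdw] using ih

theorem pdw_sum (hU : IsOpen U) {ι : Type*} (s : Finset ι) {F : ι → Euc n → ℝ}
    (hF : ∀ j, ContDiffOn ℝ (⊤ : ℕ∞) (F j) U) (w : List (Fin n)) :
    EqOn (pdw w fun x => ∑ j ∈ s, F j x) (fun x => ∑ j ∈ s, pdw w (F j) x) U := by
  classical
  induction s using Finset.induction_on with
  | empty => simp [pdw_zero, EqOn]
  | insert a s ha ih =>
    intro x hx
    simp only [Finset.sum_insert ha]
    have h := pdw_add hU (hF a) (ContDiffOn.sum fun j _ => hF j : ContDiffOn ℝ (⊤ : ℕ∞)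
      (fun x => ∑ j ∈ s, F j x) U) w hx
    exact h.trans (congrArg _ (ih hx))

end Words

/-- Composition of the jet of a flat function with a smooth function vanishing on the zero
section is flat. -/
theorem SFlat.comp_jet {U : Set (Euc n)} (hU : IsOpen U) {p : Euc n} (hp : p ∈ U) {u : Euc n → ℝ}
    (hu : ContDiffOn ℝ (⊤ : ℕ∞) u U) {k : ℕ} (h0 : SFlat k u p) (h1 : ∀ i, SFlat k (pd i u) p)
    {H : Euc n × ℝ × Euc n → ℝ}
    (hH : ContDiffOn ℝ (⊤ : ℕ∞) H (U ×ˢ (univ : Set (ℝ × Euc n))))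
    (hH0 : ∀ x ∈ U, H (x, 0, 0) = 0) : SFlat k (fun x => H (x, u x, gradient u x)) p := by
  have hO : IsOpen (U ×ˢ (univ : Set (ℝ × Euc n))) := hU.prod isOpen_univ
  have hj : ContDiffOn ℝ (⊤ : ℕ∞) (fun x => (x, u x, gradient u x)) U :=
    contDiffOn_id.prodMk (hu.prodMk (contDiffOn_gradient hU hu))
  have hcomp : ∀ {G : Euc n × ℝ × Euc n → ℝ},
      ContDiffOn ℝ (⊤ : ℕ∞) G (U ×ˢ (univ : Set (ℝ × Euc n))) →
      ContDiffOn ℝ (⊤ : ℕ∞) (fun x => G (x, u x, gradient u x)) U := fun hG =>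
    hG.comp hj fun x hx => ⟨hx, mem_univ _⟩
  have hder : ∀ {G : Euc n × ℝ × Euc n → ℝ} (v : Euc n × ℝ × Euc n),
      ContDiffOn ℝ (⊤ : ℕ∞) G (U ×ˢ (univ : Set (ℝ × Euc n))) →
      ContDiffOn ℝ (⊤ : ℕ∞) (fun q => fderiv ℝ G q v) (U ×ˢ (univ : Set (ℝ × Euc n))) :=
    fun v hG => (hG.fderiv_of_isOpen hO (by simp)).clm_apply contDiffOn_const
  induction k generalizing H with
  | zero => trivial
  | succ k ih =>
    have hg : gradient u p = 0 := by
      ext i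
      rw [gradient_apply_eq_pd]
      exact (h1 i).1
    refine ⟨by simp only [h0.1, hg, hH0 p hp], fun i => ?_⟩
    have e : EqOn (fun x =>
        fderiv ℝ H (x, u x, gradient u x) (EuclideanSpace.single i 1, 0, 0)
        + fderiv ℝ H (x, u x, gradient u x) (0, 1, 0) * pd i u x
        + ∑ j, fderiv ℝ H (x, u x, gradient u x) (0, 0, EuclideanSpace.single j 1)
            * pd i (pd j u) x)
        (pd i fun x => H (x, u x, gradient u x)) U := by
      intro x hx
      have d1 : HasFDerivAt H (fderiv ℝ H (x, u x, gradient u x)) (x, u x, gradient u x) :=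
        ((hH.contDiffAt (hO.mem_nhds ⟨hx, mem_univ _⟩)).differentiableAt (by simp)).hasFDerivAt
      have dg : DifferentiableAt ℝ (gradient u) x :=
        (((contDiffOn_gradient hU hu).contDiffAt (hU.mem_nhds hx)).differentiableAt (by simp))
      have d2 : HasFDerivAt (fun x => (x, u x, gradient u x))
          ((ContinuousLinearMap.id ℝ (Euc n)).prod
            ((fderiv ℝ u x).prod (fderiv ℝ (gradient u) x))) x :=
        (hasFDerivAt_id x).prodMk
          ((hu.differentiableAt_of_isOpen hU hx).hasFDerivAt.prodMk dg.hasFDerivAt)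
      have hv : ((ContinuousLinearMap.id ℝ (Euc n)).prod
            ((fderiv ℝ u x).prod (fderiv ℝ (gradient u) x))) (EuclideanSpace.single i 1)
          = (EuclideanSpace.single i 1, 0, 0) + pd i u x • (0, 1, 0)
            + ∑ j, pd i (pd j u) x • (0, 0, EuclideanSpace.single j (1 : ℝ)) := by
        have hgj : fderiv ℝ (gradient u) x (EuclideanSpace.single i 1)
            = ∑ j, pd i (pd j u) x • EuclideanSpace.single j (1 : ℝ) := by
          ext j
          have h3 : HasFDerivAt (fun y => gradient u y j)
              ((EuclideanSpace.proj j : Euc n →L[ℝ] ℝ).comp (fderiv ℝ (gradient u) x)) x :=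
            (EuclideanSpace.proj j : Euc n →L[ℝ] ℝ).hasFDerivAt.comp x dg.hasFDerivAt
          have h4 : pd i (pd j u) x = fderiv ℝ (gradient u) x (EuclideanSpace.single i 1) j := by
            rw [show pd j u = fun y => gradient u y j from
              funext fun y => (gradient_apply_eq_pd u y j).symm, pd, h3.fderiv]
            rfl
          rw [← h4]
          simp [Finset.sum_apply, Pi.single_apply]
        have hs : ∑ j, pd i (pd j u) x • ((0 : Euc n), (0 : ℝ), EuclideanSpace.single j (1 : ℝ))
            = (0, 0, ∑ j, pd i (pd j u) x • EuclideanSpace.single j (1 : ℝ)) := by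
          simp only [Prod.smul_mk, smul_zero]
          refine Prod.ext ?_ (Prod.ext ?_ ?_)
          · simp [Prod.fst_sum]
          · simp [Prod.fst_sum, Prod.snd_sum]
          · simp [Prod.snd_sum]
        rw [hs]
        simp [hgj, pd]
      have d3 : HasFDerivAt (fun x => H (x, u x, gradient u x)) _ x := d1.comp x d2
      refine Eq.trans ?_ ((DFunLike.congr_fun d3.fderiv _).trans
        (congrArg (fderiv ℝ H (x, u x, gradient u x)) hv)).symm
      rw [map_add, map_add, map_smul, map_sum]
      simp only [map_smul, smul_eq_mul]
      rw [mul_comm (pd i u x)]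
      congr 1
      exact Finset.sum_congr rfl fun j _ => mul_comm _ _
    have s1 := hcomp (hder (EuclideanSpace.single i 1, 0, 0) hH)
    have s2 := hcomp (hder (0, 1, 0) hH)
    have s3 := fun j : Fin n => hcomp (hder (0, 0, EuclideanSpace.single j 1) hH)
    refine SFlat.congr hU hp e (SFlat.add hU hp (s1.add (s2.mul (hu.pd hU i)))
      (ContDiffOn.sum fun j _ => (s3 j).mul ((hu.pd hU j).pd hU i))
      (SFlat.add hU hp s1 (s2.mul (hu.pd hU i)) ?_ ?_) ?_)
    · refine ih h0.of_succ (fun j => (h1 j).of_succ)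
        (hder (EuclideanSpace.single i 1, 0, 0) hH) fun x hx => ?_
      have d1 : HasFDerivAt H (fderiv ℝ H (x, 0, 0)) (x, 0, 0) :=
        ((hH.contDiffAt (hO.mem_nhds ⟨hx, mem_univ _⟩)).differentiableAt (by simp)).hasFDerivAt
      have d2 : HasFDerivAt (fun y : Euc n => (y, (0 : ℝ), (0 : Euc n)))
          ((ContinuousLinearMap.id ℝ (Euc n)).prod 0) x :=
        (hasFDerivAt_id x).prodMk (hasFDerivAt_const _ _)
      have d3 := d1.comp x d2
      have d4 : HasFDerivAt (fun y : Euc n => H (y, 0, 0)) (0 : Euc n →L[ℝ] ℝ) x :=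
        (hasFDerivAt_const (0 : ℝ) x).congr_of_eventuallyEq
          (by filter_upwards [hU.mem_nhds hx] with y hy using hH0 y hy)
      have := DFunLike.congr_fun (d3.unique d4) (EuclideanSpace.single i 1)
      simpa [← Prod.mk_zero_zero] using this
    · exact SFlat.mul_left hU hp s2 (hu.pd hU i) (h0.2 i)
    · exact SFlat.sum hU hp _ (fun j => (s3 j).mul ((hu.pd hU j).pd hU i)) fun j =>
        SFlat.mul_left hU hp (s3 j) ((hu.pd hU j).pd hU i) ((h1 j).2 i)

end WordDerivatives

section Independence

variable {n : ℕ} {U : Set (Euc n)} {a : Fin n → Fin n → Euc n → ℝ} {F : Euc n → ℝ → Euc n → ℝ}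
  {u : Euc n → ℝ} {p : Euc n} {k : ℕ}

/-- The principal part with coefficients frozen at `p` vanishes to higher order at `p`. -/
theorem SFlat.frozen_principal_part (hU : IsOpen U) (ha : ∀ i j, ContDiffOn ℝ (⊤ : ℕ∞) (a i j) U)
    (hF : ContDiffOn ℝ (⊤ : ℕ∞) (fun p : Euc n × ℝ × Euc n => F p.1 p.2.1 p.2.2)
      (U ×ˢ (univ : Set (ℝ × Euc n))))
    (hF0 : ∀ x ∈ U, F x 0 0 = 0) (hu : ContDiffOn ℝ (⊤ : ℕ∞) u U)
    (hpde : ∀ x ∈ U, ∑ i, ∑ j, a i j x * pd i (pd j u) x = F x (u x) (gradient u x))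
    (hp : p ∈ U) (h : SFlat (k + 2) u p) :
    SFlat (k + 1) (fun x => ∑ i, ∑ j, a i j p * pd i (pd j u) x) p := by
  have hd : ∀ i j, ContDiffOn ℝ (⊤ : ℕ∞) (pd i (pd j u)) U := fun i j => (hu.pd hU j).pd hU i
  have s1 : ∀ i j, ContDiffOn ℝ (⊤ : ℕ∞) (fun x => a i j x - a i j p) U :=
    fun i j => (ha i j).sub contDiffOn_const
  have s2 : ∀ i j, ContDiffOn ℝ (⊤ : ℕ∞) (fun x => (a i j x - a i j p) * pd i (pd j u) x) U :=
    fun i j => (s1 i j).mul (hd i j)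
  have hR : SFlat (k + 1) (fun x => F x (u x) (gradient u x)) p :=
    SFlat.comp_jet (H := fun q => F q.1 q.2.1 q.2.2) hU hp hu h.of_succ (fun i => h.2 i) hF hF0
  have hL : SFlat (k + 1)
      (fun x => ∑ i, ∑ j, (a i j x - a i j p) * pd i (pd j u) x) p := by
    refine SFlat.sum hU hp _ (fun i => ContDiffOn.sum fun j _ => s2 i j) fun i =>
      SFlat.sum hU hp _ (fun j => s2 i j) fun j => ?_
    rw [add_comm]
    exact SFlat.mul hU hp (s1 i j) (hd i j) ⟨sub_self _, fun _ => trivial⟩ ((h.2 j).2 i)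
  have sR : ContDiffOn ℝ (⊤ : ℕ∞) (fun x => F x (u x) (gradient u x)) U :=
    (ContDiffOn.sum fun i _ => ContDiffOn.sum fun j _ => (ha i j).mul (hd i j)).congr
      fun x hx => (hpde x hx).symm
  refine (SFlat.sub hU hp sR
    (ContDiffOn.sum fun i _ => ContDiffOn.sum fun j _ => s2 i j) hR hL).congr hU hp fun x hx => ?_
  simp only [← hpde x hx, ← Finset.sum_sub_distrib]
  exact Finset.sum_congr rfl fun i _ => Finset.sum_congr rfl fun j _ => by ring

/-- At a zero of order at least two of a solution, two derivatives of the solution vanish and have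
linearly independent gradients. -/
theorem exists_independent_pd (hU : IsOpen U) (ha : ∀ i j, ContDiffOn ℝ (⊤ : ℕ∞) (a i j) U)
    (hpos : ∀ x ∈ U, ∀ ξ : Euc n, ξ ≠ 0 → 0 < ∑ i, ∑ j, a i j x * ξ i * ξ j)
    (hF : ContDiffOn ℝ (⊤ : ℕ∞) (fun p : Euc n × ℝ × Euc n => F p.1 p.2.1 p.2.2)
      (U ×ˢ (univ : Set (ℝ × Euc n))))
    (hF0 : ∀ x ∈ U, F x 0 0 = 0) (hu : ContDiffOn ℝ (⊤ : ℕ∞) u U)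
    (hpde : ∀ x ∈ U, ∑ i, ∑ j, a i j x * pd i (pd j u) x = F x (u x) (gradient u x))
    (hp : p ∈ U) (h : SFlat (k + 2) u p) (h' : ¬ SFlat (k + 3) u p) :
    ∃ w₁ w₂ : List (Fin n), pdw w₁ u p = 0 ∧ pdw w₂ u p = 0 ∧
      ∃ i j, pd i (pdw w₁ u) p * pd j (pdw w₂ u) p - pd j (pdw w₁ u) p * pd i (pdw w₂ u) p ≠ 0 := by
  by_contra! hcon
  have hT : ∀ w₁ w₂ : List (Fin n), w₁.length = k + 1 → w₂.length = k + 1 → ∀ i j,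
      pdw (i :: w₁) u p * pdw (j :: w₂) u p = pdw (j :: w₁) u p * pdw (i :: w₂) u p := by
    intro w₁ w₂ h1 h2 i j
    have := hcon w₁ w₂ (h.pdw_eq_zero (by omega)) (h.pdw_eq_zero (by omega)) i j
    simp only [pd_pdw hU hu _ _ hp] at this
    linarith
  obtain ⟨w, hwl, hw⟩ := exists_pdw_ne_zero h h'
  match w, hwl, hw with
  | b :: c :: w₀, hwl, hw =>
  simp only [List.length_cons, Nat.add_right_cancel_iff] at hwl
  set ℓ : Fin n → ℝ := fun i => pdw (i :: c :: w₀) u p with hℓ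
  have hb : ℓ b ≠ 0 := hw
  have hij : ∀ v : List (Fin n), v.length = k → ∀ i j,
      pdw (i :: j :: v) u p * ℓ b ^ 2 = pdw (b :: b :: v) u p * (ℓ i * ℓ j) := by
    intro v hv i j
    have e1 := hT (j :: v) (c :: w₀) (by simp [hv]) (by simp [hwl]) i b
    have e2 := hT (b :: v) (c :: w₀) (by simp [hv]) (by simp [hwl]) j b
    rw [pdw_swap hU hu b j v hp] at e1
    change _ * ℓ b = _ * ℓ i at e1
    change _ * ℓ b = _ * ℓ j at e2
    linear_combination ℓ b * e1 + ℓ i * e2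
  have hbb : pdw (b :: b :: w₀) u p = 0 := by
    have hd : ∀ i j, ContDiffOn ℝ (⊤ : ℕ∞) (pd i (pd j u)) U := fun i j => (hu.pd hU j).pd hU i
    have e := (SFlat.frozen_principal_part hU ha hF hF0 hu hpde hp h).pdw_eq_zero
      (w := w₀) (by omega)
    rw [pdw_sum hU _ (fun i => ContDiffOn.sum fun j _ => contDiffOn_const.mul (hd i j)) w₀ hp]
      at e
    have e' : ∑ i, ∑ j, a i j p * pdw (i :: j :: w₀) u p = 0 := by
      rw [← e]
      refine Finset.sum_congr rfl fun i _ => ?_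
      rw [pdw_sum hU _ (fun j => contDiffOn_const.mul (hd i j)) w₀ hp]
      refine Finset.sum_congr rfl fun j _ => ?_
      rw [pdw_const_mul hU (hd i j) _ w₀ hp, pdw_swap hU hu i j w₀ hp]
      rfl
    have hξ : (WithLp.toLp 2 ℓ : Euc n) ≠ 0 := fun h0 => hb (congrArg (fun v : Euc n => v b) h0)
    have hpos' := hpos p hp _ hξ
    have e3 : pdw (b :: b :: w₀) u p * ∑ i, ∑ j, a i j p * ℓ i * ℓ j = 0 := by
      have := congrArg (· * ℓ b ^ 2) e'
      simp only [Finset.sum_mul, zero_mul] at this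
      rw [← this, Finset.mul_sum]
      refine Finset.sum_congr rfl fun i _ => ?_
      rw [Finset.mul_sum]
      refine Finset.sum_congr rfl fun j _ => ?_
      linear_combination -(a i j p) * hij w₀ hwl i j
    exact (mul_eq_zero.1 e3).resolve_right hpos'.ne'
  have := hij w₀ hwl b c
  rw [hbb, zero_mul] at this
  exact hw ((mul_eq_zero.1 this).resolve_right (pow_ne_zero 2 hb))

end Independence

section Rectifiability

variable {n m : ℕ}

theorem CountablyCinfRectifiable.of_countable {ι : Type*} [Countable ι] {S : Set (Euc n)}
    {g : ι → Euc m → Euc n} (hg : ∀ i, ContDiff ℝ (⊤ : ℕ∞) (g i)) (hS : S ⊆ ⋃ i, range (g i)) :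
    CountablyCinfRectifiable m S := by
  rcases isEmpty_or_nonempty ι with h | h
  · refine ⟨fun _ _ => 0, fun _ => contDiff_const, ?_⟩
    rw [iUnion_of_empty] at hS
    exact hS.trans (empty_subset _)
  · obtain ⟨f, hf⟩ := exists_surjective_nat ι
    exact ⟨fun k => g (f k), fun k => hg _, hS.trans (hf.iUnion_comp fun i => range (g i)).ge⟩

theorem CountablyCinfRectifiable.iUnion {ι : Type*} [Countable ι] {S : ι → Set (Euc n)}
    (h : ∀ i, CountablyCinfRectifiable m (S i)) : CountablyCinfRectifiable m (⋃ i, S i) := by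
  choose g hg hS using h
  refine .of_countable (g := fun q : ι × ℕ => g q.1 q.2) (fun q => hg _ _)
    (iUnion_subset fun i => (hS i).trans (iUnion_subset fun k => ?_))
  exact subset_iUnion (fun q : ι × ℕ => range (g q.1 q.2)) (i, k)

theorem CountablyCinfRectifiable.of_locally {S : Set (Euc n)}
    (h : ∀ x ∈ S, ∃ W ∈ 𝓝 x, ∃ g : Euc m → Euc n, ContDiff ℝ (⊤ : ℕ∞) g ∧ S ∩ W ⊆ range g) :
    CountablyCinfRectifiable m S := by
  choose! W hW g hg hr using h
  obtain ⟨t, htS, htc, ht⟩ := TopologicalSpace.countable_cover_nhdsWithin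
    (s := S) (f := W) fun x hx => mem_nhdsWithin_of_mem_nhds (hW x hx)
  have := htc.to_subtype
  refine .of_countable (g := fun x : t => g x) (fun x => hg _ (htS x.2)) fun y hy => ?_
  obtain ⟨x, hx, hyx⟩ := mem_iUnion₂.1 (ht hy)
  exact mem_iUnion.2 ⟨⟨x, hx⟩, hr x (htS hx) ⟨hy, hyx⟩⟩

theorem card_compl_pair {i j : Fin n} (hij : i ≠ j) :
    Fintype.card {k : Fin n // k ≠ i ∧ k ≠ j} = n - 2 := by
  rw [Fintype.card_subtype]
  have : (Finset.univ.filter fun k => k ≠ i ∧ k ≠ j) = (Finset.univ \ {i, j}) := by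
    ext k; simp
  rw [this, Finset.card_sdiff_of_subset (Finset.subset_univ _), Finset.card_pair hij]
  simp

/-- Common zeros of two functions with independent gradients are locally parametrised by
`ℝⁿ⁻²`. -/
theorem exists_param_of_minor_ne_zero {U : Set (Euc n)} (hU : IsOpen U) {f g : Euc n → ℝ}
    (hf : ContDiffOn ℝ (⊤ : ℕ∞) f U) (hg : ContDiffOn ℝ (⊤ : ℕ∞) g U) {p : Euc n} (hp : p ∈ U)
    (hfp : f p = 0) (hgp : g p = 0) {i j : Fin n}
    (hij : pd i f p * pd j g p - pd j f p * pd i g p ≠ 0) :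
    ∃ W ∈ 𝓝 p, ∃ φ : Euc (n - 2) → Euc n, ContDiff ℝ (⊤ : ℕ∞) φ ∧
      {x ∈ W | f x = 0 ∧ g x = 0} ⊆ range φ := by
  have hne : i ≠ j := by rintro rfl; exact hij (by ring)
  set V : Set (Euc n) := {x ∈ U | pd i f x * pd j g x - pd j f x * pd i g x ≠ 0} with hV
  have hVo : IsOpen V := by
    have : ContinuousOn (fun x => pd i f x * pd j g x - pd j f x * pd i g x) U :=
      (((hf.pd hU i).mul (hg.pd hU j)).sub ((hf.pd hU j).mul (hg.pd hU i))).continuousOn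
    exact this.isOpen_inter_preimage hU isOpen_compl_singleton
  have hVU : V ⊆ U := fun x hx => hx.1
  have hpV : p ∈ V := ⟨hp, hij⟩
  let Φ : Euc n → Euc n := fun x => WithLp.toLp 2 fun k => if k = i then f x else if k = j then g x
    else x k
  have hΦ : ContDiffOn ℝ (⊤ : ℕ∞) Φ U := by
    refine (PiLp.contDiff_toLp).comp_contDiffOn (contDiffOn_pi.2 fun k => ?_)
    by_cases h1 : k = i
    · simpa [h1] using hf
    by_cases h2 : k = j
    · simpa [h1, h2, hne.symm] using hg
    · simpa [h1, h2] using (EuclideanSpace.proj k : Euc n →L[ℝ] ℝ).contDiff.contDiffOn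
  have hder : ∀ x ∈ V, ∃ L : Euc n ≃L[ℝ] Euc n, HasFDerivAt Φ (L : Euc n →L[ℝ] Euc n) x := by
    intro x hx
    have hd : HasFDerivAt Φ (fderiv ℝ Φ x) x :=
      ((hΦ.contDiffAt (hU.mem_nhds (hVU hx))).differentiableAt (by simp)).hasFDerivAt
    have hc : ∀ k v, fderiv ℝ Φ x v k
        = if k = i then fderiv ℝ f x v else if k = j then fderiv ℝ g x v else v k := by
      intro k v
      have h3 : HasFDerivAt (fun y => Φ y k)
          ((EuclideanSpace.proj k : Euc n →L[ℝ] ℝ).comp (fderiv ℝ Φ x)) x :=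
        (EuclideanSpace.proj k : Euc n →L[ℝ] ℝ).hasFDerivAt.comp x hd
      have h4 := DFunLike.congr_fun h3.fderiv v
      change _ = fderiv ℝ Φ x v k at h4
      rw [← h4]
      by_cases h1 : k = i
      · simp [Φ, h1]
      by_cases h2 : k = j
      · simp [Φ, h2, hne.symm]
      · simp only [Φ, h1, h2, if_false]
        exact DFunLike.congr_fun (EuclideanSpace.proj k : Euc n →L[ℝ] ℝ).hasFDerivAt.fderiv v
    have hinj : Function.Injective (fderiv ℝ Φ x : Euc n →ₗ[ℝ] Euc n) := by
      rw [injective_iff_map_eq_zero]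
      intro v hv
      have hk : ∀ k, (if k = i then fderiv ℝ f x v else if k = j then fderiv ℝ g x v else v k)
          = 0 := fun k => by rw [← hc]; exact congrArg (fun w : Euc n => w k) hv
      have hv0 : ∀ k, k ≠ i → k ≠ j → v k = 0 := fun k h1 h2 => by simpa [h1, h2] using hk k
      have hs : ∀ h : Euc n → ℝ, fderiv ℝ h x v = v i * pd i h x + v j * pd j h x := by
        intro h
        rw [fderiv_apply_eq_sum_pd, ← Finset.sum_pair (f := fun k => v k * pd k h x) hne]
        refine (Finset.sum_subset (Finset.subset_univ _) fun k _ hk => ?_).symm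
        simp only [Finset.mem_insert, Finset.mem_singleton, not_or] at hk
        rw [hv0 k hk.1 hk.2, zero_mul]
      have e1 : fderiv ℝ f x v = 0 := by simpa using hk i
      have e2 : fderiv ℝ g x v = 0 := by simpa [hne.symm] using hk j
      rw [hs] at e1 e2
      have d1 : v i * (pd i f x * pd j g x - pd j f x * pd i g x) = 0 := by
        linear_combination pd j g x * e1 - pd j f x * e2
      have d2 : v j * (pd i f x * pd j g x - pd j f x * pd i g x) = 0 := by
        linear_combination pd i f x * e2 - pd i g x * e1
      ext k
      by_cases h1 : k = i
      · rw [h1]; exact (mul_eq_zero.1 d1).resolve_right hx.2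
      by_cases h2 : k = j
      · rw [h2]; exact (mul_eq_zero.1 d2).resolve_right hx.2
      · exact hv0 k h1 h2
    refine ⟨(LinearEquiv.ofInjectiveEndo _ hinj).toContinuousLinearEquiv, ?_⟩
    have hLd : ((LinearEquiv.ofInjectiveEndo _ hinj).toContinuousLinearEquiv : Euc n →L[ℝ] Euc n)
        = fderiv ℝ Φ x := by ext v; rfl
    rw [hLd]
    exact hd
  obtain ⟨L, hL⟩ := hder p hpV
  have hcd := hΦ.contDiffAt (hU.mem_nhds hp)
  let H := hcd.toOpenPartialHomeomorph Φ hL (by simp)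
  have hH : (H : Euc n → Euc n) = Φ := hcd.toOpenPartialHomeomorph_coe hL (by simp)
  have hpH : p ∈ H.source := hcd.mem_toOpenPartialHomeomorph_source hL (by simp)
  have hO : IsOpen (H.target ∩ H.symm ⁻¹' V) := H.isOpen_inter_preimage_symm hVo
  have hΦpO : Φ p ∈ H.target ∩ H.symm ⁻¹' V := by
    rw [← hH]
    exact ⟨H.map_source hpH, by simpa [H.left_inv hpH] using hpV⟩
  let σ : {k : Fin n // k ≠ i ∧ k ≠ j} ≃ Fin (n - 2) :=
    Fintype.equivFinOfCardEq (card_compl_pair hne)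
  let e : Euc (n - 2) → Euc n := fun z => WithLp.toLp 2 fun k =>
    if h : k ≠ i ∧ k ≠ j then z (σ ⟨k, h⟩) else 0
  have he : ContDiff ℝ (⊤ : ℕ∞) e := by
    refine (PiLp.contDiff_toLp).comp (contDiff_pi.2 fun k => ?_)
    by_cases h : k ≠ i ∧ k ≠ j
    · simp only [dif_pos h]
      exact (EuclideanSpace.proj (σ ⟨k, h⟩) : Euc (n - 2) →L[ℝ] ℝ).contDiff
    · simpa only [dif_neg h] using contDiff_const
  let ret : Euc n → Euc (n - 2) := fun y => WithLp.toLp 2 fun l => y (σ.symm l).1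
  have hret : Continuous ret := by
    refine (PiLp.continuous_toLp 2 _).comp (continuous_pi fun l => ?_)
    exact (EuclideanSpace.proj (σ.symm l).1 : Euc n →L[ℝ] ℝ).continuous
  have her : ∀ x, f x = 0 → g x = 0 → e (ret (Φ x)) = Φ x := by
    intro x hfx hgx
    ext k
    by_cases h1 : k = i
    · simp [e, Φ, h1, hfx]
    by_cases h2 : k = j
    · simp [e, Φ, h2, hgx, hne.symm]
    · simp [e, Φ, ret, h1, h2]
  obtain ⟨δ, hδ, hball⟩ := Metric.isOpen_iff.1 (hO.preimage he.continuous) (ret (Φ p))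
    (by rw [mem_preimage, her p hfp hgp]; exact hΦpO)
  have hΦc : ContinuousAt Φ p := hcd.continuousAt
  let B := OpenPartialHomeomorph.univBall (ret (Φ p)) δ
  refine ⟨H.source ∩ (fun x => ret (Φ x)) ⁻¹' ball (ret (Φ p)) δ,
    inter_mem (H.open_source.mem_nhds hpH)
      ((hret.continuousAt.comp hΦc).preimage_mem_nhds (ball_mem_nhds _ hδ)),
    fun t => H.symm (e (B t)), ?_, ?_⟩
  · rw [contDiff_iff_contDiffAt]
    intro t
    have ht : B t ∈ ball (ret (Φ p)) δ := by
      rw [← OpenPartialHomeomorph.univBall_target _ hδ]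
      exact B.map_source (by simp [B])
    obtain ⟨h1, h2⟩ := hball ht
    obtain ⟨L', hL'⟩ := hder _ h2
    have h3 : ContDiffAt ℝ (⊤ : ℕ∞) H.symm (e (B t)) :=
      H.contDiffAt_symm h1 (f₀' := L') (by rw [hH]; exact hL')
        (by rw [hH]; exact hΦ.contDiffAt (hU.mem_nhds (hVU h2)))
    exact h3.comp t (he.contDiffAt.comp t OpenPartialHomeomorph.contDiff_univBall.contDiffAt)
  · rintro x ⟨⟨hxs, hxb⟩, hfx, hgx⟩
    refine ⟨B.symm (ret (Φ x)), ?_⟩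
    have : ret (Φ x) ∈ B.target := by
      rw [OpenPartialHomeomorph.univBall_target _ hδ]; exact hxb
    simp only [B.right_inv this, her x hfx hgx]
    rw [← hH]
    exact H.left_inv hxs

end Rectifiability

section Projections

variable {n : ℕ}

/-- The projection of `ℝⁿ` forgetting the coordinates `i` and `j`. -/
def forgetPair (i j : Fin n) (x : Euc n) : {k : Fin n // k ≠ i ∧ k ≠ j} → ℝ := fun k => x k

theorem continuous_forgetPair (i j : Fin n) : Continuous (forgetPair i j) :=
  continuous_pi fun k => (EuclideanSpace.proj k.1 : Euc n →L[ℝ] ℝ).continuous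

/-- Near a point where two functions have independent gradients, their common zero set is a
Lipschitz graph over a coordinate plane, with a universal constant. -/
theorem exists_dist_le_forgetPair {U : Set (Euc n)} (hU : IsOpen U) {f g : Euc n → ℝ}
    (hf : ContDiffOn ℝ (⊤ : ℕ∞) f U) (hg : ContDiffOn ℝ (⊤ : ℕ∞) g U) {p : Euc n} (hp : p ∈ U)
    (h : ∃ i j, pd i f p * pd j g p - pd j f p * pd i g p ≠ 0) :
    ∃ i j, i ≠ j ∧ ∃ W ∈ 𝓝 p, ∀ x ∈ W, ∀ y ∈ W, f x = 0 → g x = 0 → f y = 0 → g y = 0 →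
      dist x y ≤ 6 * n * dist (forgetPair i j x) (forgetPair i j y) := by
  obtain ⟨i₀, j₀, h0⟩ := h
  set m : Fin n → Fin n → ℝ := fun i j => pd i f p * pd j g p - pd j f p * pd i g p with hm
  have : Nonempty (Fin n × Fin n) := ⟨(i₀, j₀)⟩
  obtain ⟨⟨i, j⟩, hmax⟩ := Finite.exists_max fun q : Fin n × Fin n => |m q.1 q.2|
  have hμ : 0 < |m i j| := (abs_pos.2 h0).trans_le (hmax (i₀, j₀))
  have hne : i ≠ j := by
    rintro rfl
    simp [hm] at hμ
  refine ⟨i, j, hne, ?_⟩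
  set G : ℝ := |pd i f p| + |pd j f p| + |pd i g p| + |pd j g p| + 1 with hG
  have hG0 : 0 < G := by positivity
  set ε : ℝ := |m i j| / (4 * G) with hε
  have hε0 : 0 < ε := by positivity
  have hsd : ∀ {w : Euc n → ℝ}, ContDiffOn ℝ (⊤ : ℕ∞) w U → ∃ W ∈ 𝓝 p, ∀ x ∈ W, ∀ y ∈ W,
      w x = 0 → w y = 0 → |∑ k, (x k - y k) * pd k w p| ≤ ε * dist x y := by
    intro w hw
    have hs : HasStrictFDerivAt w (fderiv ℝ w p) p :=
      (hw.contDiffAt (hU.mem_nhds hp)).hasStrictFDerivAt (by simp)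
    have hb := (hs.isLittleO.def hε0)
    rw [nhds_prod_eq] at hb
    obtain ⟨W, hW, hWb⟩ := Filter.eventually_prod_self_iff'.1 hb
    refine ⟨W, hW, fun x hx y hy hwx hwy => ?_⟩
    have := hWb x hx y hy
    simp only [hwx, hwy, fderiv_apply_eq_sum_pd, sub_zero, zero_sub, norm_neg,
      Real.norm_eq_abs] at this
    rw [dist_eq_norm]
    exact this
  obtain ⟨W₁, hW₁, b1⟩ := hsd hf
  obtain ⟨W₂, hW₂, b2⟩ := hsd hg
  refine ⟨W₁ ∩ W₂, inter_mem hW₁ hW₂, fun x hx y hy hfx hgx hfy hgy => ?_⟩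
  have e1 := b1 x hx.1 y hy.1 hfx hfy
  have e2 := b2 x hx.2 y hy.2 hgx hgy
  set v : Fin n → ℝ := fun k => x k - y k with hv
  set D := dist (forgetPair i j x) (forgetPair i j y) with hD
  have hvD : ∀ k, k ≠ i → k ≠ j → |v k| ≤ D := fun k h1 h2 =>
    dist_le_pi_dist (forgetPair i j x) (forgetPair i j y) ⟨k, h1, h2⟩
  have hD0 : 0 ≤ D := dist_nonneg
  set s : Finset (Fin n) := (Finset.univ.erase i).erase j with hs
  have hsplit : ∀ h : Fin n → ℝ, ∑ k, h k = h i + h j + ∑ k ∈ s, h k := by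
    intro h
    rw [← Finset.add_sum_erase _ _ (Finset.mem_univ i),
      ← Finset.add_sum_erase _ _ (Finset.mem_erase.2 ⟨hne.symm, Finset.mem_univ j⟩), add_assoc]
  have hscard : (s.card : ℝ) + 2 = n := by
    have : s.card + 2 = n := by
      rw [hs, Finset.card_erase_of_mem (Finset.mem_erase.2 ⟨hne.symm, Finset.mem_univ j⟩),
        Finset.card_erase_of_mem (Finset.mem_univ i)]
      have h1 := i.2
      have h2 := j.2
      have h3 := Fin.val_ne_of_ne hne
      simp
      omega
    exact_mod_cast this
  have hsum : ∑ k ∈ s, |v k| ≤ s.card * D := by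
    rw [← nsmul_eq_mul]
    refine Finset.sum_le_card_nsmul _ _ _ fun k hk => ?_
    simp only [hs, Finset.mem_erase] at hk
    exact hvD k hk.2.1 hk.1
  have hr := dist_nonneg (x := x) (y := y)
  have hcoord : ∀ (l : Fin n) (α β : ℝ), |α| ≤ G → |β| ≤ G → ∀ c : Fin n → ℝ,
      (∀ k, |c k| ≤ |m i j|) → m i j * v l
        = β * ∑ k, v k * pd k f p - α * ∑ k, v k * pd k g p - ∑ k ∈ s, c k * v k →
      |α| + |β| ≤ G → |v l| ≤ dist x y / 4 + s.card * D := by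
    intro l α β hα hβ c hc he hαβ
    have h1 : |m i j| * |v l| ≤ G * (ε * dist x y) + |m i j| * (s.card * D) := by
      rw [← abs_mul, he]
      have hs' : |∑ k ∈ s, c k * v k| ≤ |m i j| * (s.card * D) := by
        refine (Finset.abs_sum_le_sum_abs _ _).trans ?_
        refine le_trans (Finset.sum_le_sum fun k _ => ?_)
          ((Finset.mul_sum s (fun k => |v k|) |m i j|).ge.trans
            (mul_le_mul_of_nonneg_left hsum hμ.le))
        rw [abs_mul]
        exact mul_le_mul_of_nonneg_right (hc k) (abs_nonneg _)
      have h2 : |β * ∑ k, v k * pd k f p| ≤ |β| * (ε * dist x y) := by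
        rw [abs_mul]; exact mul_le_mul_of_nonneg_left e1 (abs_nonneg _)
      have h3 : |α * ∑ k, v k * pd k g p| ≤ |α| * (ε * dist x y) := by
        rw [abs_mul]; exact mul_le_mul_of_nonneg_left e2 (abs_nonneg _)
      have h4 : (|α| + |β|) * (ε * dist x y) ≤ G * (ε * dist x y) :=
        mul_le_mul_of_nonneg_right hαβ (by positivity)
      have h5 := abs_sub (β * ∑ k, v k * pd k f p - α * ∑ k, v k * pd k g p) (∑ k ∈ s, c k * v k)
      have h6 := abs_sub (β * ∑ k, v k * pd k f p) (α * ∑ k, v k * pd k g p)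
      linarith
    have h2 : G * (ε * dist x y) = |m i j| * (dist x y / 4) := by
      rw [hε]; field_simp
    rw [h2, ← mul_add] at h1
    exact le_of_mul_le_mul_left h1 hμ
  have hi : |v i| ≤ dist x y / 4 + s.card * D := by
    refine hcoord i (pd j f p) (pd j g p) ?_ ?_ (fun k => m k j) (fun k => hmax (k, j)) ?_ ?_
    · rw [hG]; linarith [abs_nonneg (pd i f p), abs_nonneg (pd i g p), abs_nonneg (pd j g p)]
    · rw [hG]; linarith [abs_nonneg (pd i f p), abs_nonneg (pd i g p), abs_nonneg (pd j f p)]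
    · rw [Finset.mul_sum, Finset.mul_sum, ← Finset.sum_sub_distrib, hsplit, add_sub_assoc,
        ← Finset.sum_sub_distrib, Finset.sum_eq_zero (s := s)]
      · simp only [hm]; ring
      · intro k _; simp only [hm]; ring
    · rw [hG]; linarith [abs_nonneg (pd i f p), abs_nonneg (pd i g p)]
  have hj : |v j| ≤ dist x y / 4 + s.card * D := by
    refine hcoord j (-pd i f p) (-pd i g p) ?_ ?_ (fun k => m i k) (fun k => hmax (i, k)) ?_ ?_
    · rw [abs_neg, hG]
      linarith [abs_nonneg (pd j f p), abs_nonneg (pd i g p), abs_nonneg (pd j g p)]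
    · rw [abs_neg, hG]
      linarith [abs_nonneg (pd j f p), abs_nonneg (pd i f p), abs_nonneg (pd j g p)]
    · rw [Finset.mul_sum, Finset.mul_sum, ← Finset.sum_sub_distrib, hsplit, add_sub_assoc,
        ← Finset.sum_sub_distrib, Finset.sum_eq_zero (s := s)]
      · simp only [hm]; ring
      · intro k _; simp only [hm]; ring
    · rw [abs_neg, abs_neg, hG]; linarith [abs_nonneg (pd j f p), abs_nonneg (pd j g p)]
  have hnorm : dist x y ≤ |v i| + |v j| + ∑ k ∈ s, |v k| := by
    rw [dist_eq_norm, ← hsplit fun k => |v k|]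
    exact norm_le_sum_abs (x - y)
  rw [← hscard]
  nlinarith

/-- A bounded set with uniformly bounded fibres under a projection, covered by countably many
pieces on which the projection has Lipschitz inverses with a uniform constant, has finite Hausdorff
measure. -/
theorem hausdorffMeasure_lt_top_of_fibers {ι : Type*} [Fintype ι] {π : Euc n → ι → ℝ}
    (hπ : Continuous π) {S : Set (Euc n)} (hS : MeasurableSet S) (hb : Bornology.IsBounded (π '' S))
    {K : ℝ≥0} {V : ℕ → Set (Euc n)} (hV : ∀ m, MeasurableSet (V m)) (hSV : S ⊆ ⋃ m, V m)
    (hL : ∀ m, ∀ x ∈ S ∩ V m, ∀ y ∈ S ∩ V m, dist x y ≤ K * dist (π x) (π y)) {M : ℕ}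
    (hM : ∀ Z : Finset (Euc n), (Z : Set (Euc n)) ⊆ S → (∀ x ∈ Z, ∀ y ∈ Z, π x = π y) →
      Z.card ≤ M) :
    μH[(Fintype.card ι : ℝ)] S < ⊤ := by
  classical
  set T : ℕ → Set (Euc n) := fun m => S ∩ disjointed V m with hT
  have hTm : ∀ m, MeasurableSet (T m) := fun m => hS.inter (MeasurableSet.disjointed hV m)
  have hTd : Pairwise (Function.onFun Disjoint T) := fun m m' hmm =>
    (disjoint_disjointed V hmm).mono inter_subset_right inter_subset_right
  have hTL : ∀ m, ∀ x ∈ T m, ∀ y ∈ T m, dist x y ≤ K * dist (π x) (π y) := fun m x hx y hy =>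
    hL m x ⟨hx.1, disjointed_subset V m hx.2⟩ y ⟨hy.1, disjointed_subset V m hy.2⟩
  have hinj : ∀ m, InjOn π (T m) := fun m x hx y hy hxy => by
    have := hTL m x hx y hy
    rw [hxy, dist_self, mul_zero] at this
    exact dist_le_zero.1 this
  have hST : S ⊆ ⋃ m, T m := by
    rw [hT, ← inter_iUnion, iUnion_disjointed]
    exact fun x hx => ⟨hx, hSV hx⟩
  have him : ∀ m, MeasurableSet (π '' T m) := fun m =>
    (hTm m).image_of_continuousOn_injOn hπ.continuousOn (hinj m)
  obtain ⟨R, hR⟩ := hb.subset_closedBall 0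
  have hpiece : ∀ m, μH[(Fintype.card ι : ℝ)] (T m)
      ≤ (K : ℝ≥0∞) ^ (Fintype.card ι : ℝ) * volume (π '' T m) := by
    intro m
    have hl : LipschitzOnWith K (Function.invFunOn π (T m)) (π '' T m) := by
      refine LipschitzOnWith.of_dist_le_mul ?_
      rintro _ ⟨x, hx, rfl⟩ _ ⟨y, hy, rfl⟩
      rw [(hinj m).leftInvOn_invFunOn hx, (hinj m).leftInvOn_invFunOn hy]
      exact hTL m x hx y hy
    have h := hl.hausdorffMeasure_image_le (d := Fintype.card ι) (Nat.cast_nonneg _)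
    rwa [(hinj m).leftInvOn_invFunOn.image_image, hausdorffMeasure_pi_real] at h
  have hcount : ∀ y, ∑' m, (π '' T m).indicator (1 : (ι → ℝ) → ℝ≥0∞) y
      ≤ (closedBall (0 : ι → ℝ) R).indicator (fun _ => (M : ℝ≥0∞)) y := by
    intro y
    rw [ENNReal.tsum_eq_iSup_sum]
    refine iSup_le fun t => ?_
    by_cases hy : y ∈ closedBall (0 : ι → ℝ) R
    · rw [indicator_of_mem hy]
      simp only [indicator_apply, Pi.one_apply, Finset.sum_boole]
      have hex : ∀ m ∈ t.filter fun m => y ∈ π '' T m, ∃ x ∈ T m, π x = y := fun m hm =>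
        (Finset.mem_filter.1 hm).2
      choose! z hz hzy using hex
      have hzi : InjOn z (t.filter fun m => y ∈ π '' T m : Finset ℕ) := by
        intro m hm m' hm' hmm
        by_contra hne
        exact Set.disjoint_left.1 (hTd hne) (hz m hm) (hmm ▸ hz m' hm')
      rw [← Finset.card_image_of_injOn hzi]
      refine Nat.cast_le.2 (hM _ ?_ ?_)
      · intro x hx
        obtain ⟨m, hm, rfl⟩ := Finset.mem_image.1 (Finset.mem_coe.1 hx)
        exact (hz m hm).1
      · intro x hx x' hx'
        obtain ⟨m, hm, rfl⟩ := Finset.mem_image.1 hx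
        obtain ⟨m', hm', rfl⟩ := Finset.mem_image.1 hx'
        rw [hzy m hm, hzy m' hm']
    · refine (Finset.sum_eq_zero fun m _ => indicator_of_notMem (fun hm => hy ?_) _).trans_le
        zero_le
      exact hR (image_mono inter_subset_left hm)
  calc μH[(Fintype.card ι : ℝ)] S ≤ μH[(Fintype.card ι : ℝ)] (⋃ m, T m) := measure_mono hST
    _ ≤ ∑' m, μH[(Fintype.card ι : ℝ)] (T m) := measure_iUnion_le _
    _ ≤ ∑' m, (K : ℝ≥0∞) ^ (Fintype.card ι : ℝ) * volume (π '' T m) :=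
        ENNReal.tsum_le_tsum hpiece
    _ = (K : ℝ≥0∞) ^ (Fintype.card ι : ℝ) *
          ∫⁻ y, ∑' m, (π '' T m).indicator (1 : (ι → ℝ) → ℝ≥0∞) y := by
        rw [ENNReal.tsum_mul_left, lintegral_tsum fun m =>
          (measurable_one.indicator (him m)).aemeasurable]
        simp_rw [lintegral_indicator_one (him _)]
    _ ≤ (K : ℝ≥0∞) ^ (Fintype.card ι : ℝ) *
          ∫⁻ y, (closedBall (0 : ι → ℝ) R).indicator (fun _ => (M : ℝ≥0∞)) y := by
        gcongr with y
        exact hcount y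
    _ < ⊤ := by
        rw [lintegral_indicator measurableSet_closedBall, lintegral_const]
        refine ENNReal.mul_lt_top
          (ENNReal.rpow_lt_top_of_nonneg (Nat.cast_nonneg _) ENNReal.coe_ne_top)
          (ENNReal.mul_lt_top (ENNReal.natCast_lt_top M) ?_)
        rw [Measure.restrict_apply_univ]
        exact measure_closedBall_lt_top

end Projections

section GaussianFunctional

open MvPolynomial

variable {n : ℕ}

theorem pderiv_comm (i j : Fin n) (P : MvPolynomial (Fin n) ℝ) :
    pderiv i (pderiv j P) = pderiv j (pderiv i P) := by
  have h : ⁅pderiv (R := ℝ) i, pderiv (R := ℝ) j⁆ = 0 := by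
    refine MvPolynomial.derivation_ext fun k => ?_
    rw [Derivation.commutator_apply, pderiv_X, pderiv_X]
    rcases eq_or_ne k i with rfl | hi <;> rcases eq_or_ne k j with rfl | hj <;>
      simp [*]
  have := DFunLike.congr_fun h P
  rwa [Derivation.commutator_apply, Derivation.zero_apply, sub_eq_zero] at this

theorem integrable_pow_mul_exp (j : ℕ) :
    Integrable fun x : ℝ => x ^ j * Real.exp (-(1 / 2) * x ^ 2) := by
  have h : (-1 : ℝ) < j := lt_of_lt_of_le (by norm_num) (Nat.cast_nonneg j)
  simpa only [Real.rpow_natCast] using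
    integrable_rpow_mul_exp_neg_mul_sq (b := 1 / 2) (by norm_num) h

/-- The unnormalised moments of the one-dimensional Gaussian. -/
def gaussMoment (j : ℕ) : ℝ := ∫ x : ℝ, x ^ j * Real.exp (-(1 / 2) * x ^ 2)

theorem gaussMoment_succ (j : ℕ) : gaussMoment (j + 1) = j * gaussMoment (j - 1) := by
  have hd : ∀ x : ℝ, HasDerivAt (fun x => x ^ j * Real.exp (-(1 / 2) * x ^ 2))
      (j * (x ^ (j - 1) * Real.exp (-(1 / 2) * x ^ 2))
        - x ^ (j + 1) * Real.exp (-(1 / 2) * x ^ 2)) x := by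
    intro x
    have h1 : HasDerivAt (fun x : ℝ => -(1 / 2) * x ^ 2) (-x) x := by
      refine ((hasDerivAt_pow 2 x).const_mul (-(1 / 2) : ℝ)).congr_deriv ?_
      simp
    refine ((hasDerivAt_pow j x).mul h1.exp).congr_deriv ?_
    ring
  have h := integral_eq_zero_of_hasDerivAt_of_integrable hd
    (((integrable_pow_mul_exp _).const_mul _).sub (integrable_pow_mul_exp _))
    (integrable_pow_mul_exp j)
  rw [integral_sub ((integrable_pow_mul_exp _).const_mul _) (integrable_pow_mul_exp _),
    integral_const_mul] at h
  exact (sub_eq_zero.1 h).symm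

/-- The Gaussian weight on `ℝⁿ`. -/
def gaussWeight (x : Fin n → ℝ) : ℝ := ∏ k, Real.exp (-(1 / 2) * x k ^ 2)

/-- The Gaussian integral of a polynomial. -/
def gaussInt (P : MvPolynomial (Fin n) ℝ) : ℝ := ∫ x : Fin n → ℝ, eval x P * gaussWeight x

theorem eval_monomial_mul_gaussWeight (s : Fin n →₀ ℕ) (c : ℝ) (x : Fin n → ℝ) :
    eval x (monomial s c) * gaussWeight x
      = c * ∏ k, (x k ^ s k * Real.exp (-(1 / 2) * x k ^ 2)) := by
  rw [eval_monomial, Finset.prod_mul_distrib, Finsupp.prod_fintype _ _ (by simp), gaussWeight,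
    mul_assoc]

theorem integrable_eval_mul_gaussWeight (P : MvPolynomial (Fin n) ℝ) :
    Integrable fun x : Fin n → ℝ => eval x P * gaussWeight x := by
  induction P using MvPolynomial.induction_on' with
  | monomial s c =>
    simp only [eval_monomial_mul_gaussWeight]
    exact (Integrable.fintype_prod fun k => integrable_pow_mul_exp (s k)).const_mul c
  | add p q hp hq =>
    simp only [map_add, add_mul]
    exact hp.add hq

theorem gaussInt_add (P Q : MvPolynomial (Fin n) ℝ) :
    gaussInt (P + Q) = gaussInt P + gaussInt Q := by
  simp only [gaussInt, map_add, add_mul]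
  exact integral_add (integrable_eval_mul_gaussWeight P) (integrable_eval_mul_gaussWeight Q)

theorem gaussInt_sum {ι : Type*} (s : Finset ι) (P : ι → MvPolynomial (Fin n) ℝ) :
    gaussInt (∑ i ∈ s, P i) = ∑ i ∈ s, gaussInt (P i) := by
  classical
  induction s using Finset.induction_on with
  | empty => simp [gaussInt]
  | insert a s ha ih => rw [Finset.sum_insert ha, Finset.sum_insert ha, gaussInt_add, ih]

theorem gaussInt_monomial (s : Fin n →₀ ℕ) (c : ℝ) :
    gaussInt (monomial s c) = c * ∏ k, gaussMoment (s k) := by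
  simp only [gaussInt, eval_monomial_mul_gaussWeight, integral_const_mul]
  rw [integral_fintype_prod_volume_eq_prod fun k (x : ℝ) => x ^ s k * Real.exp (-(1 / 2) * x ^ 2)]
  rfl

/-- Gaussian integration by parts. -/
theorem gaussInt_X_mul (k : Fin n) (P : MvPolynomial (Fin n) ℝ) :
    gaussInt (X k * P) = gaussInt (pderiv k P) := by
  induction P using MvPolynomial.induction_on' with
  | monomial s c =>
    rw [X, monomial_mul, pderiv_monomial, gaussInt_monomial, gaussInt_monomial,
      ← Finset.mul_prod_erase Finset.univ
        (fun l => gaussMoment ((Finsupp.single k 1 + s : Fin n →₀ ℕ) l)) (Finset.mem_univ k),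
      ← Finset.mul_prod_erase Finset.univ
        (fun l => gaussMoment ((s - Finsupp.single k 1 : Fin n →₀ ℕ) l)) (Finset.mem_univ k)]
    have h : ∀ l ∈ Finset.univ.erase k, gaussMoment ((Finsupp.single k 1 + s : Fin n →₀ ℕ) l)
        = gaussMoment ((s - Finsupp.single k 1 : Fin n →₀ ℕ) l) := by
      intro l hl
      have : k ≠ l := (Finset.ne_of_mem_erase hl).symm
      simp [this]
    rw [Finset.prod_congr rfl h]
    simp only [Finsupp.add_apply, Finsupp.single_eq_same, Finsupp.tsub_apply]
    rw [add_comm 1 (s k), gaussMoment_succ]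
    ring
  | add p q hp hq => rw [mul_add, gaussInt_add, hp, hq, map_add, gaussInt_add]

theorem eq_zero_of_gaussInt_sq {P : MvPolynomial (Fin n) ℝ} (h : gaussInt (P ^ 2) = 0) : P = 0 := by
  have hw : ∀ x : Fin n → ℝ, 0 < gaussWeight x := fun x =>
    Finset.prod_pos fun k _ => Real.exp_pos _
  have hc : Continuous fun x : Fin n → ℝ => eval x (P ^ 2) * gaussWeight x := by
    refine (MvPolynomial.continuous_eval _).mul ?_
    unfold gaussWeight
    fun_prop
  have h0 : 0 ≤ fun x : Fin n → ℝ => eval x (P ^ 2) * gaussWeight x := fun x => by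
    simp only [map_pow]
    exact mul_nonneg (sq_nonneg _) (hw x).le
  have h1 := (integral_eq_zero_iff_of_nonneg h0 (integrable_eval_mul_gaussWeight _)).1 h
  have h2 := (hc.ae_eq_iff_eq volume continuous_zero).1 h1
  refine MvPolynomial.funext fun x => ?_
  have h3 := congrFun h2 x
  simp only [map_pow, Pi.zero_apply] at h3
  simpa using (mul_eq_zero.1 h3).resolve_right (LT.lt.ne' (hw x))

/-- A harmonic homogeneous polynomial is orthogonal to polynomials of smaller degree. -/
theorem gaussInt_mul_eq_zero {d : ℕ} {P R : MvPolynomial (Fin n) ℝ} (hP : P.IsHomogeneous d)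
    (hΔ : ∑ i, pderiv i (pderiv i P) = 0) (hR : R.totalDegree < d) : gaussInt (P * R) = 0 := by
  have key : ∀ (m : ℕ) (d : ℕ) (P : MvPolynomial (Fin n) ℝ) (s : Fin n →₀ ℕ) (c : ℝ),
      P.IsHomogeneous d → ∑ i, pderiv i (pderiv i P) = 0 → s.degree = m → m < d →
      gaussInt (P * monomial s c) = 0 := by
    intro m
    induction m using Nat.strong_induction_on with
    | _ m ih =>
    intro d P s c hP hΔ hs hmd
    by_cases hs0 : s = 0
    · have he := hP.sum_X_mul_pderiv
      have h1 : gaussInt (∑ i, X i * (pderiv i P * C c)) = 0 := by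
        rw [gaussInt_sum]
        simp only [gaussInt_X_mul]
        rw [← gaussInt_sum]
        have : ∑ i, pderiv i (pderiv i P * C c) = (∑ i, pderiv i (pderiv i P)) * C c := by
          rw [Finset.sum_mul]
          exact Finset.sum_congr rfl fun i _ => by rw [mul_comm, pderiv_C_mul, mul_comm]
        rw [this, hΔ, zero_mul]
        simp [gaussInt]
      have h2 : ∑ i, X i * (pderiv i P * C c) = C (d : ℝ) * (P * C c) := by
        simp only [← mul_assoc]
        rw [← Finset.sum_mul, he]
        simp
      have h3 : ∀ Q : MvPolynomial (Fin n) ℝ, gaussInt (C (d : ℝ) * Q) = d * gaussInt Q := by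
        intro Q
        simp only [gaussInt, map_mul, eval_C, mul_assoc, integral_const_mul]
      rw [h2, h3] at h1
      have hd : (d : ℝ) ≠ 0 := Nat.cast_ne_zero.2 (by omega)
      rw [hs0]
      exact (mul_eq_zero.1 h1).resolve_left hd
    · obtain ⟨k, hk⟩ := Finsupp.ne_iff.1 hs0
      have hk1 : 1 ≤ s k := Nat.one_le_iff_ne_zero.2 hk
      set t := s - Finsupp.single k 1 with ht
      have hst : s = Finsupp.single k 1 + t := by
        rw [ht, add_tsub_cancel_of_le]
        exact Finsupp.single_le_iff.2 hk1
      have htd : t.degree + 1 = m := by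
        rw [← hs, hst, map_add, Finsupp.degree_single, add_comm]
      have e : P * monomial s c = X k * (P * monomial t c) := by
        rw [hst, X, mul_left_comm, monomial_mul, one_mul]
      rw [e, gaussInt_X_mul, pderiv_mul, gaussInt_add, pderiv_monomial]
      rw [ih t.degree (by omega) (d - 1) (pderiv k P) t c hP.pderiv ?_ rfl (by omega), zero_add]
      · by_cases htk : t k = 0
        · simp [htk, gaussInt]
        · refine ih (t - Finsupp.single k 1).degree ?_ d P _ _ hP hΔ rfl ?_
          all_goals
            have h4 : t = Finsupp.single k 1 + (t - Finsupp.single k 1) :=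
              (add_tsub_cancel_of_le (Finsupp.single_le_iff.2 (Nat.one_le_iff_ne_zero.2 htk))).symm
            have h5 := congrArg Finsupp.degree h4
            rw [map_add, Finsupp.degree_single] at h5
            omega
      · have : ∑ i, pderiv i (pderiv i (pderiv k P)) = pderiv k (∑ i, pderiv i (pderiv i P)) := by
          rw [map_sum]
          refine Finset.sum_congr rfl fun i _ => ?_
          rw [pderiv_comm i k P, pderiv_comm i k]
        rw [this, hΔ, map_zero]
  rw [R.as_sum, Finset.mul_sum, gaussInt_sum]
  refine Finset.sum_eq_zero fun s hs => key _ d P s _ hP hΔ rfl ?_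
  exact (le_totalDegree hs).trans_lt hR

/-- A nonzero harmonic homogeneous polynomial has no multiple factor. -/
theorem totalDegree_eq_zero_of_sq_mul {d : ℕ} {P Q R : MvPolynomial (Fin n) ℝ}
    (hP : P.IsHomogeneous d) (hΔ : ∑ i, pderiv i (pderiv i P) = 0) (hP0 : P ≠ 0)
    (h : P = Q ^ 2 * R) : Q.totalDegree = 0 := by
  by_contra hQ
  have hQ0 : Q ≠ 0 := by rintro rfl; simp at hQ
  have hR0 : R ≠ 0 := by rintro rfl; simp at h; exact hP0 h
  have hdeg : d = Q.totalDegree + Q.totalDegree + R.totalDegree := by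
    rw [← hP.totalDegree hP0, h, sq, totalDegree_mul_of_isDomain (mul_ne_zero hQ0 hQ0) hR0,
      totalDegree_mul_of_isDomain hQ0 hQ0]
  have h0 := gaussInt_mul_eq_zero hP hΔ (R := R) (by omega)
  rw [h, show Q ^ 2 * R * R = (Q * R) ^ 2 by ring] at h0
  exact mul_ne_zero hQ0 hR0 (eq_zero_of_gaussInt_sq h0)

end GaussianFunctional

section SeparableLines

open MvPolynomial

variable {n : ℕ}

theorem sum_eq_of_mem_support {d : ℕ} {P : MvPolynomial (Fin n) ℝ} (hP : P.IsHomogeneous d)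
    {s : Fin n →₀ ℕ} (hs : s ∈ P.support) : ∑ k, s k = d := by
  simpa [Finsupp.weight_apply, Finsupp.sum_fintype] using hP (mem_support_iff.1 hs)

theorem aeval_mul_of_isHomogeneous {S : Type*} [CommRing S] [Algebra ℝ S] {d : ℕ}
    {P : MvPolynomial (Fin n) ℝ} (hP : P.IsHomogeneous d) (t : S) (x : Fin n → S) :
    aeval (fun k => t * x k) P = t ^ d * aeval x P := by
  rw [aeval_def, aeval_def, eval₂_eq', eval₂_eq', Finset.mul_sum]
  refine Finset.sum_congr rfl fun s hs => ?_
  have h := sum_eq_of_mem_support hP hs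
  simp only [mul_pow, Finset.prod_mul_distrib, Finset.prod_pow_eq_pow_sum, h]
  ring

theorem natDegree_prod_le_and_coeff {ι A : Type*} [CommRing A] (s : Finset ι)
    (f : ι → Polynomial A) (e : ι → ℕ) (h : ∀ i ∈ s, (f i).natDegree ≤ e i) :
    (∏ i ∈ s, f i).natDegree ≤ ∑ i ∈ s, e i ∧
      (∏ i ∈ s, f i).coeff (∑ i ∈ s, e i) = ∏ i ∈ s, (f i).coeff (e i) := by
  classical
  induction s using Finset.induction_on with
  | empty => simp
  | insert a s ha ih =>
    obtain ⟨h1, h2⟩ := ih fun i hi => h i (Finset.mem_insert_of_mem hi)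
    have h3 := h a (Finset.mem_insert_self a s)
    rw [Finset.prod_insert ha, Finset.sum_insert ha, Finset.prod_insert ha]
    exact ⟨Polynomial.natDegree_mul_le_of_le h3 h1,
      by rw [Polynomial.coeff_mul_add_eq_of_natDegree_le h3 h1, h2]⟩

/-- The restriction of a polynomial to the generic line with direction `b`. -/
def linePoly (b : Fin n → ℝ) (P : MvPolynomial (Fin n) ℝ) :
    Polynomial (MvPolynomial (Fin n) ℝ) :=
  aeval (fun k => Polynomial.C (X k) + Polynomial.C (C (b k)) * Polynomial.X) P

theorem linePoly_natDegree_le_and_coeff (b : Fin n → ℝ) {d : ℕ} {P : MvPolynomial (Fin n) ℝ}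
    (hP : P.IsHomogeneous d) :
    (linePoly b P).natDegree ≤ d ∧ (linePoly b P).coeff d = C (eval b P) := by
  have hf : ∀ k : Fin n, (Polynomial.C (X k) + Polynomial.C (C (b k)) * Polynomial.X :
      Polynomial (MvPolynomial (Fin n) ℝ)).natDegree ≤ 1 := fun k => by
    compute_degree
  have hp : ∀ s ∈ P.support, (∏ k, (Polynomial.C (X k) + Polynomial.C (C (b k)) * Polynomial.X :
      Polynomial (MvPolynomial (Fin n) ℝ)) ^ s k).natDegree ≤ d ∧
      (∏ k, (Polynomial.C (X k) + Polynomial.C (C (b k)) * Polynomial.X :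
      Polynomial (MvPolynomial (Fin n) ℝ)) ^ s k).coeff d = ∏ k, C (b k) ^ s k := by
    intro s hs
    have h : ∑ k, s k * 1 = d := by
      simp_rw [mul_one]
      exact sum_eq_of_mem_support hP hs
    obtain ⟨h1, h2⟩ := natDegree_prod_le_and_coeff Finset.univ (fun k =>
      (Polynomial.C (X k) + Polynomial.C (C (b k)) * Polynomial.X :
        Polynomial (MvPolynomial (Fin n) ℝ)) ^ s k) (fun k => s k * 1)
      fun k _ => Polynomial.natDegree_pow_le_of_le _ (hf k)
    rw [h] at h1 h2
    refine ⟨h1, h2.trans (Finset.prod_congr rfl fun k _ => ?_)⟩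
    rw [Polynomial.coeff_pow_of_natDegree_le (hf k)]
    simp
  have e : linePoly b P = ∑ s ∈ P.support, Polynomial.C (C (coeff s P)) *
      ∏ k, (Polynomial.C (X k) + Polynomial.C (C (b k)) * Polynomial.X) ^ s k := by
    rw [linePoly, aeval_def, eval₂_eq']
    rfl
  rw [e]
  constructor
  · refine Polynomial.natDegree_sum_le_of_forall_le _ _ fun s hs => ?_
    exact (Polynomial.natDegree_C_mul_le _ _).trans (hp s hs).1
  · rw [Polynomial.finsetSum_coeff, eval_eq', map_sum]
    refine Finset.sum_congr rfl fun s hs => ?_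
    rw [Polynomial.coeff_C_mul, (hp s hs).2]
    simp

theorem aeval_linePoly (b : Fin n → ℝ) (P : MvPolynomial (Fin n) ℝ) (Y : Fin n → ℝ) {S : Type*}
    [CommRing S] [Algebra ℝ S] (t : S) :
    Polynomial.aeval t ((linePoly b P).map (eval Y))
      = aeval (fun k => algebraMap ℝ S (Y k) + algebraMap ℝ S (b k) * t) P := by
  induction P using MvPolynomial.induction_on with
  | C a => simp [linePoly, algebraMap_eq, Polynomial.algebraMap_apply]
  | add p q hp hq =>
    simp only [linePoly, map_add, Polynomial.map_add] at hp hq ⊢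
    rw [hp, hq]
  | mul_X p k hp =>
    simp only [linePoly, map_mul, Polynomial.map_mul, aeval_X] at hp ⊢
    rw [hp]
    simp

theorem derivative_linePoly_single (i : Fin n) (P : MvPolynomial (Fin n) ℝ) :
    Polynomial.derivative (linePoly (Pi.single i 1) P)
      = linePoly (Pi.single i 1) (pderiv i P) := by
  induction P using MvPolynomial.induction_on with
  | C a => simp [linePoly, Polynomial.algebraMap_apply]
  | add p q hp hq =>
    simp only [linePoly, map_add] at hp hq ⊢
    rw [hp, hq]
  | mul_X p k hp =>
    simp only [linePoly, map_mul, aeval_X, Polynomial.derivative_mul, pderiv_mul, map_add] at hp ⊢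
    rw [hp]
    rcases eq_or_ne k i with rfl | h
    · simp
    · simp [h]

theorem squarefree_linePoly {b : Fin n → ℝ} {d : ℕ} {P : MvPolynomial (Fin n) ℝ}
    (hP : P.IsHomogeneous d) (hsq : ∀ Q R, P = Q ^ 2 * R → Q.totalDegree = 0)
    (hb : eval b P = 1) (K : Type*) [Field K] [Algebra (MvPolynomial (Fin n) ℝ) K]
    [IsFractionRing (MvPolynomial (Fin n) ℝ) K] :
    Squarefree ((linePoly b P).map (algebraMap (MvPolynomial (Fin n) ℝ) K)) := by
  obtain ⟨h1, h2⟩ := linePoly_natDegree_le_and_coeff b hP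
  have hm : (linePoly b P).Monic :=
    Polynomial.monic_of_natDegree_le_of_coeff_eq_one d h1 (by rw [h2, hb, map_one])
  have hinj : Function.Injective (algebraMap (MvPolynomial (Fin n) ℝ) K) :=
    IsFractionRing.injective _ _
  intro q hq
  have hq0 : q ≠ 0 := by
    rintro rfl
    rw [zero_mul, zero_dvd_iff] at hq
    exact (hm.map _).ne_zero hq
  obtain ⟨Q, hQ⟩ := IsIntegrallyClosed.eq_map_mul_C_of_dvd K hm (dvd_of_mul_right_dvd hq)
  have hlc : q.leadingCoeff ≠ 0 := Polynomial.leadingCoeff_ne_zero.2 hq0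
  have hQm : Q.Monic := by
    refine Polynomial.monic_of_injective hinj ?_
    have := congrArg Polynomial.leadingCoeff hQ
    rw [Polynomial.leadingCoeff_mul, Polynomial.leadingCoeff_C] at this
    exact mul_right_cancel₀ hlc (this.trans (one_mul _).symm)
  have hQd : Q * Q ∣ linePoly b P := by
    rw [← Polynomial.map_dvd_map _ hinj (hQm.mul hQm), Polynomial.map_mul]
    refine dvd_trans (mul_dvd_mul ?_ ?_) hq <;> exact Dvd.intro _ hQ
  obtain ⟨R, hR⟩ := hQd
  have e0 : P = (Q.eval 0) ^ 2 * R.eval 0 := by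
    have h3 := congrArg (Polynomial.eval 0) hR
    rw [Polynomial.eval_mul, Polynomial.eval_mul, ← sq] at h3
    rw [← h3, linePoly, ← Polynomial.coe_evalRingHom, aeval_def, hom_eval₂, eval₂_eq']
    simp [Polynomial.algebraMap_apply, ← eval₂_eq', algebraMap_eq]
  have hc := totalDegree_eq_zero_iff_eq_C.1 (hsq _ _ e0)
  have hX : (linePoly b P).map constantCoeff = Polynomial.X ^ d := by
    refine Polynomial.funext fun t => ?_
    have h3 := aeval_mul_of_isHomogeneous hP t b
    rw [aeval_eq_eval, aeval_eq_eval, hb, mul_one] at h3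
    have h4 := aeval_linePoly b P 0 t
    rw [eval_zero, Polynomial.coe_aeval_eq_eval, aeval_eq_eval] at h4
    rw [h4, Polynomial.eval_pow, Polynomial.eval_X, ← h3]
    simp [mul_comm]
  have hdvd : Q.map constantCoeff ∣ Polynomial.X ^ d := by
    rw [← hX, hR, Polynomial.map_mul, Polynomial.map_mul, mul_assoc]
    exact dvd_mul_right _ _
  obtain ⟨m, hmd, hass⟩ := (dvd_prime_pow Polynomial.prime_X d).1 hdvd
  have hQX := Polynomial.eq_of_monic_of_associated (hQm.map constantCoeff)
    (Polynomial.monic_X_pow m) hass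
  rcases Nat.eq_zero_or_pos m with rfl | hm0
  · have : Q.natDegree = 0 := by
      rw [← hQm.natDegree_map constantCoeff, hQX, pow_zero, Polynomial.natDegree_one]
    rw [hQm.natDegree_eq_zero.1 this, Polynomial.map_one, one_mul] at hQ
    rw [← hQ]
    exact Polynomial.isUnit_C.2 hlc.isUnit
  · have h4 : constantCoeff (Q.eval 0) = 0 := by
      have := congrArg (Polynomial.eval 0) hQX
      rw [Polynomial.eval_pow, Polynomial.eval_X, zero_pow hm0.ne'] at this
      rw [← this, ← Polynomial.coeff_zero_eq_eval_zero, ← Polynomial.coeff_zero_eq_eval_zero,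
        Polynomial.coeff_map]
    rw [hc, constantCoeff_C] at h4
    rw [hc, h4, map_zero, sq, zero_mul, zero_mul] at e0
    rw [e0, map_zero] at hb
    exact absurd hb zero_ne_one

theorem exists_bezout_linePoly {b : Fin n → ℝ} {d : ℕ} {P : MvPolynomial (Fin n) ℝ}
    (hP : P.IsHomogeneous d) (hsq : ∀ Q R, P = Q ^ 2 * R → Q.totalDegree = 0)
    (hb : eval b P ≠ 0) (K : Type*) [Field K] [Algebra (MvPolynomial (Fin n) ℝ) K]
    [IsFractionRing (MvPolynomial (Fin n) ℝ) K] :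
    ∃ (c : MvPolynomial (Fin n) ℝ) (u v : Polynomial (MvPolynomial (Fin n) ℝ)), c ≠ 0 ∧
      u * linePoly b P + v * Polynomial.derivative (linePoly b P) = Polynomial.C c := by
  have hinj : Function.Injective (algebraMap (MvPolynomial (Fin n) ℝ) K) :=
    IsFractionRing.injective _ _
  have hchar : CharZero K :=
    charZero_of_injective_ringHom (f := (algebraMap (MvPolynomial (Fin n) ℝ) K)) hinj
  have hPs : linePoly b (C (eval b P)⁻¹ * P)
      = Polynomial.C (C (eval b P)⁻¹) * linePoly b P := by
    rw [linePoly, linePoly, map_mul, ← algebraMap_eq, AlgHom.commutes]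
    rfl
  have hs := squarefree_linePoly (P := C (eval b P)⁻¹ * P) (b := b) (hP.C_mul _)
    (fun Q R h => hsq Q (C (eval b P) * R) (by
      rw [mul_left_comm, ← h, ← mul_assoc, ← map_mul, mul_inv_cancel₀ hb, map_one, one_mul]))
    (by rw [map_mul, eval_C, inv_mul_cancel₀ hb]) K
  rw [hPs, Polynomial.map_mul] at hs
  have hs' := hs.squarefree_of_dvd (dvd_mul_left _ _)
  obtain ⟨u, v, huv⟩ := PerfectField.separable_iff_squarefree.2 hs'
  obtain ⟨bu, hbu, hu⟩ :=
    IsLocalization.integerNormalization_spec (nonZeroDivisors (MvPolynomial (Fin n) ℝ)) u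
  obtain ⟨bv, hbv, hv⟩ :=
    IsLocalization.integerNormalization_spec (nonZeroDivisors (MvPolynomial (Fin n) ℝ)) v
  rw [← algebraMap_smul K, Polynomial.smul_eq_C_mul] at hu hv
  refine ⟨bu * bv, Polynomial.C bv * IsLocalization.integerNormalization
      (nonZeroDivisors (MvPolynomial (Fin n) ℝ)) u,
    Polynomial.C bu * IsLocalization.integerNormalization
      (nonZeroDivisors (MvPolynomial (Fin n) ℝ)) v,
    mul_ne_zero (nonZeroDivisors.ne_zero hbu) (nonZeroDivisors.ne_zero hbv), ?_⟩
  apply Polynomial.map_injective _ hinj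
  simp only [Polynomial.map_add, Polynomial.map_mul, Polynomial.map_C, hu, hv, map_mul,
    ← Polynomial.derivative_map]
  linear_combination Polynomial.C (algebraMap (MvPolynomial (Fin n) ℝ) K bu)
    * Polynomial.C (algebraMap (MvPolynomial (Fin n) ℝ) K bv) * huv

/-- If `P` has no multiple factor then its restriction to almost every line with a given
noncharacteristic direction has no multiple root. -/
theorem exists_isCoprime_linePoly {b : Fin n → ℝ} {d : ℕ} {P : MvPolynomial (Fin n) ℝ}
    (hP : P.IsHomogeneous d) (hsq : ∀ Q R, P = Q ^ 2 * R → Q.totalDegree = 0)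
    (hb : eval b P ≠ 0) : ∃ c : MvPolynomial (Fin n) ℝ, c ≠ 0 ∧ ∀ Y, eval Y c ≠ 0 →
      IsCoprime ((linePoly b P).map (eval Y))
        (Polynomial.derivative ((linePoly b P).map (eval Y))) := by
  obtain ⟨c, u, v, hc, key⟩ :=
    exists_bezout_linePoly hP hsq hb (FractionRing (MvPolynomial (Fin n) ℝ))
  refine ⟨c, hc, fun Y hY => ?_⟩
  have h := congrArg (Polynomial.map (eval Y)) key
  simp only [Polynomial.map_add, Polynomial.map_mul, Polynomial.map_C,
      ← Polynomial.derivative_map] at h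
  refine ⟨Polynomial.C (eval Y c)⁻¹ * u.map (eval Y),
    Polynomial.C (eval Y c)⁻¹ * v.map (eval Y), ?_⟩
  rw [mul_assoc, mul_assoc, ← mul_add, h, ← Polynomial.C_mul, inv_mul_cancel₀ hY, Polynomial.C_1]

/-- A generic basis: no basis direction is characteristic, and the restrictions to the lines in
the coordinate planes have no multiple roots. -/
theorem exists_generic_basis {d : ℕ} {P : MvPolynomial (Fin n) ℝ}
    (hP : P.IsHomogeneous d) (hP0 : P ≠ 0) (hsq : ∀ Q R, P = Q ^ 2 * R → Q.totalDegree = 0) :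
    ∃ b : Fin n → (Fin n → ℝ), LinearIndependent ℝ b ∧ (∀ i, eval (b i) P ≠ 0) ∧
      ∀ i j, i < j → IsCoprime ((linePoly (b i) P).map (eval (b j)))
        (Polynomial.derivative ((linePoly (b i) P).map (eval (b j)))) := by
  suffices H : ∀ m ≤ n, ∃ b : Fin m → (Fin n → ℝ), LinearIndependent ℝ b ∧
      (∀ i, eval (b i) P ≠ 0) ∧ ∀ i j, i < j → IsCoprime ((linePoly (b i) P).map (eval (b j)))
        (Polynomial.derivative ((linePoly (b i) P).map (eval (b j)))) from H n le_rfl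
  intro m
  induction m with
  | zero => exact fun _ => ⟨Fin.elim0, linearIndependent_empty_type, fun i => i.elim0,
      fun i => i.elim0⟩
  | succ m ih =>
    intro hm
    obtain ⟨b, hli, hbP, hbc⟩ := ih (by omega)
    choose c hc0 hc using fun i => exists_isCoprime_linePoly hP hsq (hbP i)
    have hlt : Submodule.span ℝ (range b) < ⊤ := by
      refine lt_top_iff_ne_top.2 fun htop => ?_
      have h1 := finrank_span_eq_card hli
      rw [htop, finrank_top] at h1
      simp at h1
      omega
    obtain ⟨f, hf0, hf⟩ := Submodule.exists_le_ker_of_lt_top _ hlt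
    set ℓ : MvPolynomial (Fin n) ℝ := ∑ k, C (f (Pi.single k 1)) * X k with hℓ
    have hℓe : ∀ v, eval v ℓ = f v := fun v => by
      rw [hℓ, map_sum]
      conv_rhs => rw [pi_eq_sum_univ' v, map_sum]
      refine Finset.sum_congr rfl fun k _ => ?_
      rw [map_mul, eval_C, eval_X, map_smul, smul_eq_mul, mul_comm]
    have hℓ0 : ℓ ≠ 0 := by
      intro h
      refine hf0 (LinearMap.ext fun v => ?_)
      rw [← hℓe, h, map_zero, LinearMap.zero_apply]
    have hprod : P * ℓ * ∏ i, c i ≠ 0 :=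
      mul_ne_zero (mul_ne_zero hP0 hℓ0) (Finset.prod_ne_zero_iff.2 fun i _ => hc0 i)
    obtain ⟨v, hv⟩ : ∃ v, eval v (P * ℓ * ∏ i, c i) ≠ 0 := by
      by_contra! h
      exact hprod (MvPolynomial.funext fun v => by rw [h v, map_zero])
    rw [map_mul, map_mul, map_prod] at hv
    have hvP := left_ne_zero_of_mul (left_ne_zero_of_mul hv)
    have hvℓ := right_ne_zero_of_mul (left_ne_zero_of_mul hv)
    have hvc := Finset.prod_ne_zero_iff.1 (right_ne_zero_of_mul hv)
    refine ⟨Fin.snoc b v, linearIndependent_finSnoc.2 ⟨hli, fun h => hvℓ ?_⟩, ?_, ?_⟩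
    · rw [hℓe]
      exact hf h
    · refine Fin.lastCases ?_ fun i => ?_
      · simpa using hvP
      · simpa using hbP i
    · refine Fin.lastCases (fun j hj => absurd hj (Fin.le_last j).not_gt) fun i => ?_
      refine Fin.lastCases (fun _ => ?_) fun j hij => ?_
      · simpa using hc i v (hvc i (Finset.mem_univ i))
      · simpa using hbc i j (by simpa using hij)

/-- The polynomials which vanish at the critical zeros of `P` on the plane where all
coordinates other than the `i`-th and `j`-th vanish. -/
def critFamily (P : MvPolynomial (Fin n) ℝ) (i j : Fin n) :
    Unit ⊕ Fin n ⊕ {k : Fin n // k ≠ i ∧ k ≠ j} → MvPolynomial (Fin n) ℝ :=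
  Sum.elim (fun _ => P) (Sum.elim (fun l => pderiv l P) fun k => X k.1)

/-- Linear change of variables. -/
def substBasis (b : Fin n → (Fin n → ℝ)) (P : MvPolynomial (Fin n) ℝ) :
    MvPolynomial (Fin n) ℝ :=
  aeval (fun l => ∑ k, C (b k l) * X k) P

theorem eval_substBasis (b : Fin n → (Fin n → ℝ)) (P : MvPolynomial (Fin n) ℝ) (x : Fin n → ℝ) :
    eval x (substBasis b P) = eval (fun l => ∑ k, b k l * x k) P := by
  induction P using MvPolynomial.induction_on with
  | C a => simp [substBasis, algebraMap_eq]
  | add p q hp hq =>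
    simp only [substBasis, map_add] at hp hq ⊢
    rw [hp, hq]
  | mul_X p k hp =>
    simp only [substBasis, map_mul, aeval_X] at hp ⊢
    rw [hp]
    simp

theorem isHomogeneous_substBasis (b : Fin n → (Fin n → ℝ)) {d : ℕ} {P : MvPolynomial (Fin n) ℝ}
    (hP : P.IsHomogeneous d) : (substBasis b P).IsHomogeneous d := by
  have := hP.aeval (fun l => ∑ k, C (b k l) * X k) (n := 1) fun l =>
    IsHomogeneous.sum _ _ _ fun k _ => (isHomogeneous_X ℝ k).C_mul _
  rwa [one_mul] at this

theorem linePoly_substBasis (b : Fin n → (Fin n → ℝ)) (P : MvPolynomial (Fin n) ℝ) (i j : Fin n) :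
    (linePoly (Pi.single i 1) (substBasis b P)).map (eval (Pi.single j 1))
      = (linePoly (b i) P).map (eval (b j)) := by
  refine Polynomial.funext fun t => ?_
  have h1 := aeval_linePoly (Pi.single i 1) (substBasis b P) (Pi.single j 1) t
  have h2 := aeval_linePoly (b i) P (b j) t
  rw [Polynomial.coe_aeval_eq_eval, aeval_eq_eval] at h1 h2
  rw [h1, h2, eval_substBasis]
  congr 2
  ext l
  simp [Pi.single_apply, mul_add, Finset.sum_add_distrib]

/-- If a homogeneous polynomial has only nondegenerate critical behaviour in the plane of the
`i`-th and `j`-th coordinates then its critical zeros there are concentrated at the origin. -/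
theorem eq_zero_of_forall_critFamily {K : Type*} [Field K] [Algebra ℝ K] {d : ℕ}
    {P : MvPolynomial (Fin n) ℝ} (hP : P.IsHomogeneous d) {i j : Fin n} (hij : i ≠ j)
    (hi : eval (Pi.single i 1) P ≠ 0)
    (hc : IsCoprime ((linePoly (Pi.single i 1) P).map (eval (Pi.single j 1)))
      (Polynomial.derivative ((linePoly (Pi.single i 1) P).map (eval (Pi.single j 1)))))
    {x : Fin n → K} (hx : ∀ e, aeval x (critFamily P i j e) = 0) : x = 0 := by
  have hx0 : aeval x P = 0 := hx (Sum.inl ())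
  have hx1 : aeval x (pderiv i P) = 0 := hx (Sum.inr (Sum.inl i))
  have hx2 : ∀ k, k ≠ i → k ≠ j → x k = 0 := fun k h1 h2 => by
    simpa [critFamily] using hx (Sum.inr (Sum.inr ⟨k, h1, h2⟩))
  have hxj : x j = 0 := by
    by_contra hxj
    obtain ⟨u, v, huv⟩ := hc
    rw [Polynomial.derivative_map, derivative_linePoly_single] at huv
    have hpt : (fun k => algebraMap ℝ K ((Pi.single j 1 : Fin n → ℝ) k)
        + algebraMap ℝ K ((Pi.single i 1 : Fin n → ℝ) k) * ((x j)⁻¹ * x i))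
        = fun k => (x j)⁻¹ * x k := by
      ext k
      rcases eq_or_ne k i with rfl | h1
      · simp [hij]
      · rcases eq_or_ne k j with rfl | h2
        · simp [h1, hxj]
        · simp [h1, h2, hx2 k h1 h2]
    have h := congrArg (Polynomial.aeval ((x j)⁻¹ * x i)) huv
    rw [map_add, map_mul, map_mul, aeval_linePoly, aeval_linePoly, hpt,
      aeval_mul_of_isHomogeneous hP, aeval_mul_of_isHomogeneous hP.pderiv, hx0, hx1] at h
    simp at h
  have hxi : x i = 0 := by
    have h : x = fun k => x i * algebraMap ℝ K ((Pi.single i 1 : Fin n → ℝ) k) := by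
      ext k
      rcases eq_or_ne k i with rfl | h1
      · simp
      · rcases eq_or_ne k j with rfl | h2
        · simp [h1, hxj]
        · simp [h1, hx2 k h1 h2]
    rw [h, aeval_mul_of_isHomogeneous hP] at hx0
    rcases mul_eq_zero.1 hx0 with h1 | h1
    · exact eq_zero_of_pow_eq_zero h1
    · have h2 := aeval_algebraMap_apply K (Pi.single i 1 : Fin n → ℝ) P
      rw [Function.comp_def, h1, aeval_eq_eval] at h2
      exact absurd ((map_eq_zero _).1 h2.symm) hi
  ext k
  by_cases h1 : k = i
  · rw [h1, hxi, Pi.zero_apply]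
  · by_cases h2 : k = j
    · rw [h2, hxj, Pi.zero_apply]
    · exact hx2 k h1 h2

theorem exists_idealOfVars_pow_le {d : ℕ} {P : MvPolynomial (Fin n) ℝ} (hP : P.IsHomogeneous d)
    {i j : Fin n} (hij : i ≠ j) (hi : eval (Pi.single i 1) P ≠ 0)
    (hc : IsCoprime ((linePoly (Pi.single i 1) P).map (eval (Pi.single j 1)))
      (Polynomial.derivative ((linePoly (Pi.single i 1) P).map (eval (Pi.single j 1))))) :
    ∃ N, idealOfVars (Fin n) ℝ ^ N ≤ Ideal.span (range (critFamily P i j)) := by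
  refine Ideal.exists_pow_le_of_le_radical_of_fg ?_ (idealOfVars_fg _ _)
  rw [idealOfVars, Ideal.span_le]
  rintro _ ⟨k, rfl⟩
  rw [SetLike.mem_coe, Ideal.radical_eq_sInf, Ideal.mem_sInf]
  rintro J ⟨hJ, hJp⟩
  let φ : MvPolynomial (Fin n) ℝ →ₐ[ℝ] FractionRing (MvPolynomial (Fin n) ℝ ⧸ J) :=
    (IsScalarTower.toAlgHom ℝ (MvPolynomial (Fin n) ℝ ⧸ J) _).comp (Ideal.Quotient.mkₐ ℝ J)
  have hφ : ∀ Q, φ Q = 0 ↔ Q ∈ J := fun Q => by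
    have : φ Q = algebraMap (MvPolynomial (Fin n) ℝ ⧸ J) _ (Ideal.Quotient.mk J Q) := rfl
    rw [this, IsFractionRing.to_map_eq_zero_iff, Ideal.Quotient.eq_zero_iff_mem]
  have h := eq_zero_of_forall_critFamily hP hij hi hc (x := fun k => φ (X k)) fun e => by
    rw [← comp_aeval_apply, aeval_X_left_apply]
    exact (hφ _).2 (hJ (Ideal.subset_span (mem_range_self e)))
  exact (hφ _).1 (congrFun h k)

/-- In generic coordinates, all monomials of high degree lie in the ideals of the critical
zeros in the coordinate planes. -/
theorem exists_basis_idealOfVars_pow_le {d : ℕ} {P : MvPolynomial (Fin n) ℝ}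
    (hP : P.IsHomogeneous d) (hP0 : P ≠ 0) (hsq : ∀ Q R, P = Q ^ 2 * R → Q.totalDegree = 0) :
    ∃ b : Fin n → (Fin n → ℝ), LinearIndependent ℝ b ∧ ∃ N, ∀ i j, i < j →
      idealOfVars (Fin n) ℝ ^ N ≤ Ideal.span (range (critFamily (substBasis b P) i j)) := by
  obtain ⟨b, hli, hbP, hbc⟩ := exists_generic_basis hP hP0 hsq
  have h : ∀ i j, ∃ N, i < j →
      idealOfVars (Fin n) ℝ ^ N ≤ Ideal.span (range (critFamily (substBasis b P) i j)) := by
    intro i j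
    by_cases hij : i < j
    · obtain ⟨N, hN⟩ := exists_idealOfVars_pow_le (isHomogeneous_substBasis b hP) hij.ne
        (by rw [eval_substBasis]; simpa [Pi.single_apply] using hbP i)
        (by rw [linePoly_substBasis]; exact hbc i j hij)
      exact ⟨N, fun _ => hN⟩
    · exact ⟨0, fun h => absurd h hij⟩
  choose N hN using h
  refine ⟨b, hli, ∑ i, ∑ j, N i j, fun i j hij => (Ideal.pow_le_pow_right ?_).trans (hN i j hij)⟩
  exact (Finset.single_le_sum (f := fun j => N i j) (fun _ _ => Nat.zero_le _)
    (Finset.mem_univ j)).trans (Finset.single_le_sum (f := fun i => ∑ j, N i j)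
      (fun _ _ => Nat.zero_le _) (Finset.mem_univ i))

end SeparableLines

section LeadingPolynomial

open MvPolynomial

variable {n : ℕ} {f g : Euc n → ℝ}

theorem pd_pd_comm (hf : ContDiff ℝ (⊤ : ℕ∞) f) (i j : Fin n) :
    pd i (pd j f) = pd j (pd i f) :=
  funext fun x => pd_comm isOpen_univ hf.contDiffOn i j (mem_univ x)

/-- The polynomial function on Euclidean space. -/
def polyFun (P : MvPolynomial (Fin n) ℝ) (x : Euc n) : ℝ := eval (fun k => x k) P

theorem contDiff_polyFun (P : MvPolynomial (Fin n) ℝ) : ContDiff ℝ (⊤ : ℕ∞) (polyFun P) := by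
  induction P using MvPolynomial.induction_on with
  | C a =>
    have e : polyFun (C a : MvPolynomial (Fin n) ℝ) = fun _ => a := by ext x; simp [polyFun]
    exact e ▸ contDiff_const
  | add p q hp hq =>
    have e : polyFun (p + q) = fun x => polyFun p x + polyFun q x := by ext x; simp [polyFun]
    exact e ▸ hp.add hq
  | mul_X p k hp =>
    have hX : ContDiff ℝ (⊤ : ℕ∞) fun x : Euc n => x k :=
      (EuclideanSpace.proj k : Euc n →L[ℝ] ℝ).contDiff
    have e : polyFun (p * X k) = fun x => polyFun p x * x k := by ext x; simp [polyFun]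
    exact e ▸ hp.mul hX

theorem pd_polyFun (i : Fin n) (P : MvPolynomial (Fin n) ℝ) :
    pd i (polyFun P) = polyFun (pderiv i P) := by
  induction P using MvPolynomial.induction_on with
  | C a =>
    have : polyFun (C a : MvPolynomial (Fin n) ℝ) = fun _ => a := by ext x; simp [polyFun]
    rw [this, pd_const, pderiv_C]
    ext x
    simp [polyFun]
  | add p q hp hq =>
    ext x
    have h := pd_add ((contDiff_polyFun p).differentiable (by simp) x)
      ((contDiff_polyFun q).differentiable (by simp) x) i
    have e : polyFun (p + q) = fun x => polyFun p x + polyFun q x := by ext x; simp [polyFun]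
    rw [e, h, hp, hq]
    simp [polyFun]
  | mul_X p k hp =>
    ext x
    have hX : ContDiff ℝ (⊤ : ℕ∞) fun x : Euc n => x k :=
      (EuclideanSpace.proj k : Euc n →L[ℝ] ℝ).contDiff
    have h := pd_mul ((contDiff_polyFun p).differentiable (by simp) x)
      (hX.differentiable (by simp) x) i
    have hk : pd i (fun x : Euc n => x k) x = if k = i then 1 else 0 := by
      have : HasFDerivAt (fun x : Euc n => x k) (EuclideanSpace.proj k : Euc n →L[ℝ] ℝ) x :=
        (EuclideanSpace.proj k : Euc n →L[ℝ] ℝ).hasFDerivAt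
      rw [pd, this.fderiv]
      simp
    rw [hp, hk] at h
    have e : polyFun (p * X k) = fun y => polyFun p y * y k := by ext y; simp [polyFun]
    rw [e, h]
    rcases eq_or_ne k i with rfl | hki
    · simp [polyFun]
      ring
    · simp [polyFun, hki]
      ring

/-- The homogeneous part of degree `d` of the Taylor polynomial at the origin. -/
def taylorPart : ℕ → (Euc n → ℝ) → MvPolynomial (Fin n) ℝ
  | 0, f => C (f 0)
  | d + 1, f => C ((d : ℝ) + 1)⁻¹ * ∑ i, X i * taylorPart d (pd i f)

theorem isHomogeneous_taylorPart (d : ℕ) (f : Euc n → ℝ) : (taylorPart d f).IsHomogeneous d := by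
  induction d generalizing f with
  | zero => exact isHomogeneous_C _ _
  | succ d ih =>
    refine IsHomogeneous.C_mul (IsHomogeneous.sum _ _ _ fun i _ => ?_) _
    rw [add_comm]
    exact (isHomogeneous_X ℝ i).mul (ih _)

theorem pderiv_taylorPart (hf : ContDiff ℝ (⊤ : ℕ∞) f) (d : ℕ) (j : Fin n) :
    pderiv j (taylorPart (d + 1) f) = taylorPart d (pd j f) := by
  have hX : ∀ i : Fin n, pderiv j (X i : MvPolynomial (Fin n) ℝ) = if i = j then 1 else 0 :=
    fun i => by
      rcases eq_or_ne i j with rfl | h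
      · simp
      · simp [h]
  induction d generalizing f with
  | zero =>
    simp [taylorPart, hX]
  | succ d ih =>
    rw [taylorPart, pderiv_C_mul, map_sum]
    simp_rw [pderiv_mul, hX, ih (hf.pd _), pd_pd_comm hf j]
    rw [Finset.sum_add_distrib]
    have h1 : ∑ i, X i * taylorPart d (pd i (pd j f))
        = C ((d : ℝ) + 1) * taylorPart (d + 1) (pd j f) := by
      rw [taylorPart, ← mul_assoc, ← C_mul, mul_inv_cancel₀ (by positivity), C_1, one_mul]
    have h2 : ∑ i, (if i = j then 1 else 0) * taylorPart (d + 1) (pd i f)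
        = taylorPart (d + 1) (pd j f) := by simp
    rw [h1, h2, ← one_add_mul, ← mul_assoc, ← C_1, ← C_add, ← C_mul]
    push_cast
    rw [add_comm 1 ((d : ℝ) + 1), inv_mul_cancel₀ (by positivity), C_1, one_mul]

theorem sflat_sub_taylorPart (hf : ContDiff ℝ (⊤ : ℕ∞) f) {d : ℕ} (h : SFlat d f 0) :
    SFlat (d + 1) (fun x => f x - polyFun (taylorPart d f) x) 0 := by
  induction d generalizing f with
  | zero => exact ⟨by simp [taylorPart, polyFun], fun i => trivial⟩
  | succ d ih =>
    refine ⟨?_, fun i => ?_⟩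
    · have : (fun k => (0 : Euc n) k) = (0 : Fin n → ℝ) := rfl
      simp [h.1, polyFun, taylorPart]
    · have e : pd i (fun x => f x - polyFun (taylorPart (d + 1) f) x)
          = fun x => pd i f x - polyFun (taylorPart d (pd i f)) x := by
        ext x
        rw [pd_sub (hf.differentiable (by simp) x)
            ((contDiff_polyFun _).differentiable (by simp) x),
          pd_polyFun, pderiv_taylorPart hf]
      rw [e]
      exact ih (hf.pd i) (h.2 i)

theorem taylorPart_ne_zero (hf : ContDiff ℝ (⊤ : ℕ∞) f) {d : ℕ} (h : SFlat d f 0)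
    (h' : ¬ SFlat (d + 1) f 0) : taylorPart d f ≠ 0 := by
  intro h0
  have := sflat_sub_taylorPart hf h
  rw [h0] at this
  exact h' (by simpa [polyFun] using this)

theorem taylorPart_eq_zero {d : ℕ} (h : SFlat (d + 1) f 0) : taylorPart d f = 0 := by
  induction d generalizing f with
  | zero => simp [taylorPart, h.1]
  | succ d ih => simp [taylorPart, fun i => ih (h.2 i)]

theorem taylorPart_sum {ι : Type*} (s : Finset ι) {F : ι → Euc n → ℝ}
    (hF : ∀ j ∈ s, ContDiff ℝ (⊤ : ℕ∞) (F j)) (c : ι → ℝ) (d : ℕ) :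
    taylorPart d (fun x => ∑ j ∈ s, c j * F j x) = ∑ j ∈ s, C (c j) * taylorPart d (F j) := by
  induction d generalizing F with
  | zero => simp [taylorPart, map_sum]
  | succ d ih =>
    have h : ∀ i, pd i (fun x => ∑ j ∈ s, c j * F j x) = fun x => ∑ j ∈ s, c j * pd i (F j) x := by
      intro i
      ext x
      rw [pd_sum s fun j hj => (contDiff_const.mul (hF j hj)).differentiable (by simp) x]
      exact Finset.sum_congr rfl fun j hj =>
        pd_const_mul _ ((hF j hj).differentiable (by simp) x) i
    simp only [taylorPart, h, fun i => ih fun j hj => (hF j hj).pd i, Finset.mul_sum]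
    rw [Finset.sum_comm]
    exact Finset.sum_congr rfl fun j _ => Finset.sum_congr rfl fun i _ => by ring

theorem taylorPart_comp_linear (hf : ContDiff ℝ (⊤ : ℕ∞) f) (b : Fin n → Fin n → ℝ)
    (B : Euc n →L[ℝ] Euc n) (hB : ∀ k l, B (EuclideanSpace.single k 1) l = b k l) (d : ℕ) :
    taylorPart d (fun y => f (0 + B y)) = substBasis b (taylorPart d f) := by
  induction d generalizing f with
  | zero => simp [taylorPart, substBasis, algebraMap_eq]
  | succ d ih =>
    have h : ∀ i, pd i (fun y => f (0 + B y)) = fun y => ∑ l, b i l * pd l f (0 + B y) := by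
      intro i
      ext y
      rw [pd_comp_affine (hf.differentiable (by simp))]
      simp only [hB]
    rw [taylorPart, taylorPart]
    simp_rw [h, taylorPart_sum Finset.univ (fun l _ => (hf.pd l).comp_affine B 0), ih (hf.pd _)]
    unfold substBasis
    rw [map_mul, ← algebraMap_eq, AlgHom.commutes, map_sum]
    congr 1
    simp_rw [map_mul, aeval_X, Finset.mul_sum, Finset.sum_mul]
    rw [Finset.sum_comm]
    exact Finset.sum_congr rfl fun j _ => Finset.sum_congr rfl fun i _ => by
      rw [algebraMap_eq]; ring

theorem SFlat.of_translate {k : ℕ} {p : Euc n} (h : SFlat k (fun z => f (p + z)) 0) :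
    SFlat k f p := by
  induction k generalizing f with
  | zero => trivial
  | succ k ih =>
    refine ⟨by simpa using h.1, fun i => ih ?_⟩
    have e : pd i (fun z => f (p + z)) = fun z => pd i f (p + z) := by
      ext z
      rw [pd, fderiv_comp_add_left]
      rfl
    exact e ▸ h.2 i

end LeadingPolynomial

section NormalForm

open MvPolynomial Carleman

variable {n : ℕ} {U : Set (Euc n)} {p : Euc n} {u : Euc n → ℝ} {a : Fin n → Fin n → Euc n → ℝ}
  {F : Euc n → ℝ → Euc n → ℝ} {k : ℕ}

/-- In suitable linear coordinates near a zero of finite order `k + 2`, a solution is a small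
perturbation of a homogeneous polynomial `P` such that for each coordinate plane the ideal
generated by `P`, its partial derivatives and the remaining coordinates has radical the
irrelevant ideal. -/
theorem exists_normal_form (hU : IsOpen U) (ha : ∀ i j, ContDiffOn ℝ (⊤ : ℕ∞) (a i j) U)
    (hsym : ∀ i j, ∀ x ∈ U, a i j x = a j i x)
    (hpos : ∀ x ∈ U, ∀ ξ : Euc n, ξ ≠ 0 → 0 < ∑ i, ∑ j, a i j x * ξ i * ξ j)
    (hF : ContDiffOn ℝ (⊤ : ℕ∞) (fun p : Euc n × ℝ × Euc n => F p.1 p.2.1 p.2.2)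
      (U ×ˢ (univ : Set (ℝ × Euc n))))
    (hF0 : ∀ x ∈ U, F x 0 0 = 0) (hu : ContDiffOn ℝ (⊤ : ℕ∞) u U)
    (hpde : ∀ x ∈ U, ∑ i, ∑ j, a i j x * pd i (pd j u) x = F x (u x) (gradient u x))
    (hp : p ∈ U) (h : SFlat (k + 2) u p) (h' : ¬ SFlat (k + 3) u p) :
    ∃ r > 0, ball p r ⊆ U ∧ ∃ u' : Euc n → ℝ, ContDiff ℝ (⊤ : ℕ∞) u' ∧ EqOn u u' (ball p r) ∧
      ∃ L : Euc n ≃L[ℝ] Euc n, SFlat (k + 2) (fun y => u' (p + L y)) 0 ∧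
      ∃ P : MvPolynomial (Fin n) ℝ, P.IsHomogeneous (k + 2) ∧
        SFlat (k + 3) (fun y => u' (p + L y) - polyFun P y) 0 ∧
        ∃ N, ∀ i j, i < j → idealOfVars (Fin n) ℝ ^ N ≤ Ideal.span (range (critFamily P i j)) := by
  obtain ⟨r, hr, hrU, χ, hχ1, hχ0, -, hχ⟩ := exists_cutoff hU hp
  obtain ⟨T, S, hST, hTS, hSA⟩ := exists_matrix_normalization (hsym · · p hp) (hpos p hp)
  set L₀ : Euc n →L[ℝ] Euc n := Matrix.toEuclideanCLM (n := Fin n) (𝕜 := ℝ) T with hLd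
  have hLT : ∀ i k, L₀ (EuclideanSpace.single i 1) k = T k i := fun i k => by
    simp [hLd, Matrix.ofLp_toEuclideanCLM]
  set S₀ : Euc n →L[ℝ] Euc n := Matrix.toEuclideanCLM (n := Fin n) (𝕜 := ℝ) S with hSd
  have hLS : ∀ z, L₀ (S₀ z) = z := fun z => by
    rw [hLd, hSd, ← mul_apply_eq_comp, ← map_mul, hTS, map_one, one_apply_eq_self]
  have hSL : ∀ z, S₀ (L₀ z) = z := fun z => by
    rw [hLd, hSd, ← mul_apply_eq_comp, ← map_mul, hST, map_one, one_apply_eq_self]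
  set u' : Euc n → ℝ := fun x => χ x * u x with hu'
  have hu's : ContDiff ℝ (⊤ : ℕ∞) u' := hχ u hu
  have huu : EqOn u u' (ball p r) := fun x hx => by simp [hu', hχ1 x hx]
  have hpu : ∀ i, EqOn (pd i u) (pd i u') (ball p r) := pd_congr isOpen_ball huu
  set v : Euc n → ℝ := fun y => u' (p + L₀ y) with hv
  have hvs : ContDiff ℝ (⊤ : ℕ∞) v := hu's.comp_affine L₀ p
  have hvf : SFlat (k + 2) v 0 :=
    (h.congr isOpen_ball (mem_ball_self hr) huu).comp_affine hu's L₀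
  have hvf' : ¬ SFlat (k + 3) v 0 := fun hc => by
    have h1 : SFlat (k + 3) (fun z => v (0 + S₀ z)) 0 := SFlat.comp_affine hvs S₀ hc
    simp only [hv, zero_add, hLS] at h1
    exact h' (h1.of_translate.congr isOpen_ball (mem_ball_self hr) huu.symm)
  have hΔ : ∑ i, pderiv i (pderiv i (taylorPart (k + 2) v)) = 0 := by
    have hfr : SFlat (k + 1) (fun x => ∑ i, ∑ j, a i j p * pd i (pd j u') x) p :=
      (SFlat.frozen_principal_part hU ha hF hF0 hu hpde hp h).congr isOpen_ball
        (mem_ball_self hr) fun x hx => Finset.sum_congr rfl fun i _ =>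
          Finset.sum_congr rfl fun j _ => by rw [pd_congr isOpen_ball (hpu j) i hx]
    have hs : ContDiff ℝ (⊤ : ℕ∞) fun x => ∑ i, ∑ j, a i j p * pd i (pd j u') x :=
      ContDiff.sum fun i _ => ContDiff.sum fun j _ => contDiff_const.mul ((hu's.pd j).pd i)
    have h1 := SFlat.comp_affine hs L₀ hfr
    have e : (fun y => ∑ i, ∑ j, a i j p * pd i (pd j u') (p + L₀ y))
        = fun y => ∑ i, (1 : ℝ) * pd i (pd i v) y := by
      ext y
      rw [← sum_conj_mul_pd_pd_comp_affine hu's hTS L₀ hLT]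
      simp_rw [hSA]
      simp [hv]
    rw [e] at h1
    have h2 := taylorPart_eq_zero h1
    rw [taylorPart_sum Finset.univ fun i _ => (hvs.pd i).pd i] at h2
    simpa [pderiv_taylorPart hvs, pderiv_taylorPart (hvs.pd _)] using h2
  have hP := isHomogeneous_taylorPart (k + 2) v
  have hP0 := taylorPart_ne_zero hvs hvf hvf'
  obtain ⟨b, hb, N, hN⟩ := exists_basis_idealOfVars_pow_le hP hP0
    fun Q R => totalDegree_eq_zero_of_sq_mul hP hΔ hP0
  set B : Euc n →L[ℝ] Euc n :=
    Matrix.toEuclideanCLM (n := Fin n) (𝕜 := ℝ) (Matrix.of fun l k => b k l) with hBd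
  have hB : ∀ k l, B (EuclideanSpace.single k 1) l = b k l := fun k l => by
    simp [hBd, Matrix.ofLp_toEuclideanCLM]
  have hBinj : Function.Injective B := by
    refine (injective_iff_map_eq_zero B).2 fun y hy => ?_
    have h1 : ∑ k, y k • b k = 0 := by
      ext l
      have : B y l = 0 := by rw [hy]; rfl
      simpa [hBd, Matrix.ofLp_toEuclideanCLM, Matrix.mulVec, dotProduct, mul_comm] using this
    ext k
    exact Fintype.linearIndependent_iff.1 hb _ h1 k
  have hLinj : Function.Injective (L₀.comp B) :=
    (Function.LeftInverse.injective hSL).comp hBinj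
  refine ⟨r, hr, hrU, u', hu's, huu,
    (LinearEquiv.ofInjectiveEndo (L₀.comp B : Euc n →ₗ[ℝ] Euc n) hLinj).toContinuousLinearEquiv,
    ?_, substBasis b (taylorPart (k + 2) v), isHomogeneous_substBasis b hP, ?_, N, hN⟩
  · have := SFlat.comp_affine hvs B hvf (p := 0)
    simpa [hv] using! this
  · have h1 : SFlat (k + 2) (fun y => v (0 + B y)) 0 := SFlat.comp_affine hvs B hvf
    have h2 := sflat_sub_taylorPart (hvs.comp_affine B 0) h1
    rw [taylorPart_comp_linear hvs b B hB] at h2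
    simpa [hv] using! h2

end NormalForm

section Counting

variable {n : ℕ} {f g : Euc n → ℝ} {K : ℕ} {ε δ : ℝ}

/-- All derivatives of order less than `K` of the smooth function `f` are bounded by `ε` on the
closed unit ball. -/
def DerivBound (K : ℕ) (ε : ℝ) (f : Euc n → ℝ) : Prop :=
  ContDiff ℝ (⊤ : ℕ∞) f ∧ ∀ w : List (Fin n), w.length < K → ∀ x, ‖x‖ ≤ 1 → |pdw w f x| ≤ ε

namespace DerivBound

theorem of_pd (hf : ContDiff ℝ (⊤ : ℕ∞) f) (h0 : ∀ x, ‖x‖ ≤ 1 → |f x| ≤ ε)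
    (h : ∀ i, DerivBound K ε (pd i f)) : DerivBound (K + 1) ε f := by
  refine ⟨hf, fun w hw => ?_⟩
  cases w with
  | nil => exact h0
  | cons i w => exact (h i).2 w (by simpa using hw)

theorem pd (h : DerivBound (K + 1) ε f) (i : Fin n) : DerivBound K ε (pd i f) :=
  ⟨h.1.pd i, fun w hw => h.2 (i :: w) (by simpa using hw)⟩

theorem of_succ (h : DerivBound (K + 1) ε f) : DerivBound K ε f :=
  ⟨h.1, fun w hw => h.2 w (by omega)⟩

theorem mono (h : DerivBound K ε f) (hε : ε ≤ δ) : DerivBound K δ f :=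
  ⟨h.1, fun w hw x hx => (h.2 w hw x hx).trans hε⟩

theorem congr (h : DerivBound K ε f) (hfg : ∀ x, g x = f x) : DerivBound K ε g :=
  (funext hfg : g = f) ▸ h

theorem const_mul (h : DerivBound K ε f) (c : ℝ) : DerivBound K (|c| * ε) fun x => c * f x := by
  refine ⟨contDiff_const.mul h.1, fun w hw x hx => ?_⟩
  rw [pdw_const_mul isOpen_univ h.1.contDiffOn c w (mem_univ x), abs_mul]
  exact mul_le_mul_of_nonneg_left (h.2 w hw x hx) (abs_nonneg c)

theorem add (hf : DerivBound K ε f) (hg : DerivBound K δ g) :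
    DerivBound K (ε + δ) fun x => f x + g x := by
  refine ⟨hf.1.add hg.1, fun w hw x hx => ?_⟩
  rw [pdw_add isOpen_univ hf.1.contDiffOn hg.1.contDiffOn w (mem_univ x)]
  exact (abs_add_le _ _).trans (add_le_add (hf.2 w hw x hx) (hg.2 w hw x hx))

theorem exists_abs_le (hf : ContDiff ℝ (⊤ : ℕ∞) f) : ∃ C ≥ 0, ∀ x, ‖x‖ ≤ 1 → |f x| ≤ C := by
  obtain ⟨C, hC⟩ := (isCompact_closedBall (0 : Euc n) 1).exists_bound_of_continuousOn
    hf.continuous.continuousOn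
  exact ⟨max C 0, le_max_right _ _, fun x hx => (hC x (by simpa using hx)).trans (le_max_left _ _)⟩

theorem exists_of_contDiff (K : ℕ) (hf : ContDiff ℝ (⊤ : ℕ∞) f) : ∃ C ≥ 0, DerivBound K C f := by
  induction K generalizing f with
  | zero => exact ⟨0, le_rfl, hf, fun w hw => by simp at hw⟩
  | succ K ih =>
    obtain ⟨C, hC, hfC⟩ := exists_abs_le hf
    choose D hD hfD using fun i => ih (hf.pd i)
    have hs : 0 ≤ ∑ i, D i := Finset.sum_nonneg fun i _ => hD i
    refine ⟨C + ∑ i, D i, by positivity, of_pd hf (fun x hx => (hfC x hx).trans (by linarith))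
      fun i => (hfD i).mono ?_⟩
    have := Finset.single_le_sum (fun i _ => hD i) (Finset.mem_univ i)
    linarith

theorem exists_mul (K : ℕ) (hg : ContDiff ℝ (⊤ : ℕ∞) g) :
    ∃ C ≥ 0, ∀ f : Euc n → ℝ, ∀ ε ≥ 0, DerivBound K ε f →
      DerivBound K (C * ε) fun x => g x * f x := by
  induction K generalizing g with
  | zero => exact ⟨0, le_rfl, fun f ε _ h => ⟨hg.mul h.1, fun w hw => by simp at hw⟩⟩
  | succ K ih =>
    obtain ⟨A, hA, hgA⟩ := exists_abs_le hg
    obtain ⟨B, hB, hgB⟩ := ih hg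
    choose D hD hgD using fun i => ih (hg.pd i)
    have hs : 0 ≤ ∑ i, D i := Finset.sum_nonneg fun i _ => hD i
    refine ⟨A + B + ∑ i, D i, by positivity, fun f ε hε hf => ?_⟩
    refine of_pd (hg.mul hf.1) (fun x hx => ?_) fun i => ?_
    · rw [abs_mul]
      have h1 : |f x| ≤ ε := hf.2 [] (by simp) x hx
      exact (mul_le_mul (hgA x hx) h1 (abs_nonneg _) hA).trans
        (mul_le_mul_of_nonneg_right (by linarith) hε)
    · have e : _root_.pd i (fun x => g x * f x)
          = fun x => _root_.pd i g x * f x + g x * _root_.pd i f x := by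
        ext x
        rw [pd_mul (hg.differentiable (by simp) x) (hf.1.differentiable (by simp) x)]
      rw [e]
      refine ((hgD i f ε hε hf.of_succ).add (hgB _ ε hε (hf.pd i))).mono ?_
      have := Finset.single_le_sum (fun i _ => hD i) (Finset.mem_univ i)
      rw [← add_mul]
      exact mul_le_mul_of_nonneg_right (by linarith) hε

theorem pd_comp_homothety (hf : ContDiff ℝ (⊤ : ℕ∞) f) (z : Euc n) (τ : ℝ) (i : Fin n) :
    _root_.pd i (fun x => f (z + τ • x)) = fun x => τ * _root_.pd i f (z + τ • x) := by
  ext x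
  have := pd_comp_affine (hf.differentiable (by simp)) (τ • ContinuousLinearMap.id ℝ (Euc n)) z x i
  simpa [Pi.single_apply] using this

theorem comp_homothety (hf : DerivBound K ε f) {z : Euc n} (hz : ‖z‖ ≤ 1) {τ : ℝ} (h0 : 0 ≤ τ)
    (h1 : τ ≤ 1) : DerivBound K ε fun x => f ((1 - τ) • z + τ • x) := by
  induction K generalizing f with
  | zero => exact ⟨hf.1.comp (by fun_prop), fun w hw => by simp at hw⟩
  | succ K ih =>
    have hε : 0 ≤ ε := (abs_nonneg _).trans (hf.2 [] (by simp) 0 (by simp))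
    refine of_pd (hf.1.comp (by fun_prop)) (fun x hx => hf.2 [] (by simp) _ ?_) fun i => ?_
    · refine (norm_add_le _ _).trans ?_
      rw [norm_smul, norm_smul, Real.norm_of_nonneg h0, Real.norm_of_nonneg (by linarith)]
      nlinarith
    · rw [pd_comp_homothety hf.1]
      refine ((ih (hf.pd i)).const_mul τ).mono ?_
      rw [abs_of_nonneg h0]
      nlinarith

/-- Blowing up a function vanishing to order `m + 1` at the origin at order `m`. -/
theorem exists_blowup (K : ℕ) {m : ℕ} (hf : ContDiff ℝ (⊤ : ℕ∞) f) (h : SFlat (m + 1) f 0) :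
    ∃ C ≥ 0, ∀ᶠ ρ in 𝓝[>] (0 : ℝ), DerivBound K (C * ρ) fun x => (ρ ^ m)⁻¹ * f (ρ • x) := by
  have hle : ∀ᶠ ρ in 𝓝[>] (0 : ℝ), 0 < ρ ∧ ρ ≤ 1 := by
    filter_upwards [Ioc_mem_nhdsGT (zero_lt_one' ℝ)] with ρ hρ using hρ
  have hsm : ∀ {g : Euc n → ℝ}, ContDiff ℝ (⊤ : ℕ∞) g → ∀ ρ : ℝ,
      ContDiff ℝ (⊤ : ℕ∞) fun x => g (ρ • x) := fun hg ρ => hg.comp (by fun_prop)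
  induction K generalizing f m with
  | zero =>
    exact ⟨0, le_rfl, Eventually.of_forall fun ρ =>
      ⟨contDiff_const.mul (hsm hf ρ), fun w hw => by simp at hw⟩⟩
  | succ K ih =>
    obtain ⟨A, hA, r, hr, -, hfA⟩ := h.exists_bound isOpen_univ (mem_univ 0) hf.contDiffOn
    have hi : ∀ i, ∃ C ≥ 0, ∀ᶠ ρ in 𝓝[>] (0 : ℝ),
        DerivBound K (C * ρ) (_root_.pd i fun x => (ρ ^ m)⁻¹ * f (ρ • x)) := by
      intro i
      have e : ∀ ρ : ℝ, _root_.pd i (fun x => (ρ ^ m)⁻¹ * f (ρ • x))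
          = fun x => (ρ ^ m)⁻¹ * (ρ * _root_.pd i f (ρ • x)) := by
        intro ρ
        have h1 := pd_comp_homothety hf 0 ρ i
        simp only [zero_add] at h1
        ext x
        rw [pd_const_mul _ ((hsm hf ρ).differentiable (by simp) x), h1]
      simp only [e]
      cases m with
      | zero =>
        obtain ⟨C, hC, hfC⟩ := exists_of_contDiff K (hf.pd i)
        refine ⟨C, hC, ?_⟩
        filter_upwards [hle] with ρ hρ
        have h2 := (hfC.comp_homothety (z := 0) (by simp) hρ.1.le hρ.2).const_mul ρ
        simp only [smul_zero, zero_add, abs_of_pos hρ.1] at h2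
        simpa [mul_comm C] using h2
      | succ m =>
        obtain ⟨C, hC, hfC⟩ := ih (hf.pd i) (h.2 i)
        refine ⟨C, hC, ?_⟩
        filter_upwards [hle, hfC] with ρ hρ h2
        convert h2 using 2 with x
        have := hρ.1.ne'
        field_simp
        ring
    choose D hD hfD using hi
    have hsum : 0 ≤ ∑ i, D i := Finset.sum_nonneg fun i _ => hD i
    refine ⟨A + ∑ i, D i, by positivity, ?_⟩
    filter_upwards [hle, eventually_all.2 hfD, Ioo_mem_nhdsGT hr] with ρ hρ hρD hρr
    refine of_pd (contDiff_const.mul (hsm hf ρ)) (fun x hx => ?_) fun i => (hρD i).mono ?_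
    · have hx' : ‖ρ • x‖ ≤ ρ := by
        rw [norm_smul, Real.norm_of_nonneg hρ.1.le]
        exact mul_le_of_le_one_right hρ.1.le hx
      have h1 := hfA (ρ • x) (by simpa using hx'.trans_lt hρr.2)
      rw [sub_zero] at h1
      have h2 : A * ‖ρ • x‖ ^ (m + 1) ≤ A * ρ ^ (m + 1) := by gcongr
      have h3 := pow_pos hρ.1 m
      rw [abs_mul, abs_of_pos (inv_pos.2 h3), inv_mul_le_iff₀ h3]
      have h4 : 0 ≤ (∑ i, D i) * ρ * ρ ^ m := by have := hρ.1; positivity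
      calc _ ≤ A * ρ ^ (m + 1) := h1.trans h2
        _ ≤ ρ ^ m * ((A + ∑ i, D i) * ρ) := by rw [pow_succ]; linarith
    · have := Finset.single_le_sum (fun i _ => hD i) (Finset.mem_univ i)
      exact mul_le_mul_of_nonneg_right (by linarith) hρ.1.le

end DerivBound

/-- The monomial associated with a word of coordinate indices. -/
def wordProd (w : List (Fin n)) (x : Euc n) : ℝ := (w.map fun i => x i).prod

/-- A discrete functional supported on `K` points is controlled on functions with bounded
derivatives of order less than `K` by its moments of order less than `K`. -/
theorem exists_abs_sum_le_of_moments (n K : ℕ) :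
    ∃ C ≥ 0, ∀ (Z : Finset (Euc n)) (c h : Euc n → ℝ) (M ε : ℝ), Z.card ≤ K →
      (∀ z ∈ Z, ‖z‖ ≤ 1) → 0 ≤ M → 0 ≤ ε →
      (∀ w : List (Fin n), w.length < K → |∑ z ∈ Z, c z * wordProd w z| ≤ M) →
      DerivBound K ε h → |∑ z ∈ Z, c z * h z| ≤ C * ε * M := by
  classical
  induction K with
  | zero =>
    refine ⟨0, le_rfl, fun Z c h M ε hZ _ _ _ _ _ => ?_⟩
    have : Z = ∅ := by simpa using hZ
    simp [this]
  | succ K ih =>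
    obtain ⟨C, hC, ih⟩ := ih
    refine ⟨1 + 2 * n * C, by positivity, fun Z c h M ε hZ hZ1 hM hε hc hh => ?_⟩
    rcases Z.eq_empty_or_nonempty with rfl | ⟨z₀, hz₀⟩
    · simpa using by positivity
    set φ : ℝ → ℝ := fun τ => ∑ z ∈ Z, c z * h ((1 - τ) • z₀ + τ • z) with hφ
    set φ' : ℝ → ℝ := fun τ =>
      ∑ z ∈ Z, c z * ∑ j, (z j - z₀ j) * pd j h ((1 - τ) • z₀ + τ • z) with hφ'
    have hder : ∀ τ ∈ Icc (0 : ℝ) 1, HasDerivWithinAt φ (φ' τ) (Icc 0 1) τ := by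
      intro τ _
      refine HasDerivAt.hasDerivWithinAt (HasDerivAt.fun_sum fun z _ => HasDerivAt.const_mul _ ?_)
      have h1 : HasDerivAt (fun τ : ℝ => (1 - τ) • z₀ + τ • z) (z - z₀) τ := by
        have := (((hasDerivAt_id τ).const_sub 1).smul_const z₀).add
          ((hasDerivAt_id τ).smul_const z)
        convert! this using 1
        simp [sub_eq_neg_add]
      have h2 := (hh.1.differentiable (by simp) ((1 - τ) • z₀ + τ • z)).hasFDerivAt.comp_hasDerivAt
        τ h1
      rw [fderiv_apply_eq_sum_pd] at h2
      exact h2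
    have hbd : ∀ τ ∈ Ico (0 : ℝ) 1, ‖φ' τ‖ ≤ 2 * n * C * ε * M := by
      intro τ hτ
      have e : φ' τ = ∑ j, ∑ z ∈ Z.erase z₀, (c z * (z j - z₀ j)) *
          pd j h ((1 - τ) • z₀ + τ • z) := by
        rw [Finset.sum_comm, Finset.sum_erase _ (by simp)]
        exact Finset.sum_congr rfl fun z _ => by
          rw [Finset.mul_sum]; exact Finset.sum_congr rfl fun j _ => by ring
      rw [e, Real.norm_eq_abs]
      have hj : ∀ j, |∑ z ∈ Z.erase z₀, (c z * (z j - z₀ j)) * pd j h ((1 - τ) • z₀ + τ • z)|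
          ≤ C * ε * (2 * M) := by
        intro j
        refine ih (Z.erase z₀) (fun z => c z * (z j - z₀ j))
          (fun x => pd j h ((1 - τ) • z₀ + τ • x)) (2 * M) ε ?_ ?_ (by positivity) hε ?_ ?_
        · rw [Finset.card_erase_of_mem hz₀]; omega
        · exact fun z hz => hZ1 z (Finset.mem_of_mem_erase hz)
        · intro w hw
          rw [Finset.sum_erase _ (by simp)]
          have e2 : ∑ z ∈ Z, c z * (z j - z₀ j) * wordProd w z
              = ∑ z ∈ Z, c z * wordProd (j :: w) z - z₀ j * ∑ z ∈ Z, c z * wordProd w z := by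
            rw [Finset.mul_sum, ← Finset.sum_sub_distrib]
            exact Finset.sum_congr rfl fun z _ => by simp [wordProd]; ring
          have h3 := hc (j :: w) (by simpa using hw)
          have h4 := hc w (by omega)
          have h5 : |z₀ j| ≤ 1 := (PiLp.norm_apply_le z₀ j).trans (hZ1 z₀ hz₀)
          rw [e2]
          calc _ ≤ |∑ z ∈ Z, c z * wordProd (j :: w) z| +
                |z₀ j| * |∑ z ∈ Z, c z * wordProd w z| := by
                rw [← abs_mul]; exact abs_sub _ _
            _ ≤ M + 1 * M := add_le_add h3 (mul_le_mul h5 h4 (abs_nonneg _) zero_le_one)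
            _ = _ := by ring
        · exact (hh.pd j).comp_homothety (hZ1 z₀ hz₀) hτ.1 hτ.2.le
      calc _ ≤ ∑ j : Fin n, C * ε * (2 * M) :=
            (Finset.abs_sum_le_sum_abs _ _).trans (Finset.sum_le_sum fun j _ => hj j)
        _ = _ := by simp; ring
    have hmv := norm_image_sub_le_of_norm_deriv_le_segment_01' hder hbd
    have e1 : φ 1 = ∑ z ∈ Z, c z * h z := by simp [hφ]
    have e0 : φ 0 = (∑ z ∈ Z, c z) * h z₀ := by simp [hφ, Finset.sum_mul]
    have h0 : |φ 0| ≤ M * ε := by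
      rw [e0, abs_mul]
      exact mul_le_mul (by simpa [wordProd] using hc [] (by simp))
        (hh.2 [] (by simp) z₀ (hZ1 z₀ hz₀)) (abs_nonneg _) hM
    rw [← e1]
    rw [Real.norm_eq_abs] at hmv
    have := abs_sub_abs_le_abs_sub (φ 1) (φ 0)
    nlinarith

end Counting

section Counting

open MvPolynomial

variable {n : ℕ}

theorem prod_map_X_mem_idealOfVars_pow (w : List (Fin n)) :
    (w.map X).prod ∈ idealOfVars (Fin n) ℝ ^ w.length := by
  induction w with
  | nil => simp
  | cons i w ih =>
    rw [List.map_cons, List.prod_cons, List.length_cons, pow_succ']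
    exact Ideal.mul_mem_mul (Ideal.subset_span ⟨i, rfl⟩) ih

theorem polyFun_prod_map_X (w : List (Fin n)) : polyFun (w.map X).prod = wordProd w := by
  ext x
  simp [polyFun, wordProd, map_list_prod, Function.comp_def]

/-- Nontrivial weights on a large finite set annihilating finitely many functions. -/
theorem exists_weights {ι : Type*} [Fintype ι] (m : ι → Euc n → ℝ) {Z : Finset (Euc n)}
    (hZ : Fintype.card ι < Z.card) :
    ∃ c : Euc n → ℝ, (∀ e, ∑ z ∈ Z, c z * m e z = 0) ∧ ∃ z ∈ Z, c z ≠ 0 := by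
  classical
  let T : (Z → ℝ) →ₗ[ℝ] (ι → ℝ) :=
    { toFun := fun c e => ∑ z, c z * m e z
      map_add' := fun c d => by ext e; simp [add_mul, Finset.sum_add_distrib]
      map_smul' := fun r c => by ext e; simp [mul_assoc, Finset.mul_sum] }
  obtain ⟨c, hc, hc0⟩ := Submodule.exists_mem_ne_zero_of_ne_bot
    (T.ker_ne_bot_of_finrank_lt (by simpa using hZ))
  obtain ⟨z, hz⟩ := Function.ne_iff.1 hc0
  refine ⟨fun x => if h : x ∈ Z then c ⟨x, h⟩ else 0, fun e => ?_, z, z.2, by simpa using hz⟩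
  rw [← Finset.sum_attach]
  refine Eq.trans (Finset.sum_congr rfl fun x _ => ?_) (congrFun (LinearMap.mem_ker.1 hc) e)
  simp

/-- A finite set on which all moments of order less than its size vanish carries no weight. -/
theorem eq_zero_of_moments_eq_zero {Z : Finset (Euc n)} {c : Euc n → ℝ} (hZ : ∀ z ∈ Z, ‖z‖ ≤ 1)
    (h : ∀ w : List (Fin n), w.length < Z.card → ∑ z ∈ Z, c z * wordProd w z = 0) :
    ∀ z ∈ Z, c z = 0 := by
  classical
  intro z hz
  obtain ⟨C, hC, hmom⟩ := exists_abs_sum_le_of_moments n Z.card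
  set φ : Euc n → ℝ := fun x => ∏ y ∈ Z.erase z, ‖x - y‖ ^ 2 with hφ
  have hφs : ContDiff ℝ (⊤ : ℕ∞) φ :=
    contDiff_prod fun y _ => (contDiff_id.sub contDiff_const).norm_sq ℝ
  obtain ⟨ε, hε, hφε⟩ := DerivBound.exists_of_contDiff Z.card hφs
  have h1 := hmom Z c φ 0 ε le_rfl hZ le_rfl hε (fun w hw => by simp [h w hw]) hφε
  rw [mul_zero, abs_nonpos_iff, Finset.sum_eq_single z] at h1
  · refine (mul_eq_zero.1 h1).resolve_right (Finset.prod_ne_zero_iff.2 fun y hy => ?_)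
    have : z - y ≠ 0 := sub_ne_zero.2 (Finset.ne_of_mem_erase hy).symm
    positivity
  · intro y hy hyz
    have : φ y = 0 := Finset.prod_eq_zero (Finset.mem_erase.2 ⟨hyz, hy⟩) (by simp)
    rw [this, mul_zero]
  · exact fun h => absurd hz h

/-- Functions close to generators of an ideal of finite colength have a bounded number of common
zeros. -/
theorem exists_card_lt_of_derivBound {ι : Type*} [Fintype ι] (Q : ι → MvPolynomial (Fin n) ℝ)
    {N : ℕ} (hQ : idealOfVars (Fin n) ℝ ^ N ≤ Ideal.span (range Q)) :
    ∃ K : ℕ, ∃ ε > 0, ∀ f : ι → Euc n → ℝ,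
      (∀ l, DerivBound K ε fun x => f l x - polyFun (Q l) x) →
      ∀ Z : Finset (Euc n), (∀ z ∈ Z, ‖z‖ ≤ 1) → (∀ z ∈ Z, ∀ l, f l z = 0) → Z.card < K := by
  have hfin : ∀ k, Finite {w : List (Fin n) // w.length < k} := fun k =>
    (List.finite_length_lt (Fin n) k).to_subtype
  have hft : Fintype {w : List (Fin n) // w.length < N} := Fintype.ofFinite _
  set K := Fintype.card {w : List (Fin n) // w.length < N} + 1 with hK
  have hfK : Fintype {w : List (Fin n) // w.length < K} := Fintype.ofFinite _
  obtain ⟨C, hC, hmom⟩ := exists_abs_sum_le_of_moments n K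
  have hrep : ∀ w : List (Fin n), ∃ H : ι → MvPolynomial (Fin n) ℝ, N ≤ w.length →
      ∑ l, H l * Q l = (w.map X).prod := by
    intro w
    by_cases hw : N ≤ w.length
    · obtain ⟨H, hH⟩ := Ideal.mem_span_range_iff_exists_fun.1
        (hQ (Ideal.pow_le_pow_right hw (prod_map_X_mem_idealOfVars_pow w)))
      exact ⟨H, fun _ => hH⟩
    · exact ⟨0, fun h => absurd h hw⟩
  choose H hH using hrep
  choose D hD hDH using fun w l => DerivBound.exists_mul K (contDiff_polyFun (H w l))
  set B := ∑ w : {w : List (Fin n) // w.length < K}, ∑ l, C * D w.1 l with hB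
  have hB0 : 0 ≤ B :=
    Finset.sum_nonneg fun w _ => Finset.sum_nonneg fun l _ => mul_nonneg hC (hD _ _)
  refine ⟨K, (B + 1)⁻¹, by positivity, fun f hf Z hZ1 hZf => ?_⟩
  set ε := (B + 1)⁻¹ with hε
  have hε0 : 0 < ε := by positivity
  by_contra! hcard
  obtain ⟨Y, hYZ, hYK⟩ := Finset.exists_subset_card_eq hcard
  obtain ⟨c, hc, z, hz, hcz⟩ := exists_weights
    (fun w : {w : List (Fin n) // w.length < N} => wordProd w.1) (Z := Y) (by omega)
  set M := ∑ w : {w : List (Fin n) // w.length < K}, |∑ z ∈ Y, c z * wordProd w.1 z| with hM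
  have hM0 : 0 ≤ M := Finset.sum_nonneg fun _ _ => abs_nonneg _
  have hle : ∀ w : List (Fin n), w.length < K → |∑ z ∈ Y, c z * wordProd w z| ≤ M := fun w hw =>
    Finset.single_le_sum (f := fun w : {w : List (Fin n) // w.length < K} =>
      |∑ z ∈ Y, c z * wordProd w.1 z|) (fun _ _ => abs_nonneg _) (Finset.mem_univ ⟨w, hw⟩)
  have hY1 : ∀ z ∈ Y, ‖z‖ ≤ 1 := fun z hz => hZ1 z (hYZ hz)
  have hbd : ∀ w : List (Fin n), |∑ z ∈ Y, c z * wordProd w z| ≤ (∑ l, C * D w l) * (ε * M) := by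
    intro w
    by_cases hw : w.length < N
    · rw [hc ⟨w, hw⟩, abs_zero]
      have : 0 ≤ ∑ l, C * D w l := Finset.sum_nonneg fun l _ => mul_nonneg hC (hD _ _)
      positivity
    · have e : ∑ z ∈ Y, c z * wordProd w z
          = -∑ l, ∑ z ∈ Y, c z * (polyFun (H w l) z * (f l z - polyFun (Q l) z)) := by
        rw [Finset.sum_comm, ← Finset.sum_neg_distrib]
        refine Finset.sum_congr rfl fun z hz => ?_
        rw [← polyFun_prod_map_X, ← hH w (not_lt.1 hw)]
        simp_rw [hZf z (hYZ hz)]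
        simp [polyFun, Finset.mul_sum]
      rw [e, abs_neg, Finset.sum_mul]
      refine (Finset.abs_sum_le_sum_abs _ _).trans (Finset.sum_le_sum fun l _ => ?_)
      have := hmom Y c _ M (D w l * ε) hYK.le hY1 hM0 (mul_nonneg (hD w l) hε0.le) hle
        (hDH w l _ ε hε0.le (hf l))
      linarith
  have hMB : M ≤ B * (ε * M) := by
    rw [hB, Finset.sum_mul]
    exact Finset.sum_le_sum fun w _ => hbd w.1
  have hM00 : M = 0 := by
    have h1 : (B + 1) * ε = 1 := mul_inv_cancel₀ (by positivity)
    have h2 : B * (ε * M) = M - ε * M := by linear_combination M * h1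
    have h3 : ε * M ≤ 0 := by linarith
    exact le_antisymm (nonpos_of_mul_nonpos_right h3 hε0) hM0
  refine hcz (eq_zero_of_moments_eq_zero hY1 (fun w hw => ?_) z hz)
  have := hle w (by omega)
  rw [hM00] at this
  exact abs_nonpos_iff.1 this

end Counting

section Counting

open MvPolynomial

variable {n : ℕ}

theorem DerivBound.const {K : ℕ} {ε c : ℝ} (hε : 0 ≤ ε) (hc : |c| ≤ ε) :
    DerivBound K ε fun _ : Euc n => c := by
  induction K generalizing c with
  | zero => exact ⟨contDiff_const, fun w hw => by simp at hw⟩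
  | succ K ih =>
    refine of_pd contDiff_const (fun _ _ => hc) fun i => ?_
    rw [pd_const]
    exact ih (by simpa using hε)

theorem polyFun_smul {d : ℕ} {P : MvPolynomial (Fin n) ℝ} (hP : P.IsHomogeneous d) (ρ : ℝ)
    (x : Euc n) : polyFun P (ρ • x) = ρ ^ d * polyFun P x := by
  have := aeval_mul_of_isHomogeneous hP ρ (fun k => x k)
  simpa [polyFun, aeval_eq_eval, mul_comm] using this

/-- Uniform bound for the number of critical zeros near the origin with prescribed coordinates
outside of a coordinate plane. -/
theorem exists_card_fiber_le {m N : ℕ} {v : Euc n → ℝ} {P : MvPolynomial (Fin n) ℝ}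
    (hv : ContDiff ℝ (⊤ : ℕ∞) v) (hP : P.IsHomogeneous (m + 1))
    (hvP : SFlat (m + 2) (fun y => v y - polyFun P y) 0) {i j : Fin n}
    (hN : idealOfVars (Fin n) ℝ ^ N ≤ Ideal.span (range (critFamily P i j))) :
    ∃ r > 0, ∃ M : ℕ, ∀ Z : Finset (Euc n), (∀ z ∈ Z, z ∈ ball 0 r) →
      (∀ z ∈ Z, v z = 0 ∧ ∀ l, pd l v z = 0) →
      (∀ x ∈ Z, ∀ y ∈ Z, forgetPair i j x = forgetPair i j y) → Z.card ≤ M := by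
  classical
  obtain ⟨K, ε, hε, hK⟩ := exists_card_lt_of_derivBound (critFamily P i j) hN
  have hw : ContDiff ℝ (⊤ : ℕ∞) fun y => v y - polyFun P y := hv.sub (contDiff_polyFun P)
  obtain ⟨C, hC, hCw⟩ := DerivBound.exists_blowup K hw hvP
  choose D hD hDw using fun l => DerivBound.exists_blowup K (hw.pd l) (hvP.2 l)
  have hDs : 0 ≤ ∑ l, D l := Finset.sum_nonneg fun l _ => hD l
  have hsmall : ∀ᶠ ρ in 𝓝[>] (0 : ℝ), 0 < ρ ∧ (C + ∑ l, D l) * ρ ≤ ε := by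
    have h1 : Tendsto (fun ρ : ℝ => (C + ∑ l, D l) * ρ) (𝓝[>] 0) (𝓝 0) := by
      have : Continuous fun ρ : ℝ => (C + ∑ l, D l) * ρ := by fun_prop
      simpa using (this.tendsto 0).mono_left nhdsWithin_le_nhds
    filter_upwards [self_mem_nhdsWithin, h1.eventually (gt_mem_nhds hε)] with ρ h2 h3
      using ⟨h2, h3.le⟩
  obtain ⟨ρ, ⟨hρ, hρε⟩, hρC, hρD⟩ := (hsmall.and (hCw.and (eventually_all.2 hDw))).exists
  refine ⟨min ε 1 * ρ, by positivity, K, fun Z hZr hZv hZf => ?_⟩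
  rcases Z.eq_empty_or_nonempty with rfl | ⟨z₀, hz₀⟩
  · simp
  have hZn : ∀ z ∈ Z, ‖z‖ ≤ min ε 1 * ρ := fun z hz => (mem_ball_zero_iff.1 (hZr z hz)).le
  have hpw : ∀ l x, pd l (fun y => v y - polyFun P y) x = pd l v x - polyFun (pderiv l P) x := by
    intro l x
    rw [pd_sub (hv.differentiable (by simp) x) ((contDiff_polyFun P).differentiable (by simp) x),
      pd_polyFun]
  set f : Unit ⊕ Fin n ⊕ {k : Fin n // k ≠ i ∧ k ≠ j} → Euc n → ℝ :=
    Sum.elim (fun _ x => (ρ ^ (m + 1))⁻¹ * v (ρ • x)) (Sum.elim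
      (fun l x => (ρ ^ m)⁻¹ * pd l v (ρ • x)) fun k x => x k.1 - ρ⁻¹ * z₀ k.1) with hf
  have hle : ∀ l, D l * ρ ≤ ε := fun l => by
    have := Finset.single_le_sum (fun i _ => hD i) (Finset.mem_univ l)
    refine le_trans (mul_le_mul_of_nonneg_right ?_ hρ.le) hρε
    linarith
  have hfQ : ∀ l, DerivBound K ε fun x => f l x - polyFun (critFamily P i j l) x := by
    rintro (_ | l | k)
    · refine (hρC.mono (le_trans (mul_le_mul_of_nonneg_right (by linarith) hρ.le) hρε)).congr
        fun x => ?_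
      simp only [polyFun_smul hP, hf, critFamily, Sum.elim_inl]
      field_simp
    · refine ((hρD l).mono (hle l)).congr fun x => ?_
      have hPl : (pderiv l P).IsHomogeneous m := by simpa using hP.pderiv (i := l)
      simp only [hpw, polyFun_smul hPl, hf, critFamily, Sum.elim_inl, Sum.elim_inr]
      field_simp
    · refine (DerivBound.const hε.le (c := -(ρ⁻¹ * z₀ k.1)) ?_).congr fun x => ?_
      · have h1 : |z₀ k.1| ≤ ε * ρ := (PiLp.norm_apply_le z₀ k.1).trans
          ((hZn z₀ hz₀).trans (mul_le_mul_of_nonneg_right (min_le_left _ _) hρ.le))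
        rw [abs_neg, abs_mul, abs_of_pos (inv_pos.2 hρ), inv_mul_le_iff₀ hρ]
        linarith
      · simp [hf, critFamily, polyFun]
  have hinj : Function.Injective fun z : Euc n => ρ⁻¹ • z :=
    smul_right_injective _ (inv_ne_zero hρ.ne')
  have hlt := hK f hfQ (Z.image fun z => ρ⁻¹ • z) ?_ ?_
  · rw [Finset.card_image_of_injective _ hinj] at hlt
    exact hlt.le
  · simp only [Finset.forall_mem_image]
    intro z hz
    rw [norm_smul, norm_inv, Real.norm_of_nonneg hρ.le, inv_mul_le_iff₀ hρ]
    exact (hZn z hz).trans (by rw [mul_one]; exact mul_le_of_le_one_left hρ.le (min_le_right _ _))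
  · simp only [Finset.forall_mem_image]
    intro z hz l
    have e : ρ • ρ⁻¹ • z = z := smul_inv_smul₀ hρ.ne' z
    rcases l with _ | l | k
    · simp [hf, e, (hZv z hz).1]
    · simp [hf, e, (hZv z hz).2 l]
    · have h1 : z k.1 = z₀ k.1 := congrFun (hZf z hz z₀ hz₀) k
      simp [hf, h1]

end Counting

section LocallyFinite

variable {n : ℕ}

theorem exists_minor_ne_zero_comp_affine {f g : Euc n → ℝ} (hf : ContDiff ℝ (⊤ : ℕ∞) f)
    (hg : ContDiff ℝ (⊤ : ℕ∞) g) (L : Euc n ≃L[ℝ] Euc n) (p y : Euc n)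
    (h : ∃ i j, pd i f (p + L y) * pd j g (p + L y) - pd j f (p + L y) * pd i g (p + L y) ≠ 0) :
    ∃ i j, pd i (fun z => f (p + L z)) y * pd j (fun z => g (p + L z)) y
      - pd j (fun z => f (p + L z)) y * pd i (fun z => g (p + L z)) y ≠ 0 := by
  by_contra! hcon
  obtain ⟨i, j, hij⟩ := h
  have key : ∀ {f : Euc n → ℝ}, ContDiff ℝ (⊤ : ℕ∞) f → ∀ i, pd i f (p + L y)
      = ∑ k, L.symm (EuclideanSpace.single i 1) k * pd k (fun z => f (p + L z)) y := by
    intro f hf i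
    have hs : ContDiff ℝ (⊤ : ℕ∞) fun z => f (p + L z) := hf.comp_affine (L : Euc n →L[ℝ] Euc n) p
    have h1 := pd_comp_affine (hs.differentiable (by simp)) (L.symm : Euc n →L[ℝ] Euc n)
      (-L.symm p) (p + L y) i
    have e : (fun x => f (p + L (-L.symm p + (L.symm : Euc n →L[ℝ] Euc n) x))) = f := by
      ext x; simp
    rw [e] at h1
    simpa using h1
  refine hij ?_
  rw [key hf, key hg, key hf, key hg, Finset.sum_mul_sum, Finset.sum_mul_sum,
    Finset.sum_comm (γ := Fin n) (s := Finset.univ) (t := Finset.univ)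
      (f := fun k l => L.symm (EuclideanSpace.single j 1) k * pd k (fun z => f (p + L z)) y
        * (L.symm (EuclideanSpace.single i 1) l * pd l (fun z => g (p + L z)) y)),
    ← Finset.sum_sub_distrib]
  refine Finset.sum_eq_zero fun k _ => ?_
  rw [← Finset.sum_sub_distrib]
  refine Finset.sum_eq_zero fun l _ => ?_
  linear_combination L.symm (EuclideanSpace.single i 1) k * L.symm (EuclideanSpace.single j 1) l
    * hcon k l

/-- Finiteness of the codimension-two Hausdorff measure from fibre counts over the coordinate
planes. -/
theorem hausdorffMeasure_lt_top_of_card_fibers (hn : 2 ≤ n) {S : Set (Euc n)}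
    (hS : MeasurableSet S) (hb : Bornology.IsBounded S) {ι : Type*} [Countable ι]
    {Φ : ι → Euc n → ℝ} (hΦ : ∀ e, ContDiff ℝ (⊤ : ℕ∞) (Φ e))
    (hΦS : ∀ x ∈ S, ∃ e₁ e₂, Φ e₁ x = 0 ∧ Φ e₂ x = 0 ∧
      ∃ i j, pd i (Φ e₁) x * pd j (Φ e₂) x - pd j (Φ e₁) x * pd i (Φ e₂) x ≠ 0)
    (hM : ∀ i j, i ≠ j → ∃ M : ℕ, ∀ Z : Finset (Euc n), (Z : Set (Euc n)) ⊆ S →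
      (∀ x ∈ Z, ∀ y ∈ Z, forgetPair i j x = forgetPair i j y) → Z.card ≤ M) :
    μH[(n : ℝ) - 2] S < ⊤ := by
  set A : Fin n → Fin n → Set (Euc n) → Prop := fun i j V => ∀ x ∈ V, ∀ y ∈ V,
    dist x y ≤ ((6 * n : ℝ≥0) : ℝ) * dist (forgetPair i j x) (forgetPair i j y) with hA
  set piece : ι × ι × TopologicalSpace.countableBasis (Euc n) → Set (Euc n) :=
    fun q => (q.2.2 : Set (Euc n)) ∩ {x | Φ q.1 x = 0 ∧ Φ q.2.1 x = 0} with hpiece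
  set 𝒱 : Fin n → Fin n → Set (Set (Euc n)) := fun i j =>
    insert ∅ {V | V ∈ range piece ∧ A i j V} with h𝒱
  have hcount : ∀ i j, (𝒱 i j).Countable := fun i j =>
    have := (TopologicalSpace.countable_countableBasis (Euc n)).to_subtype
    ((countable_range piece).mono fun _ h => h.1).insert ∅
  have hmeas : ∀ i j, ∀ V ∈ 𝒱 i j, MeasurableSet V := by
    rintro i j V (rfl | ⟨⟨q, rfl⟩, -⟩)
    · exact MeasurableSet.empty
    · refine (TopologicalSpace.isOpen_of_mem_countableBasis q.2.2.2).measurableSet.inter ?_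
      exact ((isClosed_eq (hΦ _).continuous continuous_const).inter
        (isClosed_eq (hΦ _).continuous continuous_const)).measurableSet
  have hAV : ∀ i j, ∀ V ∈ 𝒱 i j, A i j V := by
    rintro i j V (rfl | ⟨-, h⟩)
    · exact fun x hx => absurd hx (notMem_empty x)
    · exact h
  have hcover : S ⊆ ⋃ q : {q : Fin n × Fin n // q.1 ≠ q.2}, S ∩ ⋃₀ 𝒱 q.1.1 q.1.2 := by
    intro x hx
    obtain ⟨e₁, e₂, h1, h2, h3⟩ := hΦS x hx
    obtain ⟨i, j, hij, W, hW, hd⟩ := exists_dist_le_forgetPair isOpen_univ (hΦ e₁).contDiffOn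
      (hΦ e₂).contDiffOn (mem_univ x) h3
    obtain ⟨b, hb, hxb, hbW⟩ :=
      (TopologicalSpace.isBasis_countableBasis (Euc n)).mem_nhds_iff.1 hW
    refine mem_iUnion.2 ⟨⟨(i, j), hij⟩, hx, piece (e₁, e₂, ⟨b, hb⟩), ?_, hxb, h1, h2⟩
    refine mem_insert_of_mem _ ⟨mem_range_self _, fun y hy z hz => ?_⟩
    simpa using hd y (hbW hy.1) z (hbW hz.1) hy.2.1 hy.2.2 hz.2.1 hz.2.2
  have hfin : ∀ q : {q : Fin n × Fin n // q.1 ≠ q.2},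
      μH[(n : ℝ) - 2] (S ∩ ⋃₀ 𝒱 q.1.1 q.1.2) < ⊤ := by
    rintro ⟨⟨i, j⟩, hij⟩
    obtain ⟨V, hV⟩ := (hcount i j).exists_eq_range (insert_nonempty _ _)
    have hVm : ∀ m, V m ∈ 𝒱 i j := fun m => hV ▸ mem_range_self m
    obtain ⟨M, hM⟩ := hM i j hij
    have e : ((Fintype.card {k : Fin n // k ≠ i ∧ k ≠ j} : ℕ) : ℝ) = (n : ℝ) - 2 := by
      rw [card_compl_pair hij, Nat.cast_sub hn]
      rfl
    rw [← e]
    refine hausdorffMeasure_lt_top_of_fibers (continuous_forgetPair i j) (K := 6 * n) (V := V)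
      (M := M) ?_ ?_ (fun m => hmeas i j _ (hVm m)) ?_ ?_ ?_
    · exact hS.inter (MeasurableSet.sUnion (hcount i j) (hmeas i j))
    · exact (hb.isCompact_closure.image (continuous_forgetPair i j)).isBounded.subset
        (image_mono (inter_subset_left.trans subset_closure))
    · rintro x ⟨-, W, hW, hxW⟩
      rw [hV] at hW
      obtain ⟨m, rfl⟩ := hW
      exact mem_iUnion.2 ⟨m, hxW⟩
    · exact fun m x hx y hy => hAV i j _ (hVm m) x hx.2 y hy.2
    · exact fun Z hZ => hM Z (hZ.trans inter_subset_left)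
  refine (measure_mono hcover).trans_lt ((measure_iUnion_le _).trans_lt ?_)
  rw [tsum_fintype]
  exact ENNReal.sum_lt_top.2 fun q _ => hfin q

end LocallyFinite

section CriticalNodalSet

open MvPolynomial

variable {n : ℕ} {U : Set (Euc n)} {p : Euc n} {u : Euc n → ℝ} {a : Fin n → Fin n → Euc n → ℝ}
  {F : Euc n → ℝ → Euc n → ℝ}

theorem gradient_eq_zero_iff {x : Euc n} : gradient u x = 0 ↔ ∀ i, pd i u x = 0 := by
  refine ⟨fun h i => by rw [← gradient_apply_eq_pd, h]; rfl, fun h => ?_⟩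
  ext i
  rw [gradient_apply_eq_pd, h i]
  rfl

theorem exists_sflat_of_not_sflat (h : ∃ k, ¬ SFlat k u p) (h0 : u p = 0)
    (h1 : ∀ i, pd i u p = 0) : ∃ k, SFlat (k + 2) u p ∧ ¬ SFlat (k + 3) u p := by
  classical
  have h2 : SFlat 2 u p := ⟨h0, fun i => ⟨h1 i, fun _ => trivial⟩⟩
  have h3 : 2 < Nat.find h := by
    by_contra! hle
    exact Nat.find_spec h (h2.mono hle)
  obtain ⟨k, hk⟩ := Nat.exists_eq_add_of_lt h3
  refine ⟨k, not_not.1 (Nat.find_min h (m := k + 2) (by omega)), ?_⟩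
  have := Nat.find_spec h
  rwa [hk, show 2 + k + 1 = k + 3 by ring] at this

theorem pd_comp_affine_eq_zero_iff {f : Euc n → ℝ} (hf : ContDiff ℝ (⊤ : ℕ∞) f)
    (L : Euc n ≃L[ℝ] Euc n) (p y : Euc n) :
    (∀ i, pd i (fun z => f (p + L z)) y = 0) ↔ ∀ i, pd i f (p + L y) = 0 := by
  have h : ∀ {f : Euc n → ℝ}, ContDiff ℝ (⊤ : ℕ∞) f → ∀ (L : Euc n ≃L[ℝ] Euc n) (p y : Euc n),
      (∀ i, pd i f (p + L y) = 0) → ∀ i, pd i (fun z => f (p + L z)) y = 0 := by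
    intro f hf L p y h i
    have := pd_comp_affine (hf.differentiable (by simp)) (L : Euc n →L[ℝ] Euc n) p y i
    simpa [h] using this
  refine ⟨fun h0 => ?_, h hf L p y⟩
  have hs : ContDiff ℝ (⊤ : ℕ∞) fun z => f (p + L z) := hf.comp_affine (L : Euc n →L[ℝ] Euc n) p
  have h1 := h hs L.symm (-L.symm p) (p + L y) (by simpa using h0)
  simpa using h1

/-- Local finiteness of the codimension-two measure near a zero of finite order. -/
theorem exists_hausdorffMeasure_lt_top (hn : 2 ≤ n) (hU : IsOpen U)
    (ha : ∀ i j, ContDiffOn ℝ (⊤ : ℕ∞) (a i j) U)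
    (hsym : ∀ i j, ∀ x ∈ U, a i j x = a j i x)
    (hpos : ∀ x ∈ U, ∀ ξ : Euc n, ξ ≠ 0 → 0 < ∑ i, ∑ j, a i j x * ξ i * ξ j)
    (hF : ContDiffOn ℝ (⊤ : ℕ∞) (fun p : Euc n × ℝ × Euc n => F p.1 p.2.1 p.2.2)
      (U ×ˢ (univ : Set (ℝ × Euc n))))
    (hF0 : ∀ x ∈ U, F x 0 0 = 0) (hu : ContDiffOn ℝ (⊤ : ℕ∞) u U)
    (hpde : ∀ x ∈ U, ∑ i, ∑ j, a i j x * pd i (pd j u) x = F x (u x) (gradient u x))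
    (hfin : ∀ x ∈ U, ∃ k, ¬ SFlat k u x) (hp : p ∈ U) (hp0 : u p = 0)
    (hp1 : ∀ i, pd i u p = 0) :
    ∃ r > 0, μH[(n : ℝ) - 2] ({x ∈ U | u x = 0 ∧ ∀ i, pd i u x = 0} ∩ ball p r) < ⊤ := by
  obtain ⟨k, hk, hk'⟩ := exists_sflat_of_not_sflat (hfin p hp) hp0 hp1
  obtain ⟨r₀, hr₀, hrU, u', hu's, huu, L, -, P, hP, hvP, N, hN⟩ :=
    exists_normal_form hU ha hsym hpos hF hF0 hu hpde hp hk hk'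
  have hpu : ∀ i, EqOn (pd i u) (pd i u') (ball p r₀) := pd_congr isOpen_ball huu
  set v : Euc n → ℝ := fun y => u' (p + L y) with hv
  have hvs : ContDiff ℝ (⊤ : ℕ∞) v := hu's.comp_affine (L : Euc n →L[ℝ] Euc n) p
  have hcard : ∀ i j, ∀ᶠ ρ in 𝓝[>] (0 : ℝ), i < j → ∃ M : ℕ, ∀ Z : Finset (Euc n),
      (∀ z ∈ Z, z ∈ ball 0 ρ) → (∀ z ∈ Z, v z = 0 ∧ ∀ l, pd l v z = 0) →
      (∀ x ∈ Z, ∀ y ∈ Z, forgetPair i j x = forgetPair i j y) → Z.card ≤ M := by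
    intro i j
    by_cases hij : i < j
    · obtain ⟨r, hr, M, hM⟩ := exists_card_fiber_le hvs hP hvP (hN i j hij)
      filter_upwards [Ioo_mem_nhdsGT hr] with ρ hρ _
      exact ⟨M, fun Z hZ => hM Z fun z hz => ball_subset_ball hρ.2.le (hZ z hz)⟩
    · exact Eventually.of_forall fun _ h => absurd h hij
  have hball : ∀ᶠ ρ in 𝓝[>] (0 : ℝ), ∀ y ∈ ball (0 : Euc n) ρ, p + L y ∈ ball p r₀ := by
    have hc : Continuous fun y => p + L y := by fun_prop
    obtain ⟨s, hs, hsb⟩ := Metric.eventually_nhds_iff_ball.1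
      (hc.continuousAt.eventually (by simpa using! ball_mem_nhds p hr₀ : ball p r₀ ∈ 𝓝 (p + L 0)))
    filter_upwards [Ioo_mem_nhdsGT hs] with ρ hρ y hy
      using hsb y (ball_subset_ball hρ.2.le hy)
  have hρpos : ∀ᶠ ρ in 𝓝[>] (0 : ℝ), 0 < ρ := self_mem_nhdsWithin
  obtain ⟨ρ, hρ, hρball, hρcard⟩ :=
    (hρpos.and (hball.and (eventually_all.2 fun i => eventually_all.2 (hcard i)))).exists
  set S : Set (Euc n) := ball 0 ρ ∩ {y | v y = 0 ∧ ∀ l, pd l v y = 0} with hS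
  have hSm : MeasurableSet S := by
    have h : {y | v y = 0 ∧ ∀ l, pd l v y = 0} = {y | v y = 0} ∩ ⋂ l, {y | pd l v y = 0} := by
      ext y
      simp
    rw [hS, h]
    exact measurableSet_ball.inter ((isClosed_eq hvs.continuous continuous_const).inter
      (isClosed_iInter fun l => isClosed_eq (hvs.pd l).continuous continuous_const)).measurableSet
  have hScrit : ∀ y ∈ S, u (p + L y) = 0 ∧ ∀ i, pd i u (p + L y) = 0 := fun y hy => by
    have hb := hρball y hy.1
    refine ⟨by rw [huu hb]; exact hy.2.1, fun i => ?_⟩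
    rw [hpu i hb]
    exact (pd_comp_affine_eq_zero_iff hu's L p y).1 hy.2.2 i
  have hfinS : μH[(n : ℝ) - 2] S < ⊤ := by
    refine hausdorffMeasure_lt_top_of_card_fibers hn hSm (isBounded_ball.subset inter_subset_left)
      (Φ := fun (w : List (Fin n)) y => pdw w u' (p + L y))
      (fun w => (hu's.pdw w).comp_affine (L : Euc n →L[ℝ] Euc n) p) (fun y hy => ?_)
      fun i j hij => ?_
    · have hb := hρball y hy.1
      obtain ⟨h0, h1⟩ := hScrit y hy
      obtain ⟨m, hm, hm'⟩ := exists_sflat_of_not_sflat (hfin _ (hrU hb)) h0 h1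
      obtain ⟨w₁, w₂, e1, e2, i, j, hij⟩ :=
        exists_independent_pd hU ha hpos hF hF0 hu hpde (hrU hb) hm hm'
      have hw : ∀ w, EqOn (pdw w u) (pdw w u') (ball p r₀) := pdw_congr isOpen_ball huu
      have hw' : ∀ i w, EqOn (pd i (pdw w u)) (pd i (pdw w u')) (ball p r₀) := fun i w =>
        pd_congr isOpen_ball (hw w) i
      refine ⟨w₁, w₂, by rw [← hw w₁ hb, e1], by rw [← hw w₂ hb, e2],
        exists_minor_ne_zero_comp_affine (hu's.pdw w₁) (hu's.pdw w₂) L p y ⟨i, j, ?_⟩⟩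
      rwa [← hw' _ _ hb, ← hw' _ _ hb, ← hw' _ _ hb, ← hw' _ _ hb]
    · rcases lt_or_gt_of_ne hij with h | h
      · obtain ⟨M, hM⟩ := hρcard i j h
        exact ⟨M, fun Z hZ => hM Z (fun z hz => (hZ hz).1) fun z hz => (hZ hz).2⟩
      · obtain ⟨M, hM⟩ := hρcard j i h
        refine ⟨M, fun Z hZ hf => hM Z (fun z hz => (hZ hz).1) (fun z hz => (hZ hz).2)
          fun x hx y hy => ?_⟩
        ext l
        exact congrFun (hf x hx y hy) ⟨l, l.2.symm⟩
  have hLc : ContinuousAt (fun x => L.symm (x - p)) p := by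
    have : Continuous fun x => L.symm (x - p) := by fun_prop
    exact this.continuousAt
  obtain ⟨s, hs, hsb⟩ := Metric.eventually_nhds_iff_ball.1
    (hLc.eventually (by simpa using! ball_mem_nhds (0 : Euc n) hρ :
      ball (0 : Euc n) ρ ∈ 𝓝 (L.symm (p - p))))
  refine ⟨min s r₀, lt_min hs hr₀, ?_⟩
  have hsub : {x ∈ U | u x = 0 ∧ ∀ i, pd i u x = 0} ∩ ball p (min s r₀)
      ⊆ (fun y => p + L y) '' S := by
    rintro x ⟨⟨-, hx0, hx1⟩, hxb⟩
    have hx : p + L (L.symm (x - p)) = x := by simp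
    have hxr : x ∈ ball p r₀ := ball_subset_ball (min_le_right _ _) hxb
    refine ⟨L.symm (x - p), ⟨hsb x (ball_subset_ball (min_le_left _ _) hxb), ?_, ?_⟩, hx⟩
    · simp only [hv, hx]
      rw [← huu hxr, hx0]
    · refine (pd_comp_affine_eq_zero_iff hu's L p _).2 fun i => ?_
      rw [hx, ← hpu i hxr, hx1 i]
  have hLip : LipschitzWith ‖(L : Euc n →L[ℝ] Euc n)‖₊ fun y => p + L y := by
    refine LipschitzWith.of_dist_le_mul fun x y => ?_
    rw [dist_add_left]
    exact (L : Euc n →L[ℝ] Euc n).lipschitz.dist_le_mul x y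
  have hn2 : (0 : ℝ) ≤ (n : ℝ) - 2 := by
    have : (2 : ℝ) ≤ n := by exact_mod_cast hn
    linarith
  refine (measure_mono hsub).trans_lt ((hLip.hausdorffMeasure_image_le hn2 S).trans_lt ?_)
  exact ENNReal.mul_lt_top (ENNReal.rpow_lt_top_of_nonneg hn2 (by simp)) hfinS

/-- Rectifiability of the critical nodal set. -/
theorem countablyCinfRectifiable_critical_nodal_set (hU : IsOpen U)
    (ha : ∀ i j, ContDiffOn ℝ (⊤ : ℕ∞) (a i j) U)
    (hpos : ∀ x ∈ U, ∀ ξ : Euc n, ξ ≠ 0 → 0 < ∑ i, ∑ j, a i j x * ξ i * ξ j)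
    (hF : ContDiffOn ℝ (⊤ : ℕ∞) (fun p : Euc n × ℝ × Euc n => F p.1 p.2.1 p.2.2)
      (U ×ˢ (univ : Set (ℝ × Euc n))))
    (hF0 : ∀ x ∈ U, F x 0 0 = 0) (hu : ContDiffOn ℝ (⊤ : ℕ∞) u U)
    (hpde : ∀ x ∈ U, ∑ i, ∑ j, a i j x * pd i (pd j u) x = F x (u x) (gradient u x))
    (hfin : ∀ x ∈ U, ∃ k, ¬ SFlat k u x) :
    CountablyCinfRectifiable (n - 2) {x ∈ U | u x = 0 ∧ ∀ i, pd i u x = 0} := by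
  set R : List (Fin n) × List (Fin n) → Set (Euc n) := fun q =>
    {x ∈ U | pdw q.1 u x = 0 ∧ pdw q.2 u x = 0 ∧ ∃ i j,
      pd i (pdw q.1 u) x * pd j (pdw q.2 u) x - pd j (pdw q.1 u) x * pd i (pdw q.2 u) x ≠ 0} with hR
  have h1 : CountablyCinfRectifiable (n - 2) (⋃ q, R q) := by
    refine CountablyCinfRectifiable.iUnion fun q => .of_locally ?_
    rintro x ⟨hx, h0, h0', i, j, hij⟩
    obtain ⟨W, hW, φ, hφ, hφr⟩ :=
      exists_param_of_minor_ne_zero hU (hu.pdw hU q.1) (hu.pdw hU q.2) hx h0 h0' hij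
    exact ⟨W, hW, φ, hφ, fun y hy => hφr ⟨hy.2, hy.1.2.1, hy.1.2.2.1⟩⟩
  obtain ⟨g, hg, hgr⟩ := h1
  refine ⟨g, hg, Subset.trans ?_ hgr⟩
  rintro x ⟨hx, h0, h0'⟩
  obtain ⟨k, hk, hk'⟩ := exists_sflat_of_not_sflat (hfin x hx) h0 h0'
  obtain ⟨w₁, w₂, h⟩ := exists_independent_pd hU ha hpos hF hF0 hu hpde hx hk hk'
  exact mem_iUnion.2 ⟨(w₁, w₂), hx, h⟩

theorem CountablyCinfRectifiable.dimH_le {m : ℕ} {S : Set (Euc n)}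
    (h : CountablyCinfRectifiable m S) : dimH S ≤ m := by
  obtain ⟨g, hg, hS⟩ := h
  refine (dimH_mono hS).trans ?_
  rw [dimH_iUnion]
  refine iSup_le fun i => ?_
  simpa using ((hg i).of_le (by simp)).dimH_range_le

end CriticalNodalSet

/-- For a nontrivial smooth solution `u` of a scalar semilinear elliptic
second-order equation respecting the zero section on an open connected `U ⊆ ℝⁿ`, `n ≥ 2`,
the critical nodal set `N_crit(u) = {u = 0, ∇u = 0}` is countably `(n−2)`-`C^∞`-rectifiable
and has locally finite `(n−2)`-dimensional Hausdorff measure; in particular its Hausdorff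
dimension is at most `n − 2`. -/
theorem critical_nodal_set_rectifiable_scalar_second_order
    (n : ℕ) (hn : 2 ≤ n)
    (U : Set (Euc n)) (hUopen : IsOpen U) (hUconn : IsConnected U)
    (a : Fin n → Fin n → Euc n → ℝ)
    (ha : ∀ i j, ContDiffOn ℝ (⊤ : ℕ∞) (a i j) U)
    (hsym : ∀ i j, ∀ x ∈ U, a i j x = a j i x)
    (hpos : ∀ x ∈ U, ∀ ξ : Euc n, ξ ≠ 0 → 0 < ∑ i, ∑ j, a i j x * ξ i * ξ j)
    (F : Euc n → ℝ → Euc n → ℝ)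
    (hF : ContDiffOn ℝ (⊤ : ℕ∞) (fun p : Euc n × ℝ × Euc n => F p.1 p.2.1 p.2.2)
      (U ×ˢ (univ : Set (ℝ × Euc n))))
    (hF0 : ∀ x ∈ U, F x 0 0 = 0)
    (u : Euc n → ℝ) (hu : ContDiffOn ℝ (⊤ : ℕ∞) u U)
    (heq : ∀ x ∈ U, scalarOp a F u x = 0)
    (hnontriv : ∃ x ∈ U, u x ≠ 0) :
    CountablyCinfRectifiable (n - 2) {x ∈ U | u x = 0 ∧ gradient u x = 0} ∧
      (∀ p ∈ U, ∃ r > 0,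
        μH[(n : ℝ) - 2] ({x ∈ U | u x = 0 ∧ gradient u x = 0} ∩ ball p r) < ⊤) ∧
      dimH {x ∈ U | u x = 0 ∧ gradient u x = 0} ≤ (n : ℝ≥0∞) - 2 := by
  have hcrit : {x ∈ U | u x = 0 ∧ gradient u x = 0} = {x ∈ U | u x = 0 ∧ ∀ i, pd i u x = 0} := by
    simp only [gradient_eq_zero_iff]
  have hpde : ∀ x ∈ U, ∑ i, ∑ j, a i j x * pd i (pd j u) x = F x (u x) (gradient u x) := by
    intro x hx
    have h := heq x hx
    simp only [scalarOp, iteratedFDeriv_two_eq_pd hUopen hu hx] at h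
    linarith
  have hfin : ∀ x ∈ U, ∃ k, ¬ SFlat k u x := fun x hx =>
    exists_not_sflat (by omega) hUopen hUconn ha hsym hpos hF hF0 hu hpde hnontriv hx
  have hrect := countablyCinfRectifiable_critical_nodal_set hUopen ha hpos hF hF0 hu hpde hfin
  rw [hcrit]
  refine ⟨hrect, fun p hp => ?_, ?_⟩
  · by_cases hp' : u p = 0 ∧ ∀ i, pd i u p = 0
    · exact exists_hausdorffMeasure_lt_top hn hUopen ha hsym hpos hF hF0 hu hpde hfin hp hp'.1 hp'.2
    have hev : ∀ᶠ x in 𝓝 p, ¬ (u x = 0 ∧ ∀ i, pd i u x = 0) := by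
      rcases not_and_or.1 hp' with h | h
      · filter_upwards [(hu.continuousOn.continuousAt (hUopen.mem_nhds hp)).eventually_ne h]
          with x hx hx' using hx hx'.1
      · obtain ⟨i, hi⟩ := not_forall.1 h
        filter_upwards [((hu.pd hUopen i).continuousOn.continuousAt
          (hUopen.mem_nhds hp)).eventually_ne hi] with x hx hx' using hx (hx'.2 i)
    obtain ⟨r, hr, hball⟩ := Metric.eventually_nhds_iff_ball.1 hev
    refine ⟨r, hr, ?_⟩
    have hempty : {x ∈ U | u x = 0 ∧ ∀ i, pd i u x = 0} ∩ ball p r = ∅ :=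
      eq_empty_of_forall_notMem fun x hx => hball x hx.2 hx.1.2
    rw [hempty, measure_empty]
    exact ENNReal.zero_lt_top
  · simpa using hrect.dimH_le
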